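/- Let n ≥ 1 and 0 < λ ≤ Λ, and let F satisfy uniform ellipticity and positive homogeneity. Then there exist unique constants α⁺ > 0 and α⁻ > 0 for which the equation u_t + F(D²u) = 0 in ℝⁿ×ℝ₊ possesses viscosity solutions Φ⁺ > 0 and Φ⁻ < 0 satisfying the self-similarity relations Φ⁺(x,t) = σ^{α⁺} Φ⁺(σ^{1/2}x, σt) and Φ⁻(x,t) = σ^{α⁻} Φ⁻(σ^{1/2}x, σt) for all σ > 0 and all (x,t) ∈ ℝⁿ×ℝ₊, and such that for some constants C, a > 0 one has Φ⁺(x,1) ≤ C exp(−a|x|²) and −Φ⁻(x,1) ≤ C exp(−a|x|²) for all x ∈ ℝⁿ. Moreover, Φ⁺ and Φ⁻ are unique up to multiplication by a positive constant. -/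

import Mathlib

noncomputable section

open Filter Matrix Real Set
open scoped Topology

/-- Euclidean `n`-space `ℝⁿ`. -/
abbrev En (n : ℕ) := EuclideanSpace ℝ (Fin n)

/-- `n × n` real matrices. -/
abbrev Mat (n : ℕ) := Matrix (Fin n) (Fin n) ℝ

/-- The set of symmetric positive definite matrices whose eigenvalues all lie in `[lam, Lam]`. -/
def PucciMatrices (n : ℕ) (lam Lam : ℝ) : Set (Mat n) :=
  { A | ∃ hA : A.IsHermitian, ∀ i, hA.eigenvalues i ∈ Set.Icc lam Lam }

/-- The Pucci maximal operator `P⁺(M) = sup {-tr(AM) : A ∈ PucciMatrices}`. -/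
def PucciPlus (n : ℕ) (lam Lam : ℝ) (M : Mat n) : ℝ :=
  sSup ((fun A => -(A * M).trace) '' PucciMatrices n lam Lam)

/-- The Pucci minimal operator `P⁻(M) = inf {-tr(AM) : A ∈ PucciMatrices}`. -/
def PucciMinus (n : ℕ) (lam Lam : ℝ) (M : Mat n) : ℝ :=
  sInf ((fun A => -(A * M).trace) '' PucciMatrices n lam Lam)

/-- `F` is uniformly elliptic with ellipticity constants `lam ≤ Lam`. -/
def UniformlyElliptic (n : ℕ) (lam Lam : ℝ) (F : Mat n → ℝ) : Prop :=
  ∀ M N : Mat n, M.IsSymm → N.IsSymm →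
    PucciMinus n lam Lam (M - N) ≤ F M - F N ∧ F M - F N ≤ PucciPlus n lam Lam (M - N)

/-- `F` is positively homogeneous of order one. -/
def PositivelyHomogeneous (n : ℕ) (F : Mat n → ℝ) : Prop :=
  ∀ (M : Mat n), ∀ η : ℝ, 0 ≤ η → F (η • M) = η * F M

/-- The Hessian matrix of `φ : ℝⁿ → ℝ` at a point `y`. -/
def hess (n : ℕ) (φ : En n → ℝ) (y : En n) : Mat n :=
  Matrix.of fun i j =>
    fderiv ℝ (fun z => fderiv ℝ φ z (EuclideanSpace.single j 1)) y (EuclideanSpace.single i 1)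

/-- Viscosity subsolution of the elliptic equation `G(D²u, Du, u, y) = 0` on `Ω`,
i.e. `G[u] ≤ 0` in the viscosity sense. -/
def ViscSubE (n : ℕ) (Ω : Set (En n))
    (G : Mat n → (En n →L[ℝ] ℝ) → ℝ → En n → ℝ) (u : En n → ℝ) : Prop :=
  ∀ y ∈ Ω, ∀ φ : En n → ℝ, ContDiff ℝ 2 φ →
    IsLocalMaxOn (fun z => u z - φ z) Ω y →
    G (hess n φ y) (fderiv ℝ φ y) (u y) y ≤ 0

/-- Viscosity supersolution of the elliptic equation `G(D²u, Du, u, y) = 0` on `Ω`,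
i.e. `G[u] ≥ 0` in the viscosity sense. -/
def ViscSupE (n : ℕ) (Ω : Set (En n))
    (G : Mat n → (En n →L[ℝ] ℝ) → ℝ → En n → ℝ) (u : En n → ℝ) : Prop :=
  ∀ y ∈ Ω, ∀ φ : En n → ℝ, ContDiff ℝ 2 φ →
    IsLocalMinOn (fun z => u z - φ z) Ω y →
    0 ≤ G (hess n φ y) (fderiv ℝ φ y) (u y) y

/-- Viscosity solution of the elliptic equation `G(D²u, Du, u, y) = 0` on `Ω`. -/
def ViscSolE (n : ℕ) (Ω : Set (En n))
    (G : Mat n → (En n →L[ℝ] ℝ) → ℝ → En n → ℝ) (u : En n → ℝ) : Prop :=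
  ViscSubE n Ω G u ∧ ViscSupE n Ω G u

/-- Time derivative of `φ : ℝⁿ × ℝ → ℝ` at `p = (x, t)`. -/
def tderiv (n : ℕ) (φ : En n × ℝ → ℝ) (p : En n × ℝ) : ℝ :=
  deriv (fun s => φ (p.1, s)) p.2

/-- Spatial Hessian of `φ : ℝⁿ × ℝ → ℝ` at `p = (x, t)`. -/
def shess (n : ℕ) (φ : En n × ℝ → ℝ) (p : En n × ℝ) : Mat n :=
  hess n (fun z => φ (z, p.2)) p.1

/-- Spatial differential of `φ : ℝⁿ × ℝ → ℝ` at `p = (x, t)`. -/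
def sgrad (n : ℕ) (φ : En n × ℝ → ℝ) (p : En n × ℝ) : En n →L[ℝ] ℝ :=
  fderiv ℝ (fun z => φ (z, p.2)) p.1

/-- Viscosity subsolution of the parabolic equation `u_t + G(D²u, Du, u, (x,t)) = 0` on `Ω`. -/
def ViscSubP (n : ℕ) (Ω : Set (En n × ℝ))
    (G : Mat n → (En n →L[ℝ] ℝ) → ℝ → En n × ℝ → ℝ) (u : En n × ℝ → ℝ) : Prop :=
  ∀ p ∈ Ω, ∀ φ : En n × ℝ → ℝ, ContDiff ℝ 2 φ →
    IsLocalMaxOn (fun q => u q - φ q) Ω p →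
    tderiv n φ p + G (shess n φ p) (sgrad n φ p) (u p) p ≤ 0

/-- Viscosity supersolution of the parabolic equation `u_t + G(D²u, Du, u, (x,t)) = 0` on `Ω`. -/
def ViscSupP (n : ℕ) (Ω : Set (En n × ℝ))
    (G : Mat n → (En n →L[ℝ] ℝ) → ℝ → En n × ℝ → ℝ) (u : En n × ℝ → ℝ) : Prop :=
  ∀ p ∈ Ω, ∀ φ : En n × ℝ → ℝ, ContDiff ℝ 2 φ →
    IsLocalMinOn (fun q => u q - φ q) Ω p →
    0 ≤ tderiv n φ p + G (shess n φ p) (sgrad n φ p) (u p) p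

/-- Viscosity solution of the parabolic equation `u_t + G(D²u, Du, u, (x,t)) = 0` on `Ω`. -/
def ViscSolP (n : ℕ) (Ω : Set (En n × ℝ))
    (G : Mat n → (En n →L[ℝ] ℝ) → ℝ → En n × ℝ → ℝ) (u : En n × ℝ → ℝ) : Prop :=
  ViscSubP n Ω G u ∧ ViscSupP n Ω G u

/-- The parabolic domain `ℝⁿ × ℝ₊`. -/
def Qset (n : ℕ) : Set (En n × ℝ) := {p | 0 < p.2}

/-- The elliptic operator `F(D²u) - (1/2) y·Du - α u - f(y)`. -/
def Fop (n : ℕ) (F : Mat n → ℝ) (α : ℝ) (f : En n → ℝ) :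
    Mat n → (En n →L[ℝ] ℝ) → ℝ → En n → ℝ :=
  fun M p v y => F M - (1/2) * p y - α * v - f y

/-- Membership in the space `X` with weight `b`: continuity and finiteness of the norm. -/
def memX (n : ℕ) (b : ℝ) (u : En n → ℝ) : Prop :=
  Continuous u ∧ BddAbove (Set.range fun y : En n => |u y| * Real.exp (b * ‖y‖ ^ 2) / (1 + ‖y‖ ^ 2))

/-- The norm `‖u‖_X = sup_y |u(y)| e^{b|y|²} / (1 + |y|²)`. -/
def normX (n : ℕ) (b : ℝ) (u : En n → ℝ) : ℝ :=
  sSup (Set.range fun y : En n => |u y| * Real.exp (b * ‖y‖ ^ 2) / (1 + ‖y‖ ^ 2))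

/-- The positive anomalous exponent `α⁺(F)`. -/
def alphaPlus (n : ℕ) (lam Lam : ℝ) (F : Mat n → ℝ) : ℝ :=
  sSup { α : ℝ | ∃ φ : En n → ℝ, memX n (1/(8*Lam)) φ ∧ (∀ y, 0 ≤ φ y) ∧ φ ≠ 0 ∧
    ViscSupE n Set.univ (Fop n F α (fun _ => 0)) φ }

/-- `Φ` is a positive self-similar solution of `u_t + F(D²u) = 0` with exponent `α`,
with a Gaussian upper bound at time one. -/
def IsSelfSimilarPlus (n : ℕ) (F : Mat n → ℝ) (α : ℝ) (Φ : En n × ℝ → ℝ) : Prop :=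
  ContinuousOn Φ (Qset n) ∧
  (∀ p ∈ Qset n, 0 < Φ p) ∧
  ViscSolP n (Qset n) (fun M _ _ _ => F M) Φ ∧
  (∀ σ : ℝ, 0 < σ → ∀ x : En n, ∀ t : ℝ, 0 < t →
    Φ (x, t) = σ ^ α * Φ (Real.sqrt σ • x, σ * t)) ∧
  (∃ C : ℝ, 0 < C ∧ ∃ a : ℝ, 0 < a ∧ ∀ x : En n, Φ (x, 1) ≤ C * Real.exp (-a * ‖x‖ ^ 2))

/-- `Φ` is a negative self-similar solution of `u_t + F(D²u) = 0` with exponent `α`,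
with a Gaussian lower bound at time one. -/
def IsSelfSimilarMinus (n : ℕ) (F : Mat n → ℝ) (α : ℝ) (Φ : En n × ℝ → ℝ) : Prop :=
  ContinuousOn Φ (Qset n) ∧
  (∀ p ∈ Qset n, Φ p < 0) ∧
  ViscSolP n (Qset n) (fun M _ _ _ => F M) Φ ∧
  (∀ σ : ℝ, 0 < σ → ∀ x : En n, ∀ t : ℝ, 0 < t →
    Φ (x, t) = σ ^ α * Φ (Real.sqrt σ • x, σ * t)) ∧
  (∃ C : ℝ, 0 < C ∧ ∃ a : ℝ, 0 < a ∧ ∀ x : En n, -Φ (x, 1) ≤ C * Real.exp (-a * ‖x‖ ^ 2))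

/-- The set `S` of locally uniform sequential limits of the rescalings
`u^σ(x,t) = σ^α u(σ^{1/2} x, σ t)` as `σ → ∞`. -/
def limitSet (n : ℕ) (α : ℝ) (u : En n × ℝ → ℝ) : Set (En n × ℝ → ℝ) :=
  { U | ContinuousOn U (Qset n) ∧ ∃ σ : ℕ → ℝ,
      Tendsto σ atTop atTop ∧
      TendstoLocallyUniformlyOn
        (fun k (p : En n × ℝ) => (σ k) ^ α * u (Real.sqrt (σ k) • p.1, σ k * p.2))
        U atTop (Qset n) }

namespace SelfSim

variable {n : ℕ} {lam Lam : ℝ}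

section Jensen

variable {H : Type*} [NormedAddCommGroup H] [InnerProductSpace ℝ H]

/-- `q` is a subgradient of `g` at `x`. -/
def HasSubgrad (g : H → ℝ) (x q : H) : Prop := ∀ y, g x + inner ℝ q (y - x) ≤ g y

theorem le_of_sub_le_sq {χ : ℝ → ℝ} {K : ℝ}
    (h : ∀ s t, 0 ≤ s → s ≤ t → t ≤ 1 → χ t - χ s ≤ K * (t - s) ^ 2) : χ 1 ≤ χ 0 := by
  have key : ∀ n : ℕ, 0 < n → χ 1 - χ 0 ≤ K / n := by
    intro n hn
    have hn' : (0 : ℝ) < n := by exact_mod_cast hn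
    have h1 : ∑ i ∈ Finset.range n, (χ (((i + 1 : ℕ) : ℝ) / n) - χ ((i : ℕ) / n)) = χ 1 - χ 0 := by
      rw [Finset.sum_range_sub (fun i : ℕ => χ ((i : ℝ) / n))]
      simp [div_self hn'.ne']
    rw [← h1]
    have h2 : ∑ i ∈ Finset.range n, (χ (((i + 1 : ℕ) : ℝ) / n) - χ ((i : ℕ) / n))
        ≤ ∑ i ∈ Finset.range n, K / (n : ℝ) ^ 2 := by
      refine Finset.sum_le_sum fun i hi => ?_
      have hi' : ((i : ℝ) + 1) ≤ n := by
        have := Finset.mem_range.1 hi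
        exact_mod_cast this
      refine (h _ _ (by positivity) ?_ ?_).trans (le_of_eq ?_)
      · push_cast; gcongr; linarith
      · push_cast; rw [div_le_one hn']; exact hi'
      · push_cast; field_simp; ring
    refine h2.trans (le_of_eq ?_)
    simp only [Finset.sum_const, Finset.card_range, nsmul_eq_mul]
    field_simp
  have hl : Tendsto (fun n : ℕ => K / (n : ℝ)) atTop (𝓝 0) :=
    tendsto_const_div_atTop_nhds_zero_nat K
  have : χ 1 - χ 0 ≤ 0 := by
    refine ge_of_tendsto hl ?_
    filter_upwards [eventually_gt_atTop 0] with n hn using key n hn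
  linarith

theorem HasSubgrad.mono_inner {g : H → ℝ} {x y p q : H} (hx : HasSubgrad g x p)
    (hy : HasSubgrad g y q) : 0 ≤ inner ℝ (p - q) (x - y) := by
  have h1 := hx y
  have h2 := hy x
  have : inner ℝ p (y - x) = - inner ℝ p (x - y) := by rw [← inner_neg_right, neg_sub]
  rw [inner_sub_left]
  linarith

theorem HasSubgrad.norm_sub_le {g : H → ℝ} {x y s t : H} (hx : HasSubgrad g x (s - x))
    (hy : HasSubgrad g y (t - y)) : ‖x - y‖ ≤ ‖s - t‖ := by
  have h := hx.mono_inner hy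
  have e : s - x - (t - y) = (s - t) - (x - y) := by abel
  rw [e, inner_sub_left, real_inner_self_eq_norm_sq] at h
  have h2 := real_inner_le_norm (s - t) (x - y)
  by_contra hlt
  push Not at hlt
  nlinarith [norm_nonneg (s - t)]

theorem convexOn_of_hasSubgrad {g : H → ℝ} (hg : ∀ x, ∃ q, HasSubgrad g x q) :
    ConvexOn ℝ univ g := by
  refine ⟨convex_univ, fun x _ y _ a b ha hb hab => ?_⟩
  obtain ⟨q, hq⟩ := hg (a • x + b • y)
  have h1 := hq x
  have h2 := hq y
  have e : a * inner ℝ q (x - (a • x + b • y)) + b * inner ℝ q (y - (a • x + b • y)) = 0 := by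
    rw [← inner_smul_right, ← inner_smul_right, ← inner_add_right]
    have : a • (x - (a • x + b • y)) + b • (y - (a • x + b • y)) = 0 := by
      obtain rfl : a = 1 - b := by linarith
      module
    rw [this, inner_zero_right]
  simp only [smul_eq_mul]
  have h3 := mul_le_mul_of_nonneg_left h1 ha
  have h4 := mul_le_mul_of_nonneg_left h2 hb
  obtain rfl : a = 1 - b := by linarith
  linarith

theorem exists_prox [FiniteDimensional ℝ H] {g : H → ℝ} (hg : ∀ x, ∃ q, HasSubgrad g x q) (s : H) :
    ∃ x, HasSubgrad g x (s - x) := by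
  have hconv := convexOn_of_hasSubgrad hg
  have hcont : Continuous g := by
    rw [← continuousOn_univ]
    exact hconv.continuousOn isOpen_univ
  obtain ⟨q, hq⟩ := hg 0
  have hcoer : Tendsto (fun y => g y + (1 / 2) * ‖y - s‖ ^ 2) (cocompact H) atTop := by
    have hb : ∀ y, ‖y‖ + (g 0 + (1 / 2) * ‖s‖ ^ 2 - (‖q - s‖ + 1) ^ 2 / 2)
        ≤ g y + (1 / 2) * ‖y - s‖ ^ 2 := by
      intro y
      have h1 := hq y
      rw [sub_zero] at h1
      have h2 := abs_le.1 (abs_real_inner_le_norm (q - s) y)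
      rw [inner_sub_left, real_inner_comm y s] at h2
      rw [@norm_sub_sq_real]
      nlinarith [sq_nonneg (‖y‖ - (‖q - s‖ + 1))]
    exact tendsto_atTop_mono hb (tendsto_atTop_add_const_right _ _ tendsto_norm_cocompact_atTop)
  obtain ⟨x, hx⟩ := Continuous.exists_forall_le
    (f := fun y => g y + (1 / 2) * ‖y - s‖ ^ 2) (by fun_prop) hcoer
  refine ⟨x, fun y => ?_⟩
  have key : ∀ t : ℝ, 0 < t → t ≤ 1 →
      g x + inner ℝ (s - x) (y - x) - g y ≤ t * ((1 / 2) * ‖y - x‖ ^ 2) := by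
    intro t ht ht1
    have h1 := hx (x + t • (y - x))
    have h2 := hconv.2 (mem_univ x) (mem_univ y) (show 0 ≤ 1 - t by linarith) ht.le (by ring)
    have e1 : (1 - t) • x + t • y = x + t • (y - x) := by module
    rw [e1] at h2
    simp only [smul_eq_mul] at h2
    have e2 : ‖x + t • (y - x) - s‖ ^ 2
        = ‖x - s‖ ^ 2 - 2 * (t * inner ℝ (s - x) (y - x)) + t ^ 2 * ‖y - x‖ ^ 2 := by
      have : x + t • (y - x) - s = t • (y - x) - (s - x) := by abel
      rw [this, @norm_sub_sq_real, norm_smul, inner_smul_left, norm_sub_rev x s,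
        real_inner_comm, mul_pow, Real.norm_eq_abs, sq_abs]
      simp
      ring
    simp only [e2] at h1
    have h3 : t * (g x + inner ℝ (s - x) (y - x) - g y) ≤ t * (t * ((1 / 2) * ‖y - x‖ ^ 2)) := by
      nlinarith
    exact le_of_mul_le_mul_left h3 ht
  have hl : Tendsto (fun t : ℝ => t * ((1 / 2) * ‖y - x‖ ^ 2)) (𝓝[>] 0) (𝓝 0) := by
    have : Tendsto (fun t : ℝ => t * ((1 / 2) * ‖y - x‖ ^ 2)) (𝓝 0)
        (𝓝 (0 * ((1 / 2) * ‖y - x‖ ^ 2))) := (continuous_id.mul continuous_const).tendsto 0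
    rw [zero_mul] at this
    exact this.mono_left nhdsWithin_le_nhds
  have : g x + inner ℝ (s - x) (y - x) - g y ≤ 0 := by
    refine ge_of_tendsto hl ?_
    filter_upwards [Ioc_mem_nhdsGT (zero_lt_one' ℝ)] with t ht using key t ht.1 ht.2
  linarith

theorem exists_small_regular_value [FiniteDimensional ℝ H] {J P : H → H} {K L : NNReal}
    (hJ : LipschitzWith K J) (hP : LipschitzWith L P) {ε : ℝ} (hε : 0 < ε) :
    ∃ p, ‖p‖ < ε ∧ ∀ s, P s = p → DifferentiableAt ℝ J s := by
  let _ : MeasurableSpace H := borel H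
  have _ : BorelSpace H := ⟨rfl⟩
  set d : ℝ := (Module.finrank ℝ H : ℝ) with hd
  set N : Set H := {s | ¬ DifferentiableAt ℝ J s} with hN
  have h0 : MeasureTheory.Measure.hausdorffMeasure d N = 0 := by
    have := hJ.ae_differentiableAt (μ := MeasureTheory.Measure.hausdorffMeasure d)
    exact this
  have h1 : MeasureTheory.Measure.hausdorffMeasure d (P '' N) = 0 := by
    have := hP.hausdorffMeasure_image_le (d := d) (by positivity) N
    rw [h0, mul_zero] at this
    exact le_antisymm this bot_le
  have h2 : ¬ Metric.ball (0 : H) ε ⊆ P '' N := by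
    intro hsub
    have h3 : MeasureTheory.Measure.hausdorffMeasure d (Metric.ball (0 : H) ε) = 0 :=
      MeasureTheory.measure_mono_null hsub h1
    exact (Metric.measure_ball_pos (MeasureTheory.Measure.hausdorffMeasure d) (0 : H) hε).ne' h3
  obtain ⟨p, hp, hpN⟩ := Set.not_subset.1 h2
  refine ⟨p, by simpa using hp, fun s hs => ?_⟩
  by_contra hn
  exact hpN ⟨s, hn, hs⟩

theorem eq_of_inner_le_sq {w : H} {K : ℝ} (h : ∀ᶠ y in 𝓝 (0 : H), inner ℝ w y ≤ K * ‖y‖ ^ 2) :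
    w = 0 := by
  have ht : Tendsto (fun t : ℝ => t • w) (𝓝[>] 0) (𝓝 0) := by
    have : Tendsto (fun t : ℝ => t • w) (𝓝 0) (𝓝 ((0 : ℝ) • w)) :=
      (continuous_id.smul continuous_const).tendsto 0
    rw [zero_smul] at this
    exact this.mono_left nhdsWithin_le_nhds
  have h1 : ∀ᶠ t : ℝ in 𝓝[>] 0, ‖w‖ ^ 2 ≤ t * (K * ‖w‖ ^ 2) := by
    filter_upwards [ht.eventually h, self_mem_nhdsWithin] with t ht1 (ht0 : 0 < t)
    rw [inner_smul_right, real_inner_self_eq_norm_sq, norm_smul, mul_pow, Real.norm_eq_abs,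
      sq_abs] at ht1
    refine le_of_mul_le_mul_left ?_ ht0
    linarith
  have hl : Tendsto (fun t : ℝ => t * (K * ‖w‖ ^ 2)) (𝓝[>] 0) (𝓝 0) := by
    have : Tendsto (fun t : ℝ => t * (K * ‖w‖ ^ 2)) (𝓝 0)
        (𝓝 (0 * (K * ‖w‖ ^ 2))) := (continuous_id.mul continuous_const).tendsto 0
    rw [zero_mul] at this
    exact this.mono_left nhdsWithin_le_nhds
  have h2 : ‖w‖ ^ 2 ≤ 0 := ge_of_tendsto hl h1
  have : ‖w‖ = 0 := by nlinarith [norm_nonneg w]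
  exact norm_eq_zero.1 this

/-- A function with subgradients which is touched from above by a paraboloid has subgradients
varying at most linearly near the contact point. -/
theorem HasSubgrad.norm_sub_le_of_paraboloid {g : H → ℝ} {x q : H} {C ρ : ℝ} (hC : 0 ≤ C)
    (hρ : 0 < ρ) (hq : HasSubgrad g x q)
    (hU : ∀ h, ‖h‖ < ρ → g (x + h) ≤ g x + inner ℝ q h + C / 2 * ‖h‖ ^ 2)
    {x' q' : H} (hx' : 2 * ‖x' - x‖ < ρ) (hq' : HasSubgrad g x' q') :
    ‖q' - q‖ ≤ 2 * C * ‖x' - x‖ := by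
  have key : ∀ k : H, ‖x' - x + k‖ < ρ → inner ℝ (q' - q) k ≤ C / 2 * ‖x' - x + k‖ ^ 2 := by
    intro k hk
    have h1 := hU _ hk
    have h2 := hq' (x + (x' - x + k))
    have h3 := hq x'
    have e : x + (x' - x + k) - x' = k := by abel
    rw [e] at h2
    rw [inner_add_right] at h1
    rw [inner_sub_left]
    linarith
  rcases eq_or_ne x' x with rfl | hne
  · have : q' - q = 0 := by
      refine eq_of_inner_le_sq (K := C / 2) ?_
      filter_upwards [Metric.ball_mem_nhds (0 : H) hρ] with k hk
      have := key k (by simpa using hk)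
      simpa using this
    simp [this]
  · have hpos : 0 < ‖x' - x‖ := norm_pos_iff.2 (sub_ne_zero.2 hne)
    rcases eq_or_ne q' q with rfl | hqne
    · simp; positivity
    have hqpos : 0 < ‖q' - q‖ := norm_pos_iff.2 (sub_ne_zero.2 hqne)
    set k : H := (‖x' - x‖ / ‖q' - q‖) • (q' - q) with hk
    have hkn : ‖k‖ = ‖x' - x‖ := by
      rw [hk, norm_smul, Real.norm_eq_abs, abs_of_pos (by positivity)]
      field_simp
    have hle : ‖x' - x + k‖ ≤ 2 * ‖x' - x‖ := by
      refine (norm_add_le _ _).trans ?_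
      rw [hkn]; linarith
    have h1 := key k (lt_of_le_of_lt hle hx')
    have h2 : inner ℝ (q' - q) k = ‖x' - x‖ * ‖q' - q‖ := by
      rw [hk, inner_smul_right, real_inner_self_eq_norm_sq]
      field_simp
    rw [h2] at h1
    have h3 : ‖x' - x + k‖ ^ 2 ≤ (2 * ‖x' - x‖) ^ 2 := by gcongr
    have h4 : ‖x' - x‖ * ‖q' - q‖ ≤ ‖x' - x‖ * (2 * C * ‖x' - x‖) := by
      nlinarith [mul_le_mul_of_nonneg_left h3 (by linarith : 0 ≤ C / 2)]
    exact le_of_mul_le_mul_left h4 hpos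

/-- Second order expansion from a first order expansion of the subgradients. -/
theorem expansion_of_hasSubgrad {g : H → ℝ} {x q : H} (A : H →L[ℝ] H)
    (hg : ∀ x, ∃ q, HasSubgrad g x q) {δ ρ : ℝ}
    (hA : ∀ x' q', ‖x' - x‖ < ρ → HasSubgrad g x' q' → ‖q' - q - A (x' - x)‖ ≤ δ * ‖x' - x‖)
    {h : H} (hh : ‖h‖ < ρ) :
    |g (x + h) - g x - inner ℝ q h - (1 / 2) * inner ℝ (A h) h| ≤ δ * ‖h‖ ^ 2 := by
  choose Q hQ using hg
  set a : ℝ → ℝ := fun τ => inner ℝ (Q (x + τ • h)) h with ha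
  set β : ℝ := inner ℝ (A h) h with hβ
  have hδ : 0 ≤ δ * ‖h‖ ^ 2 := by
    have := (norm_nonneg _).trans (hA (x + h) _ (by simpa using hh) (hQ _))
    simp only [add_sub_cancel_left] at this
    nlinarith [norm_nonneg h]
  have h1 : ∀ τ, 0 ≤ τ → τ ≤ 1 → |a τ - inner ℝ q h - τ * β| ≤ δ * ‖h‖ ^ 2 := by
    intro τ h0 h1
    have hn : ‖x + τ • h - x‖ = τ * ‖h‖ := by
      rw [add_sub_cancel_left, norm_smul, Real.norm_eq_abs, abs_of_nonneg h0]
    have h2 := hA (x + τ • h) (Q (x + τ • h)) (by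
      rw [hn]; nlinarith [norm_nonneg h]) (hQ _)
    rw [hn, add_sub_cancel_left] at h2
    have h3 := abs_real_inner_le_norm (Q (x + τ • h) - q - A (τ • h)) h
    have e : inner ℝ (Q (x + τ • h) - q - A (τ • h)) h = a τ - inner ℝ q h - τ * β := by
      rw [inner_sub_left, inner_sub_left, map_smul, inner_smul_left]
      simp [ha, hβ]
    rw [e] at h3
    refine h3.trans ((mul_le_mul_of_nonneg_right h2 (norm_nonneg h)).trans ?_)
    nlinarith [norm_nonneg h]
  have h2 : ∀ s t, g (x + s • h) + (t - s) * a s ≤ g (x + t • h) := by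
    intro s t
    have := hQ (x + s • h) (x + t • h)
    have e : x + t • h - (x + s • h) = (t - s) • h := by module
    rw [e, inner_smul_right] at this
    exact this
  set K : ℝ := |β| / 2 with hK
  have hK1 : β / 2 ≤ K := by rw [hK]; linarith [le_abs_self β]
  have hK2 : -β / 2 ≤ K := by rw [hK]; linarith [neg_abs_le β]
  rw [abs_le]
  constructor
  · have := le_of_sub_le_sq (K := K) (χ := fun τ => - g (x + τ • h) + τ * inner ℝ q h
      + τ ^ 2 / 2 * β - τ * (δ * ‖h‖ ^ 2)) (by
        intro s t hs hst ht
        have h3 := h2 s t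
        have h4 := (abs_le.1 (h1 s hs (hst.trans ht))).1
        have h5 := mul_le_mul_of_nonneg_left h4 (sub_nonneg.2 hst)
        have h6 := mul_le_mul_of_nonneg_right hK1 (sq_nonneg (t - s))
        nlinarith)
    simp at this
    linarith
  · have := le_of_sub_le_sq (K := K) (χ := fun τ => g (x + τ • h) - τ * inner ℝ q h
      - τ ^ 2 / 2 * β - τ * (δ * ‖h‖ ^ 2)) (by
        intro s t hs hst ht
        have h3 := h2 t s
        have h4 := (abs_le.1 (h1 t (hs.trans hst) ht)).2
        have h5 := mul_le_mul_of_nonneg_left h4 (sub_nonneg.2 hst)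
        have h6 := mul_le_mul_of_nonneg_right hK1 (sq_nonneg (t - s))
        nlinarith)
    simp at this
    linarith

/-- Differentiability of the proximal map gives a first order expansion of the subgradients. -/
theorem subgrad_expansion [FiniteDimensional ℝ H] {g : H → ℝ} {J : H → H}
    (hJ : ∀ s x, HasSubgrad g x (s - x) ↔ J s = x) {x q : H} {L ρ : ℝ} (hL : 0 ≤ L) (hρ : 0 < ρ)
    (hq : HasSubgrad g x q) (hcont : Continuous J)
    (hdiff : DifferentiableAt ℝ J (x + q))
    (hLip : ∀ x' q', ‖x' - x‖ < ρ → HasSubgrad g x' q' → ‖q' - q‖ ≤ L * ‖x' - x‖) :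
    ∃ A : H →L[ℝ] H, ∀ δ > 0, ∃ ρ' > 0, ∀ x' q', ‖x' - x‖ < ρ' → HasSubgrad g x' q' →
      ‖q' - q - A (x' - x)‖ ≤ δ * ‖x' - x‖ := by
  have hJs : J (x + q) = x := (hJ _ _).1 (by simpa using hq)
  set D := fderiv ℝ J (x + q) with hD
  have hd : ∀ δ > 0, ∀ᶠ σ in 𝓝 (0 : H), ‖J (x + q + σ) - x - D σ‖ ≤ δ * ‖σ‖ := by
    intro δ hδ
    have h1 := (hasFDerivAt_iff_isLittleO_nhds_zero.1 hdiff.hasFDerivAt).def hδ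
    simpa [hJs] using h1
  have hanti : ∀ᶠ σ in 𝓝 (0 : H), ‖σ‖ ≤ (1 + L) * ‖J (x + q + σ) - x‖ := by
    have hc : Tendsto (fun σ => ‖J (x + q + σ) - x‖) (𝓝 0) (𝓝 0) := by
      have : Continuous fun σ => ‖J (x + q + σ) - x‖ := by fun_prop
      have := this.tendsto 0
      simpa [hJs] using this
    filter_upwards [hc.eventually (gt_mem_nhds hρ)] with σ hσ
    have h1 := hLip _ (x + q + σ - J (x + q + σ)) hσ ((hJ _ _).2 rfl)
    have e : σ = (x + q + σ - J (x + q + σ) - q) + (J (x + q + σ) - x) := by abel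
    calc ‖σ‖ = ‖(x + q + σ - J (x + q + σ) - q) + (J (x + q + σ) - x)‖ := by rw [← e]
      _ ≤ _ := norm_add_le _ _
      _ ≤ _ := by linarith
  have hL1 : 0 < 1 + L := by linarith
  have hinj : ∀ h, D h = 0 → h = 0 := by
    intro h hh
    have ht : Tendsto (fun t : ℝ => t • h) (𝓝[>] 0) (𝓝 0) := by
      have : Tendsto (fun t : ℝ => t • h) (𝓝 0) (𝓝 ((0 : ℝ) • h)) :=
        (continuous_id.smul continuous_const).tendsto 0
      rw [zero_smul] at this
      exact this.mono_left nhdsWithin_le_nhds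
    obtain ⟨t, ⟨h1, h2⟩, (h3 : 0 < t)⟩ := (((ht.eventually hanti).and (ht.eventually
      (hd (1 / (2 * (1 + L))) (by positivity)))).and self_mem_nhdsWithin).exists
    rw [map_smul, hh, smul_zero, sub_zero] at h2
    have h4 : ‖t • h‖ ≤ (1 / 2) * ‖t • h‖ := by
      calc ‖t • h‖ ≤ (1 + L) * (1 / (2 * (1 + L)) * ‖t • h‖) :=
            h1.trans (mul_le_mul_of_nonneg_left h2 hL1.le)
        _ = _ := by field_simp
    have h5 : ‖t • h‖ = 0 := by nlinarith [norm_nonneg (t • h)]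
    exact (smul_eq_zero.1 (norm_eq_zero.1 h5)).resolve_left h3.ne'
  let e : H ≃ₗ[ℝ] H := LinearEquiv.ofInjectiveEndo (D : H →ₗ[ℝ] H)
    ((injective_iff_map_eq_zero _).2 hinj)
  let T : H →L[ℝ] H := LinearMap.toContinuousLinearMap (e.symm : H →ₗ[ℝ] H)
  have hT : ∀ v, T (D v) = v := fun v => e.symm_apply_apply v
  refine ⟨T - ContinuousLinearMap.id ℝ H, fun δ hδ => ?_⟩
  set δ' : ℝ := δ / ((‖T‖ + 1) * (1 + L)) with hδ'
  have hTn : 0 ≤ ‖T‖ := norm_nonneg T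
  have hδ'p : 0 < δ' := by positivity
  obtain ⟨η, hη, hball⟩ := Metric.eventually_nhds_iff.1 (hd δ' hδ'p)
  refine ⟨min ρ (η / (1 + L)), lt_min hρ (by positivity), fun x' q' hx' hq' => ?_⟩
  have hx1 := lt_of_lt_of_le hx' (min_le_left _ _)
  have hx2 := lt_of_lt_of_le hx' (min_le_right _ _)
  set σ : H := (q' - q) + (x' - x) with hσ
  have hσn : ‖σ‖ ≤ (1 + L) * ‖x' - x‖ := by
    refine (norm_add_le _ _).trans ?_
    linarith [hLip x' q' hx1 hq']
  have hJ' : J (x + q + σ) = x' := by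
    refine (hJ _ _).1 ?_
    have : x + q + σ - x' = q' := by rw [hσ]; abel
    rwa [this]
  have h1 : ‖J (x + q + σ) - x - D σ‖ ≤ δ' * ‖σ‖ := by
    refine hball ?_
    rw [dist_zero_right]
    refine hσn.trans_lt ?_
    rw [lt_div_iff₀ hL1] at hx2
    linarith
  rw [hJ'] at h1
  have e2 : q' - q - (T - ContinuousLinearMap.id ℝ H) (x' - x) = - T (x' - x - D σ) := by
    rw [map_sub T, hT, hσ, _root_.sub_apply, ContinuousLinearMap.id_apply]
    abel
  rw [e2, norm_neg]
  calc ‖T (x' - x - D σ)‖ ≤ ‖T‖ * ‖x' - x - D σ‖ := T.le_opNorm _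
    _ ≤ (‖T‖ + 1) * (δ' * ((1 + L) * ‖x' - x‖)) := by
        refine mul_le_mul (by linarith) (h1.trans (by gcongr)) (norm_nonneg _) (by positivity)
    _ = δ * ‖x' - x‖ := by rw [hδ']; field_simp

/-- A semiconvex function with a strict interior maximum has points of twice differentiability
near the maximum, with small gradient and nonpositive Hessian. -/
theorem exists_expansion [FiniteDimensional ℝ H] {W : H → ℝ} {C r m ε : ℝ} (hC : 0 ≤ C)
    (hr : 0 < r) (hm : 0 < m) (hε : 0 < ε)
    (hg : ∀ x, ∃ q, HasSubgrad (fun z => W z + C / 2 * ‖z‖ ^ 2) x q)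
    (hsph : ∀ z, ‖z‖ = r → W z ≤ W 0 - m) :
    ∃ (z p : H) (B : H →L[ℝ] H), ‖z‖ < r ∧ ‖p‖ < ε ∧ W 0 - ε ≤ W z ∧
      (∀ δ > 0, ∀ᶠ h in 𝓝 (0 : H),
        |W (z + h) - W z - inner ℝ p h - (1 / 2) * inner ℝ (B h) h| ≤ δ * ‖h‖ ^ 2) ∧
      ∀ h, inner ℝ (B h) h ≤ 0 := by
  set g : H → ℝ := fun z => W z + C / 2 * ‖z‖ ^ 2 with hgdef
  have hgc : Continuous g := by
    rw [← continuousOn_univ]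
    exact (convexOn_of_hasSubgrad hg).continuousOn isOpen_univ
  have hWc : Continuous W := by
    have : W = fun z => g z - C / 2 * ‖z‖ ^ 2 := by ext z; simp [hgdef]
    rw [this]
    fun_prop
  choose J hJ using fun s => exists_prox hg s
  have hJu : ∀ s x, HasSubgrad g x (s - x) ↔ J s = x := by
    intro s x
    refine ⟨fun h => ?_, fun h => h ▸ hJ s⟩
    have := (hJ s).norm_sub_le h
    rw [sub_self, norm_zero] at this
    exact sub_eq_zero.1 (norm_eq_zero.1 (le_antisymm this (norm_nonneg _)))
  have hJL : LipschitzWith 1 J := LipschitzWith.of_dist_le_mul fun s t => by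
    rw [dist_eq_norm, dist_eq_norm]
    simpa using (hJ s).norm_sub_le (hJ t)
  set P : H → H := fun s => s - (1 + C) • J s with hP
  have hPL : LipschitzWith (Real.toNNReal (2 + C)) P := LipschitzWith.of_dist_le_mul fun s t => by
    rw [dist_eq_norm, dist_eq_norm, Real.coe_toNNReal _ (by linarith)]
    have e : P s - P t = (s - t) - (1 + C) • (J s - J t) := by rw [hP]; module
    rw [e]
    refine (norm_sub_le _ _).trans ?_
    rw [norm_smul, Real.norm_eq_abs, abs_of_nonneg (by linarith)]
    nlinarith [(hJ s).norm_sub_le (hJ t)]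
  set η : ℝ := min (min ε (ε / r)) (m / (2 * r)) with hη
  have hηp : 0 < η := by positivity
  obtain ⟨p, hpη, hpdiff⟩ := exists_small_regular_value hJL hPL hηp
  have hpε : ‖p‖ < ε := hpη.trans_le ((min_le_left _ _).trans (min_le_left _ _))
  have hpr : ‖p‖ * r ≤ ε := by
    have := (hpη.trans_le ((min_le_left _ _).trans (min_le_right _ _))).le
    rwa [le_div_iff₀ hr] at this
  have hpm : ‖p‖ * r < m := by
    have := hpη.trans_le (min_le_right _ _)
    rw [lt_div_iff₀ (by positivity)] at this
    nlinarith [norm_nonneg p]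
  obtain ⟨x, hxr, hxmax⟩ := (isCompact_closedBall (0 : H) r).exists_isMaxOn
    ⟨0, by simp [hr.le]⟩ (f := fun z => W z - inner ℝ p z) (by fun_prop)
  have hx0 : W 0 ≤ W x - inner ℝ p x := by
    have := hxmax (show (0 : H) ∈ Metric.closedBall 0 r by simp [hr.le])
    simpa using this
  have hxle : ‖x‖ ≤ r := by simpa using hxr
  have hpx : |inner ℝ p x| ≤ ‖p‖ * r :=
    (abs_real_inner_le_norm p x).trans (by gcongr)
  have hxlt : ‖x‖ < r := by
    refine lt_of_le_of_ne hxle fun h => ?_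
    have := hsph x h
    have := (abs_le.1 hpx).1
    linarith
  have hmaxh : ∀ h, ‖h‖ < r - ‖x‖ → W (x + h) ≤ W x + inner ℝ p h := by
    intro h hh
    have := hxmax (show x + h ∈ Metric.closedBall 0 r by
      rw [mem_closedBall_zero_iff]; linarith [norm_add_le x h])
    simp only [inner_add_right, mem_ofPred_eq] at this
    linarith
  have hr' : 0 < r - ‖x‖ := by linarith
  have hsq : ∀ h, ‖x + h‖ ^ 2 = ‖x‖ ^ 2 + 2 * inner ℝ x h + ‖h‖ ^ 2 := fun h =>
    norm_add_sq_real x h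
  obtain ⟨q, hq⟩ := hg x
  have hqe : q = p + C • x := by
    rw [← sub_eq_zero]
    refine eq_of_inner_le_sq (K := C / 2) ?_
    filter_upwards [Metric.ball_mem_nhds (0 : H) hr'] with h hh
    have h1 := hq (x + h)
    have h2 := hmaxh h (by simpa using hh)
    rw [add_sub_cancel_left] at h1
    simp only [hgdef, hsq] at h1
    rw [inner_sub_left, inner_add_left, inner_smul_left]
    simp only [conj_trivial]
    linarith
  have hU : ∀ h, ‖h‖ < r - ‖x‖ → g (x + h) ≤ g x + inner ℝ q h + C / 2 * ‖h‖ ^ 2 := by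
    intro h hh
    have h2 := hmaxh h hh
    simp only [hgdef, hsq, hqe, inner_add_left, inner_smul_left, conj_trivial]
    linarith
  have hdiff : DifferentiableAt ℝ J (x + q) := by
    refine hpdiff _ ?_
    have : J (x + q) = x := (hJu _ _).1 (by simpa using hq)
    simp only [hP, this]
    rw [hqe]
    module
  obtain ⟨A, hA⟩ := subgrad_expansion hJu (L := 2 * C) (ρ := (r - ‖x‖) / 2) (by positivity)
    (by positivity) hq hJL.continuous hdiff (fun x' q' hx' hq' =>
      hq.norm_sub_le_of_paraboloid hC hr' hU (by linarith) hq')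
  have hexp : ∀ δ > 0, ∀ᶠ h in 𝓝 (0 : H), |W (x + h) - W x - inner ℝ p h
      - (1 / 2) * inner ℝ ((A - C • ContinuousLinearMap.id ℝ H) h) h| ≤ δ * ‖h‖ ^ 2 := by
    intro δ hδ
    obtain ⟨ρ', hρ', hA'⟩ := hA δ hδ
    filter_upwards [Metric.ball_mem_nhds (0 : H) hρ'] with h hh
    have h1 := expansion_of_hasSubgrad A hg hA' (by simpa using hh)
    convert h1 using 2
    simp only [hgdef, hsq, hqe, inner_add_left, inner_smul_left, conj_trivial,
      _root_.sub_apply, _root_.smul_apply, ContinuousLinearMap.id_apply,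
      inner_sub_left, real_inner_self_eq_norm_sq]
    ring
  refine ⟨x, p, _, hxlt, hpε, ?_, hexp, fun h => ?_⟩
  · have := (abs_le.1 hpx).1
    linarith
  · set B := A - C • ContinuousLinearMap.id ℝ H
    have key : ∀ δ > 0, inner ℝ (B h) h ≤ 2 * δ * ‖h‖ ^ 2 := by
      intro δ hδ
      have ht : Tendsto (fun t : ℝ => t • h) (𝓝[>] 0) (𝓝 0) := by
        have : Tendsto (fun t : ℝ => t • h) (𝓝 0) (𝓝 ((0 : ℝ) • h)) :=
          (continuous_id.smul continuous_const).tendsto 0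
        rw [zero_smul] at this
        exact this.mono_left nhdsWithin_le_nhds
      obtain ⟨t, ⟨h1, h2⟩, (h3 : 0 < t)⟩ := (((ht.eventually (hexp δ hδ)).and (ht.eventually
        (Metric.ball_mem_nhds (0 : H) hr'))).and self_mem_nhdsWithin).exists
      have h4 := hmaxh (t • h) (by simpa using h2)
      have h5 := (abs_le.1 h1).1
      rw [map_smul, inner_smul_left, inner_smul_right, inner_smul_right, norm_smul,
        Real.norm_eq_abs, mul_pow, sq_abs] at h5
      rw [inner_smul_right] at h4
      simp only [conj_trivial] at h5
      have h6 : t ^ 2 * inner ℝ (B h) h ≤ t ^ 2 * (2 * δ * ‖h‖ ^ 2) := by nlinarith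
      exact le_of_mul_le_mul_left h6 (by positivity)
    by_contra hneg
    push Not at hneg
    have := key (inner ℝ (B h) h / (4 * (‖h‖ ^ 2 + 1))) (by positivity)
    have h7 : 2 * (inner ℝ (B h) h / (4 * (‖h‖ ^ 2 + 1))) * ‖h‖ ^ 2
        ≤ inner ℝ (B h) h / 2 := by
      rw [show 2 * (inner ℝ (B h) h / (4 * (‖h‖ ^ 2 + 1))) * ‖h‖ ^ 2
        = inner ℝ (B h) h / 2 * (‖h‖ ^ 2 / (‖h‖ ^ 2 + 1)) by field_simp; ring]
      refine mul_le_of_le_one_right (by positivity) ?_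
      rw [div_le_one (by positivity)]
      linarith
    linarith

end Jensen

/-- The operator on `ℝⁿ` attached to a matrix. -/
def mv (X : Mat n) : En n →L[ℝ] En n := Matrix.toEuclideanCLM (n := Fin n) (𝕜 := ℝ) X

/-- The quadratic form attached to a matrix. -/
def qf (X : Mat n) (h : En n) : ℝ := inner ℝ (mv X h) h

@[simp] theorem mv_add (X Y : Mat n) : mv (X + Y) = mv X + mv Y := map_add _ _ _
@[simp] theorem mv_sub (X Y : Mat n) : mv (X - Y) = mv X - mv Y := map_sub _ _ _
@[simp] theorem mv_neg (X : Mat n) : mv (-X) = -mv X := map_neg _ _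
@[simp] theorem mv_smul (c : ℝ) (X : Mat n) : mv (c • X) = c • mv X := map_smul _ _ _
@[simp] theorem mv_one : mv (1 : Mat n) = ContinuousLinearMap.id ℝ _ := map_one _
@[simp] theorem mv_zero : mv (0 : Mat n) = 0 := map_zero _

theorem mv_inner_symm {X : Mat n} (hX : X.IsSymm) (h k : En n) :
    inner ℝ (mv X h) k = inner ℝ h (mv X k) := by
  have h1 : IsSelfAdjoint (mv X) := by
    have : IsSelfAdjoint X := by
      rw [IsSelfAdjoint, star_eq_conjTranspose, conjTranspose_eq_transpose_of_trivial]
      exact hX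
    exact this.map (Matrix.toEuclideanCLM (n := Fin n) (𝕜 := ℝ))
  exact h1.isSymmetric h k

theorem mv_transpose_inner (X : Mat n) (h k : En n) :
    inner ℝ (mv Xᵀ h) k = inner ℝ h (mv X k) := by
  have h1 : mv Xᵀ = star (mv X) := by
    rw [← conjTranspose_eq_transpose_of_trivial, ← star_eq_conjTranspose]
    exact map_star (Matrix.toEuclideanCLM (n := Fin n) (𝕜 := ℝ)) X
  rw [h1, ContinuousLinearMap.star_eq_adjoint, ContinuousLinearMap.adjoint_inner_left]

theorem exists_mat (B : En n →L[ℝ] En n) :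
    ∃ X : Mat n, X.IsSymm ∧ ∀ h, qf X h = inner ℝ (B h) h := by
  obtain ⟨Y, rfl⟩ : ∃ Y : Mat n, mv Y = B :=
    (Matrix.toEuclideanCLM (n := Fin n) (𝕜 := ℝ)).surjective B
  refine ⟨(1 / 2 : ℝ) • (Y + Yᵀ), ?_, fun h => ?_⟩
  · rw [Matrix.IsSymm, transpose_smul, transpose_add, transpose_transpose, add_comm]
  · rw [qf, mv_smul, mv_add, _root_.smul_apply, _root_.add_apply, inner_smul_left,
      inner_add_left, mv_transpose_inner, real_inner_comm (mv Y h) h]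
    simp
    ring

theorem qf_add (X Y : Mat n) (h : En n) : qf (X + Y) h = qf X h + qf Y h := by
  simp [qf, inner_add_left]
theorem qf_sub (X Y : Mat n) (h : En n) : qf (X - Y) h = qf X h - qf Y h := by
  simp [qf, inner_sub_left]
theorem qf_neg (X : Mat n) (h : En n) : qf (-X) h = -qf X h := by
  simp [qf, inner_neg_left]
theorem qf_smul (c : ℝ) (X : Mat n) (h : En n) : qf (c • X) h = c * qf X h := by
  simp [qf, inner_smul_left]
theorem qf_one (h : En n) : qf (1 : Mat n) h = ‖h‖ ^ 2 := by
  simp [qf]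
theorem qf_zero (h : En n) : qf (0 : Mat n) h = 0 := by
  simp [qf]
theorem qf_vec_smul (c : ℝ) (X : Mat n) (h : En n) : qf X (c • h) = c ^ 2 * qf X h := by
  simp [qf, inner_smul_left, inner_smul_right]; ring
theorem qf_vec_neg (X : Mat n) (h : En n) : qf X (-h) = qf X h := by
  simp [qf]
@[simp] theorem qf_vec_zero (X : Mat n) : qf X 0 = 0 := by simp [qf]
theorem qf_vec_add {X : Mat n} (hX : X.IsSymm) (h k : En n) :
    qf X (h + k) = qf X h + 2 * inner ℝ (mv X h) k + qf X k := by
  have : inner ℝ (mv X k) h = inner ℝ (mv X h) k := by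
    rw [mv_inner_symm hX, real_inner_comm]
  simp only [qf, map_add, inner_add_left, inner_add_right, this]; ring
theorem continuous_qf (X : Mat n) : Continuous (qf X) := by
  unfold qf; fun_prop
theorem abs_qf_le (X : Mat n) (h : En n) : |qf X h| ≤ ‖mv X‖ * ‖h‖ ^ 2 := by
  refine (abs_real_inner_le_norm _ _).trans ?_
  rw [pow_two, ← mul_assoc]
  exact mul_le_mul_of_nonneg_right ((mv X).le_opNorm h) (norm_nonneg h)

/-- `(p, X)` is a second order superjet of `u` at `y`. -/
def SJ (u : En n → ℝ) (y p : En n) (X : Mat n) : Prop :=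
  ∀ δ > 0, ∀ᶠ h in 𝓝 (0 : En n),
    u (y + h) ≤ u y + inner ℝ p h + (1 / 2) * qf X h + δ * ‖h‖ ^ 2

/-- Sup-convolution. -/
theorem exists_supConv {u : En n → ℝ} (hu : UpperSemicontinuous u) {M ε : ℝ}
    (hM : ∀ x, |u x| ≤ M) (hε : 0 < ε) :
    ∃ (U : En n → ℝ) (Z : En n → En n), (∀ x, U x = u (Z x) - ‖x - Z x‖ ^ 2 / (2 * ε)) ∧
      (∀ x z, u z - ‖x - z‖ ^ 2 / (2 * ε) ≤ U x) ∧ ∀ x, ‖Z x - x‖ ^ 2 ≤ 4 * M * ε := by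
  have hM0 : 0 ≤ M := (abs_nonneg _).trans (hM 0)
  have key : ∀ x, ∃ z, (∀ z', u z' - ‖x - z'‖ ^ 2 / (2 * ε) ≤ u z - ‖x - z‖ ^ 2 / (2 * ε)) := by
    intro x
    have husc : UpperSemicontinuous fun z' => u z' + -(‖x - z'‖ ^ 2 / (2 * ε)) :=
      hu.add (Continuous.upperSemicontinuous (by fun_prop))
    obtain ⟨z, hz, hmax⟩ := husc.upperSemicontinuousOn _ |>.exists_isMaxOn
      (s := Metric.closedBall x (Real.sqrt (4 * M * ε)))
      ⟨x, Metric.mem_closedBall_self (Real.sqrt_nonneg _)⟩ (isCompact_closedBall _ _)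
    refine ⟨z, fun z' => ?_⟩
    by_cases hz' : z' ∈ Metric.closedBall x (Real.sqrt (4 * M * ε))
    · have := hmax hz'
      simp only [mem_ofPred_eq] at this
      linarith
    · have h1 := hmax (Metric.mem_closedBall_self (Real.sqrt_nonneg (4 * M * ε)))
      simp only [mem_ofPred_eq, sub_self, norm_zero] at h1
      rw [mem_closedBall_iff_norm', not_le] at hz'
      have h2 : 4 * M * ε ≤ ‖x - z'‖ ^ 2 := (Real.lt_sq_of_sqrt_lt hz').le
      have h3 : 2 * M ≤ ‖x - z'‖ ^ 2 / (2 * ε) := by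
        rw [le_div_iff₀ (by positivity)]; linarith
      have h4 := (abs_le.1 (hM z')).2
      have h5 := (abs_le.1 (hM x)).1
      simp at h1
      linarith
  choose Z hZ using key
  refine ⟨fun x => u (Z x) - ‖x - Z x‖ ^ 2 / (2 * ε), Z, fun _ => rfl, fun x z => hZ x z,
    fun x => ?_⟩
  have h1 := hZ x x
  rw [sub_self, norm_zero] at h1
  have h4 := (abs_le.1 (hM (Z x))).2
  have h5 := (abs_le.1 (hM x)).1
  have h3 : ‖x - Z x‖ ^ 2 / (2 * ε) ≤ 2 * M := by
    simp at h1; linarith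
  rw [div_le_iff₀ (by positivity)] at h3
  rw [norm_sub_rev]; linarith

/-- The quadratic test function used in the doubling of variables. -/
def dblTest (a b : En n) (S T : Mat n) (h k : En n) : ℝ :=
  inner ℝ a h + (1 / 2) * qf S h + inner ℝ b (h - k) + (1 / 2) * qf T (h - k)

theorem dblTest_add {a b : En n} {S T : Mat n} (hS : S.IsSymm) (hT : T.IsSymm) (h k ξ η : En n) :
    dblTest a b S T (h + ξ) (k + η) = dblTest a b S T h k
      + inner ℝ (a + b + (mv S h + mv T (h - k))) ξ + inner ℝ (-b - mv T (h - k)) η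
      + (1 / 2) * qf S ξ + (1 / 2) * qf T (ξ - η) := by
  have e : h + ξ - (k + η) = (h - k) + (ξ - η) := by abel
  simp only [dblTest, e, qf_vec_add hS, qf_vec_add hT, inner_add_right, inner_add_left,
    inner_sub_left, inner_sub_right, inner_neg_left]
  ring

theorem supConv_semiconvex {u U : En n → ℝ} {Z : En n → En n} {ε : ℝ} (hε : 0 < ε)
    (h1 : ∀ x, U x = u (Z x) - ‖x - Z x‖ ^ 2 / (2 * ε))
    (h2 : ∀ x z, u z - ‖x - z‖ ^ 2 / (2 * ε) ≤ U x) (x ξ : En n) :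
    U x + inner ℝ (ε⁻¹ • (Z x - x)) ξ - ε⁻¹ / 2 * ‖ξ‖ ^ 2 ≤ U (x + ξ) := by
  refine le_trans (le_of_eq ?_) (h2 (x + ξ) (Z x))
  have e : x + ξ - Z x = ξ - (Z x - x) := by abel
  rw [h1, e, @norm_sub_sq_real _ _ _ ξ, norm_sub_rev x, inner_smul_left, real_inner_comm ξ]
  simp
  field_simp
  ring

theorem qf_sub_le (S T : Mat n) (ξ η : En n) :
    qf S ξ + qf T (ξ - η) ≤ (‖mv S‖ + 2 * ‖mv T‖) * (‖ξ‖ ^ 2 + ‖η‖ ^ 2) := by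
  have h1 := (abs_le.1 (abs_qf_le S ξ)).2
  have h2 := (abs_le.1 (abs_qf_le T (ξ - η))).2
  have h3 : ‖ξ - η‖ ^ 2 ≤ 2 * (‖ξ‖ ^ 2 + ‖η‖ ^ 2) := by
    have := parallelogram_law_with_norm ℝ ξ η
    nlinarith [sq_nonneg ‖ξ + η‖]
  have h4 := mul_le_mul_of_nonneg_left h3 (norm_nonneg (mv T))
  nlinarith [norm_nonneg (mv S), sq_nonneg ‖η‖]

theorem eventually_smul_mem {H : Type*} [NormedAddCommGroup H] [NormedSpace ℝ H] (v : H)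
    {P : H → Prop} (hP : ∀ᶠ h in 𝓝 (0 : H), P h) : ∀ᶠ t : ℝ in 𝓝[>] 0, P (t • v) := by
  have : Tendsto (fun t : ℝ => t • v) (𝓝 0) (𝓝 ((0 : ℝ) • v)) :=
    (continuous_id.smul continuous_const).tendsto 0
  rw [zero_smul] at this
  exact (this.mono_left nhdsWithin_le_nhds).eventually hP

theorem le_of_forall_pos_mul {x y K : ℝ} (h : ∀ δ > 0, x ≤ y + δ * K) : x ≤ y := by
  by_contra hn
  push Not at hn
  have h1 := h ((x - y) / (2 * (|K| + 1))) (by have := abs_nonneg K; apply div_pos <;> linarith)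
  have h2 : (x - y) / (2 * (|K| + 1)) * K ≤ (x - y) / 2 := by
    rw [show (x - y) / (2 * (|K| + 1)) * K = (x - y) / 2 * (K / (|K| + 1)) by
      have : |K| + 1 ≠ 0 := by positivity
      field_simp]
    refine mul_le_of_le_one_right (by linarith) ?_
    rw [div_le_one (by positivity)]
    linarith [le_abs_self K]
  linarith

theorem supConv_jet {u U : En n → ℝ} {Z : En n → En n} {ε : ℝ}
    (h1 : ∀ x, U x = u (Z x) - ‖x - Z x‖ ^ 2 / (2 * ε))
    (h2 : ∀ x z, u z - ‖x - z‖ ^ 2 / (2 * ε) ≤ U x) {x p : En n} {X : Mat n}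
    (hJ : SJ U x p X) : SJ u (Z x) p X := by
  intro δ hδ
  filter_upwards [hJ δ hδ] with h hh
  have h3 := h2 (x + h) (Z x + h)
  rw [add_sub_add_right_eq_sub] at h3
  have h4 := h1 x
  linarith

/-- The product space with the Euclidean norm. -/
abbrev PairSp (n : ℕ) := WithLp 2 (En n × En n)

theorem pair_norm_sq (z : PairSp n) : ‖z‖ ^ 2 = ‖z.fst‖ ^ 2 + ‖z.snd‖ ^ 2 :=
  WithLp.prod_norm_sq_eq_of_L2 z

theorem pair_inner (z w : PairSp n) :
    inner ℝ z w = inner ℝ z.fst w.fst + inner ℝ z.snd w.snd :=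
  WithLp.prod_inner_apply z w

/-- The doubled function. -/
def dblFun (U₁ U₂ : En n → ℝ) (xh yh a b : En n) (S T : Mat n) (δ : ℝ) (z : PairSp n) : ℝ :=
  U₁ (xh + z.fst) + U₂ (yh + z.snd) - dblTest a b S T z.fst z.snd - δ / 2 * ‖z‖ ^ 2

theorem dblFun_add {U₁ U₂ : En n → ℝ} {xh yh a b : En n} {S T : Mat n} {δ : ℝ}
    (hS : S.IsSymm) (hT : T.IsSymm) (z ζ : PairSp n) :
    dblFun U₁ U₂ xh yh a b S T δ (z + ζ) = dblFun U₁ U₂ xh yh a b S T δ z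
      + (U₁ (xh + z.fst + ζ.fst) - U₁ (xh + z.fst)
        - inner ℝ (a + b + (mv S z.fst + mv T (z.fst - z.snd) + δ • z.fst)) ζ.fst)
      + (U₂ (yh + z.snd + ζ.snd) - U₂ (yh + z.snd)
        - inner ℝ (-b + (-mv T (z.fst - z.snd) + δ • z.snd)) ζ.snd)
      - (1 / 2) * (qf S ζ.fst + qf T (ζ.fst - ζ.snd) + δ * (‖ζ.fst‖ ^ 2 + ‖ζ.snd‖ ^ 2)) := by
  have h4 := dblTest_add (a := a) (b := b) hS hT z.fst z.snd ζ.fst ζ.snd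
  have h6 : ‖z + ζ‖ ^ 2 = ‖z‖ ^ 2 + 2 * inner ℝ z ζ + ‖ζ‖ ^ 2 := norm_add_sq_real z ζ
  rw [dblFun, h6, pair_norm_sq ζ, pair_inner z ζ, WithLp.add_fst, WithLp.add_snd, h4, dblFun]
  simp only [inner_add_left, inner_sub_left, inner_neg_left, inner_smul_left, ← add_assoc,
    conj_trivial]
  ring

theorem dblFun_hasSubgrad {U₁ U₂ : En n → ℝ} {xh yh a b : En n} {S T : Mat n} {δ K : ℝ}
    (hS : S.IsSymm) (hT : T.IsSymm)
    (hU₁ : ∀ x, ∃ c, ∀ ξ, U₁ x + inner ℝ c ξ - K / 2 * ‖ξ‖ ^ 2 ≤ U₁ (x + ξ))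
    (hU₂ : ∀ x, ∃ c, ∀ ξ, U₂ x + inner ℝ c ξ - K / 2 * ‖ξ‖ ^ 2 ≤ U₂ (x + ξ)) (z : PairSp n) :
    ∃ q, HasSubgrad (fun z => dblFun U₁ U₂ xh yh a b S T δ z
      + (K + (‖mv S‖ + 2 * ‖mv T‖) + δ) / 2 * ‖z‖ ^ 2) z q := by
  obtain ⟨c₁, hc₁⟩ := hU₁ (xh + z.fst)
  obtain ⟨c₂, hc₂⟩ := hU₂ (yh + z.snd)
  refine ⟨WithLp.toLp 2 (c₁ - (a + b + (mv S z.fst + mv T (z.fst - z.snd) + δ • z.fst)),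
        c₂ - (-b + (-mv T (z.fst - z.snd) + δ • z.snd)))
          + (K + (‖mv S‖ + 2 * ‖mv T‖) + δ) • z, fun w => ?_⟩
  obtain ⟨ζ, rfl⟩ : ∃ ζ, w = z + ζ := ⟨w - z, by abel⟩
  have h1 := hc₁ ζ.fst
  have h2 := hc₂ ζ.snd
  have h3 := qf_sub_le S T ζ.fst ζ.snd
  have h6 : ‖z + ζ‖ ^ 2 = ‖z‖ ^ 2 + 2 * inner ℝ z ζ + (‖ζ.fst‖ ^ 2 + ‖ζ.snd‖ ^ 2) := by
    rw [← pair_norm_sq]; exact norm_add_sq_real z ζ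
  simp only [dblFun_add hS hT z ζ, h6, add_sub_cancel_left]
  rw [inner_add_left (𝕜 := ℝ) (E := PairSp n), inner_smul_left (𝕜 := ℝ) (E := PairSp n),
    pair_inner (WithLp.toLp 2 _) ζ]
  simp only [WithLp.toLp_fst, WithLp.toLp_snd, inner_sub_left (𝕜 := ℝ) (E := En n) c₁,
    inner_sub_left (𝕜 := ℝ) (E := En n) c₂, conj_trivial]
  nlinarith

/-- Splitting a joint expansion of `f₁(ξ) + f₂(η)`. -/
theorem split_expansion {f₁ f₂ : En n → ℝ} (h₁ : f₁ 0 = 0) (h₂ : f₂ 0 = 0) {P₁ P₂ : En n}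
    {b : En n → En n → ℝ} (hb : ∀ (t : ℝ) ξ η, b (t • ξ) (t • η) = t ^ 2 * b ξ η)
    (hexp : ∀ δ > 0, ∀ᶠ ζ in 𝓝 (0 : PairSp n),
      |f₁ ζ.fst + f₂ ζ.snd - inner ℝ P₁ ζ.fst - inner ℝ P₂ ζ.snd - (1 / 2) * b ζ.fst ζ.snd|
        ≤ δ * (‖ζ.fst‖ ^ 2 + ‖ζ.snd‖ ^ 2)) :
    (∀ δ > 0, ∀ᶠ ξ in 𝓝 (0 : En n), |f₁ ξ - inner ℝ P₁ ξ - (1 / 2) * b ξ 0| ≤ δ * ‖ξ‖ ^ 2) ∧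
    (∀ δ > 0, ∀ᶠ η in 𝓝 (0 : En n), |f₂ η - inner ℝ P₂ η - (1 / 2) * b 0 η| ≤ δ * ‖η‖ ^ 2) ∧
    ∀ ξ η, b ξ 0 + b 0 η ≤ b ξ η := by
  have A : ∀ δ > 0, ∀ᶠ ξ in 𝓝 (0 : En n),
      |f₁ ξ - inner ℝ P₁ ξ - (1 / 2) * b ξ 0| ≤ δ * ‖ξ‖ ^ 2 := by
    intro δ hδ
    have hc : Tendsto (fun ξ : En n => (WithLp.toLp 2 (ξ, (0 : En n)) : PairSp n)) (𝓝 0)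
        (𝓝 (0 : PairSp n)) := by
      have : Continuous (fun ξ : En n => (WithLp.toLp 2 (ξ, (0 : En n)) : PairSp n)) := by fun_prop
      exact this.tendsto' 0 0 rfl
    filter_upwards [hc.eventually (hexp δ hδ)] with ξ hξ
    simpa [h₂] using hξ
  have B : ∀ δ > 0, ∀ᶠ η in 𝓝 (0 : En n),
      |f₂ η - inner ℝ P₂ η - (1 / 2) * b 0 η| ≤ δ * ‖η‖ ^ 2 := by
    intro δ hδ
    have hc : Tendsto (fun ξ : En n => (WithLp.toLp 2 ((0 : En n), ξ) : PairSp n)) (𝓝 0)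
        (𝓝 (0 : PairSp n)) := by
      have : Continuous (fun ξ : En n => (WithLp.toLp 2 ((0 : En n), ξ) : PairSp n)) := by fun_prop
      exact this.tendsto' 0 0 rfl
    filter_upwards [hc.eventually (hexp δ hδ)] with ξ hξ
    simpa [h₁] using hξ
  refine ⟨A, B, fun ξ η => ?_⟩
  refine le_of_forall_pos_mul (K := 4 * (‖ξ‖ ^ 2 + ‖η‖ ^ 2)) fun δ hδ => ?_
  obtain ⟨t, ⟨⟨h3, h4⟩, h5⟩, (ht : 0 < t)⟩ := (((eventually_smul_mem ξ (A δ hδ)).and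
    (eventually_smul_mem η (B δ hδ))).and (eventually_smul_mem
      (WithLp.toLp 2 (ξ, η) : PairSp n) (hexp δ hδ))).and self_mem_nhdsWithin |>.exists
  have e1 : b (t • ξ) 0 = t ^ 2 * b ξ 0 := by simpa using hb t ξ 0
  have e2 : b 0 (t • η) = t ^ 2 * b 0 η := by simpa using hb t 0 η
  simp only [WithLp.smul_fst, WithLp.smul_snd, WithLp.toLp_fst, WithLp.toLp_snd, hb] at h5
  rw [e1] at h3
  rw [e2] at h4
  simp only [norm_smul, Real.norm_eq_abs, mul_pow, sq_abs] at h3 h4 h5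
  have h3' := (abs_le.1 h3).1
  have h4' := (abs_le.1 h4).1
  have h5' := (abs_le.1 h5).2
  have : t ^ 2 * (b ξ 0 + b 0 η) ≤ t ^ 2 * (b ξ η + δ * (4 * (‖ξ‖ ^ 2 + ‖η‖ ^ 2))) := by
    nlinarith
  exact le_of_mul_le_mul_left this (by positivity)

/-- Extracting the jets from an expansion of the doubled function. -/
theorem jets_of_expansion {U₁ U₂ : En n → ℝ} {xh yh a b : En n} {S T : Mat n} {δ : ℝ}
    (hS : S.IsSymm) (hT : T.IsSymm) {z p : PairSp n} {B : PairSp n →L[ℝ] PairSp n}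
    (hexp : ∀ δ' > 0, ∀ᶠ ζ in 𝓝 (0 : PairSp n),
      |dblFun U₁ U₂ xh yh a b S T δ (z + ζ) - dblFun U₁ U₂ xh yh a b S T δ z - inner ℝ p ζ
        - (1 / 2) * inner ℝ (B ζ) ζ| ≤ δ' * ‖ζ‖ ^ 2)
    (hB : ∀ ζ, inner ℝ (B ζ) ζ ≤ 0) :
    ∃ X₁ X₂ : Mat n, X₁.IsSymm ∧ X₂.IsSymm ∧
      SJ U₁ (xh + z.fst)
        (p.fst + (a + b + (mv S z.fst + mv T (z.fst - z.snd) + δ • z.fst))) X₁ ∧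
      SJ U₂ (yh + z.snd) (p.snd + (-b + (-mv T (z.fst - z.snd) + δ • z.snd))) X₂ ∧
      ∀ ξ η, qf X₁ ξ + qf X₂ η ≤ qf S ξ + qf T (ξ - η) + δ * (‖ξ‖ ^ 2 + ‖η‖ ^ 2) := by
  set P₁ := p.fst + (a + b + (mv S z.fst + mv T (z.fst - z.snd) + δ • z.fst)) with hP₁
  set P₂ := p.snd + (-b + (-mv T (z.fst - z.snd) + δ • z.snd)) with hP₂
  set bb : En n → En n → ℝ := fun ξ η =>
    inner ℝ (B (WithLp.toLp 2 (ξ, η))) (WithLp.toLp 2 (ξ, η) : PairSp n) +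
      (qf S ξ + qf T (ξ - η) + δ * (‖ξ‖ ^ 2 + ‖η‖ ^ 2)) with hbb
  obtain ⟨h1, h2, h3⟩ := split_expansion (f₁ := fun ξ => U₁ (xh + z.fst + ξ) - U₁ (xh + z.fst))
    (f₂ := fun η => U₂ (yh + z.snd + η) - U₂ (yh + z.snd)) (P₁ := P₁) (P₂ := P₂) (b := bb)
    (by simp) (by simp)
    (by
      intro t ξ η
      have e : (WithLp.toLp 2 (t • ξ, t • η) : PairSp n) = t • WithLp.toLp 2 (ξ, η) := rfl
      simp only [hbb, e, map_smul, ← smul_sub, qf_vec_smul, norm_smul, Real.norm_eq_abs, mul_pow,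
        sq_abs, inner_smul_left (𝕜 := ℝ) (E := PairSp n), inner_smul_right (𝕜 := ℝ) (E := PairSp n),
        conj_trivial]
      ring)
    (by
      intro δ' hδ'
      filter_upwards [hexp δ' hδ'] with ζ hζ
      rw [pair_norm_sq ζ] at hζ
      convert hζ using 2
      rw [dblFun_add hS hT, pair_inner p ζ]
      have e : (WithLp.toLp 2 (ζ.fst, ζ.snd) : PairSp n) = ζ := rfl
      simp only [hbb, hP₁, hP₂, e, inner_add_left (𝕜 := ℝ) (E := En n)]
      ring)
  set iE := WithLp.prodContinuousLinearEquiv 2 ℝ (En n) (En n) with hiE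
  obtain ⟨Y₁, hY₁s, hY₁⟩ := exists_mat ((ContinuousLinearMap.fst ℝ (En n) (En n)).comp
    ((iE : PairSp n →L[ℝ] En n × En n).comp (B.comp
      ((iE.symm : En n × En n →L[ℝ] PairSp n).comp (ContinuousLinearMap.inl ℝ (En n) (En n))))))
  obtain ⟨Y₂, hY₂s, hY₂⟩ := exists_mat ((ContinuousLinearMap.snd ℝ (En n) (En n)).comp
    ((iE : PairSp n →L[ℝ] En n × En n).comp (B.comp
      ((iE.symm : En n × En n →L[ℝ] PairSp n).comp (ContinuousLinearMap.inr ℝ (En n) (En n))))))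
  have hY₁' : ∀ ξ, qf (Y₁ + S + T + δ • (1 : Mat n)) ξ = bb ξ 0 := by
    intro ξ
    have e : inner ℝ (B (WithLp.toLp 2 (ξ, (0 : En n)))) (WithLp.toLp 2 (ξ, (0 : En n)) : PairSp n)
        = qf Y₁ ξ := by
      rw [hY₁, pair_inner]
      simp [hiE]
    simp only [hbb, e, qf_add, qf_smul, qf_one, sub_zero, norm_zero]
    ring
  have hY₂' : ∀ η, qf (Y₂ + T + δ • (1 : Mat n)) η = bb 0 η := by
    intro η
    have e : inner ℝ (B (WithLp.toLp 2 ((0 : En n), η))) (WithLp.toLp 2 ((0 : En n), η) : PairSp n)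
        = qf Y₂ η := by
      rw [hY₂, pair_inner]
      simp [hiE]
    simp only [hbb, e, qf_add, qf_smul, qf_one, zero_sub, qf_vec_neg, norm_zero, qf_vec_zero]
    ring
  have h1s : (1 : Mat n).IsSymm := Matrix.isSymm_one
  refine ⟨_, _, ((hY₁s.add hS).add hT).add (h1s.smul δ), (hY₂s.add hT).add (h1s.smul δ), ?_, ?_, ?_⟩
  · intro δ' hδ'
    filter_upwards [h1 δ' hδ'] with ξ hξ
    rw [hY₁']
    have := (abs_le.1 hξ).2
    linarith
  · intro δ' hδ'
    filter_upwards [h2 δ' hδ'] with ξ hξ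
    rw [hY₂']
    have := (abs_le.1 hξ).2
    linarith
  · intro ξ η
    rw [hY₁', hY₂']
    refine (h3 ξ η).trans ?_
    have := hB (WithLp.toLp 2 (ξ, η))
    simp only [hbb]
    linarith

/-- The theorem on sums. -/
theorem theorem_on_sums {u₁ u₂ : En n → ℝ} (hu₁ : UpperSemicontinuous u₁)
    (hu₂ : UpperSemicontinuous u₂) {M : ℝ} (hM₁ : ∀ x, |u₁ x| ≤ M) (hM₂ : ∀ x, |u₂ x| ≤ M)
    {xh yh a b : En n} {S T : Mat n} (hS : S.IsSymm) (hT : T.IsSymm) {r : ℝ} (hr : 0 < r)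
    (hmax : ∀ h k, ‖h‖ ≤ r → ‖k‖ ≤ r →
      u₁ (xh + h) + u₂ (yh + k) ≤ u₁ xh + u₂ yh + dblTest a b S T h k) {δ : ℝ} (hδ : 0 < δ) :
    ∃ (x₁ x₂ p₁ p₂ : En n) (X₁ X₂ : Mat n), X₁.IsSymm ∧ X₂.IsSymm ∧
      SJ u₁ x₁ p₁ X₁ ∧ SJ u₂ x₂ p₂ X₂ ∧ ‖x₁ - xh‖ < δ ∧ ‖x₂ - yh‖ < δ ∧
      |u₁ x₁ - u₁ xh| < δ ∧ |u₂ x₂ - u₂ yh| < δ ∧ ‖p₁ - (a + b)‖ < δ ∧ ‖p₂ + b‖ < δ ∧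
      ∀ ξ η, qf X₁ ξ + qf X₂ η ≤ qf S ξ + qf T (ξ - η) + δ * (‖ξ‖ ^ 2 + ‖η‖ ^ 2) := by
  have hM0 : 0 ≤ M := (abs_nonneg _).trans (hM₁ 0)
  have hQc : Continuous fun z : En n × En n => dblTest a b S T z.1 z.2 := by
    unfold dblTest
    have := continuous_qf S
    have := continuous_qf T
    fun_prop
  have hQ0 : dblTest a b S T 0 0 = 0 := by simp [dblTest]
  -- the radii
  obtain ⟨ρ₁, hρ₁, hu₁'⟩ := Metric.eventually_nhds_iff.1 (hu₁ xh (u₁ xh + δ / 4) (by linarith))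
  obtain ⟨ρ₂, hρ₂, hu₂'⟩ := Metric.eventually_nhds_iff.1 (hu₂ yh (u₂ yh + δ / 4) (by linarith))
  have hE : ∀ᶠ z : En n × En n in 𝓝 0, |dblTest a b S T z.1 z.2| < δ / 4 ∧
      ‖mv S z.1 + mv T (z.1 - z.2) + δ • z.1‖ < δ / 2 ∧
      ‖-mv T (z.1 - z.2) + δ • z.2‖ < δ / 2 := by
    have c1 : Continuous fun z : En n × En n => |dblTest a b S T z.1 z.2| := hQc.abs
    have c2 : Continuous fun z : En n × En n => ‖mv S z.1 + mv T (z.1 - z.2) + δ • z.1‖ := by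
      fun_prop
    have c3 : Continuous fun z : En n × En n => ‖-mv T (z.1 - z.2) + δ • z.2‖ := by fun_prop
    refine (c1.continuousAt.eventually_lt continuousAt_const ?_).and
      ((c2.continuousAt.eventually_lt continuousAt_const ?_).and
        (c3.continuousAt.eventually_lt continuousAt_const ?_))
    · simp [hQ0, hδ]
    · simp [hδ]
    · simp [hδ]
  obtain ⟨ρ₃, hρ₃, hE'⟩ := Metric.eventually_nhds_iff.1 hE
  obtain ⟨ρ, hρ, hρr, hρ1, hρ2, hρ3, hρδ⟩ : ∃ ρ > 0, 2 * ρ ≤ r ∧ 2 * ρ ≤ ρ₁ ∧ 2 * ρ ≤ ρ₂ ∧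
      2 * ρ ≤ ρ₃ ∧ 2 * ρ ≤ δ := by
    refine ⟨min (min (min r ρ₁) (min ρ₂ ρ₃)) δ / 2, by positivity, ?_, ?_, ?_, ?_, ?_⟩
    all_goals
      rw [mul_div_cancel₀ _ (two_ne_zero)]
      simp
  have hK : IsCompact (Metric.closedBall (0 : En n × En n) r) := isCompact_closedBall _ _
  obtain ⟨ω, hω, hUC⟩ := Metric.uniformContinuousOn_iff.1
    (hK.uniformContinuousOn_of_continuous hQc.continuousOn) (δ * ρ ^ 2 / 4) (by positivity)
  set τ : ℝ := min ω ρ with hτ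
  have hτp : 0 < τ := by positivity
  set ε : ℝ := τ ^ 2 / (4 * M + 4) with hε
  have hεp : 0 < ε := by positivity
  have hετ : 4 * M * ε < τ ^ 2 := by
    rw [hε, mul_div_assoc', div_lt_iff₀ (by positivity)]
    nlinarith [sq_pos_of_pos hτp]
  obtain ⟨U₁, Z₁, hU₁, hU₁', hZ₁⟩ := exists_supConv hu₁ hM₁ hεp
  obtain ⟨U₂, Z₂, hU₂, hU₂', hZ₂⟩ := exists_supConv hu₂ hM₂ hεp
  have hZ₁τ : ∀ x, ‖Z₁ x - x‖ < τ := fun x =>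
    lt_of_pow_lt_pow_left₀ 2 hτp.le ((hZ₁ x).trans_lt hετ)
  have hZ₂τ : ∀ x, ‖Z₂ x - x‖ < τ := fun x =>
    lt_of_pow_lt_pow_left₀ 2 hτp.le ((hZ₂ x).trans_lt hετ)
  have hUZ₁ : ∀ x, U₁ x ≤ u₁ (Z₁ x) := fun x => by
    rw [hU₁]; have : 0 ≤ ‖x - Z₁ x‖ ^ 2 / (2 * ε) := by positivity
    linarith
  have hUZ₂ : ∀ x, U₂ x ≤ u₂ (Z₂ x) := fun x => by
    rw [hU₂]; have : 0 ≤ ‖x - Z₂ x‖ ^ 2 / (2 * ε) := by positivity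
    linarith
  have huU₁ : u₁ xh ≤ U₁ xh := by have := hU₁' xh xh; simpa using this
  have huU₂ : u₂ yh ≤ U₂ yh := by have := hU₂' yh yh; simpa using this
  have hfn : ∀ z : PairSp n, ‖z.fst‖ ≤ ‖z‖ := fun z => by
    refine le_of_sq_le_sq ?_ (norm_nonneg _)
    rw [pair_norm_sq z]; nlinarith [sq_nonneg ‖z.snd‖]
  have hsn : ∀ z : PairSp n, ‖z.snd‖ ≤ ‖z‖ := fun z => by
    refine le_of_sq_le_sq ?_ (norm_nonneg _)
    rw [pair_norm_sq z]; nlinarith [sq_nonneg ‖z.fst‖]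
  have hW0 : dblFun U₁ U₂ xh yh a b S T δ 0 = U₁ xh + U₂ yh := by
    simp only [dblFun, WithLp.zero_fst, WithLp.zero_snd, hQ0]
    simp
  obtain ⟨z, p, B, hz, hp, hWz, hexp, hB⟩ := exists_expansion
    (W := dblFun U₁ U₂ xh yh a b S T δ) (C := ε⁻¹ + (‖mv S‖ + 2 * ‖mv T‖) + δ) (r := ρ)
    (m := δ * ρ ^ 2 / 4) (ε := δ / 4) (by positivity) hρ (by positivity) (by positivity)
    (dblFun_hasSubgrad hS hT (fun x => ⟨_, supConv_semiconvex hεp hU₁ hU₁' x⟩)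
      (fun x => ⟨_, supConv_semiconvex hεp hU₂ hU₂' x⟩))
    (by
      intro z hz
      rw [hW0]
      have hzf := (hfn z).trans hz.le
      have hzs := (hsn z).trans hz.le
      set h' := Z₁ (xh + z.fst) - xh with hh'
      set k' := Z₂ (yh + z.snd) - yh with hk'
      have e1 : ‖h' - z.fst‖ < τ := by
        have := hZ₁τ (xh + z.fst)
        rwa [← sub_sub] at this
      have e2 : ‖k' - z.snd‖ < τ := by
        have := hZ₂τ (yh + z.snd)
        rwa [← sub_sub] at this
      have hτρ : τ ≤ ρ := min_le_right _ _
      have n1 : ‖h'‖ ≤ r := by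
        have := norm_add_le (h' - z.fst) z.fst
        rw [sub_add_cancel] at this; linarith
      have n2 : ‖k'‖ ≤ r := by
        have := norm_add_le (k' - z.snd) z.snd
        rw [sub_add_cancel] at this; linarith
      have h1 := hmax h' k' n1 n2
      have h2 := hUC (h', k') (by simp [Prod.norm_def, n1, n2])
        (z.fst, z.snd) (by
          have a1 : ‖z.fst‖ ≤ r := by linarith
          have a2 : ‖z.snd‖ ≤ r := by linarith
          simp [Prod.norm_def, a1, a2]) (by
          rw [Prod.dist_eq, dist_eq_norm, dist_eq_norm]
          exact max_lt (e1.trans_le (min_le_left _ _)) (e2.trans_le (min_le_left _ _)))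
      rw [Real.dist_eq] at h2
      have h3 := (abs_lt.1 h2).2
      simp only at h3
      have h4 := hUZ₁ (xh + z.fst)
      have h5 := hUZ₂ (yh + z.snd)
      have e3 : xh + h' = Z₁ (xh + z.fst) := by rw [hh']; abel
      have e4 : yh + k' = Z₂ (yh + z.snd) := by rw [hk']; abel
      rw [e3, e4] at h1
      simp only [dblFun, hz]
      linarith)
  rw [hW0] at hWz
  obtain ⟨X₁, X₂, hX₁, hX₂, hJ₁, hJ₂, hX⟩ := jets_of_expansion hS hT hexp hB
  have hzf := (hfn z).trans_lt hz
  have hzs := (hsn z).trans_lt hz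
  have hτρ : τ ≤ ρ := min_le_right _ _
  obtain ⟨q1, q2, q3⟩ := hE' (y := (z.fst, z.snd)) (by
    rw [dist_zero_right, Prod.norm_def]
    exact max_lt (by linarith) (by linarith))
  simp only at q1 q2 q3
  have d1 : ‖Z₁ (xh + z.fst) - xh‖ < 2 * ρ := by
    have h1 := hZ₁τ (xh + z.fst)
    have h2 := norm_add_le (Z₁ (xh + z.fst) - (xh + z.fst)) z.fst
    have e : Z₁ (xh + z.fst) - (xh + z.fst) + z.fst = Z₁ (xh + z.fst) - xh := by abel
    rw [e] at h2
    linarith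
  have d2 : ‖Z₂ (yh + z.snd) - yh‖ < 2 * ρ := by
    have h1 := hZ₂τ (yh + z.snd)
    have h2 := norm_add_le (Z₂ (yh + z.snd) - (yh + z.snd)) z.snd
    have e : Z₂ (yh + z.snd) - (yh + z.snd) + z.snd = Z₂ (yh + z.snd) - yh := by abel
    rw [e] at h2
    linarith
  have v1 := hu₁' (y := Z₁ (xh + z.fst)) (by rw [dist_eq_norm]; linarith)
  have v2 := hu₂' (y := Z₂ (yh + z.snd)) (by rw [dist_eq_norm]; linarith)
  have v3 := hUZ₁ (xh + z.fst)
  have v4 := hUZ₂ (yh + z.snd)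
  have v5 : 0 ≤ δ / 2 * ‖z‖ ^ 2 := by positivity
  have v6 := (abs_lt.1 q1).1
  simp only [dblFun] at hWz
  simp only at v1 v2
  have hpf := (hfn p).trans_lt hp
  have hps := (hsn p).trans_lt hp
  refine ⟨_, _, _, _, X₁, X₂, hX₁, hX₂, supConv_jet hU₁ hU₁' hJ₁, supConv_jet hU₂ hU₂' hJ₂,
    by linarith, by linarith, ?_, ?_, ?_, ?_, hX⟩
  · rw [abs_lt]; constructor <;> linarith
  · rw [abs_lt]; constructor <;> linarith
  · have e : p.fst + (a + b + (mv S z.fst + mv T (z.fst - z.snd) + δ • z.fst)) - (a + b)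
        = p.fst + (mv S z.fst + mv T (z.fst - z.snd) + δ • z.fst) := by abel
    rw [e]
    refine (norm_add_le _ _).trans_lt ?_
    linarith
  · have e : p.snd + (-b + (-mv T (z.fst - z.snd) + δ • z.snd)) + b
        = p.snd + (-mv T (z.fst - z.snd) + δ • z.snd) := by abel
    rw [e]
    refine (norm_add_le _ _).trans_lt ?_
    linarith

theorem qf_eq_dotProduct (X : Mat n) (h : En n) : qf X h = h.ofLp ⬝ᵥ (X *ᵥ h.ofLp) := by
  simp [qf, mv, EuclideanSpace.inner_eq_star_dotProduct]

/-- `c` is a lower bound of `-tr(AX)` over the Pucci matrices, i.e. `c ≤ P⁻(X)`. -/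
def PucciLB (lam Lam : ℝ) (X : Mat n) (c : ℝ) : Prop :=
  ∀ A ∈ PucciMatrices n lam Lam, c ≤ -(A * X).trace

/-- The part of uniform ellipticity used below. -/
def Ell (lam Lam : ℝ) (F : Mat n → ℝ) : Prop :=
  ∀ M N : Mat n, M.IsSymm → N.IsSymm → ∀ c, PucciLB lam Lam (M - N) c → F N + c ≤ F M

theorem posSemidef_of_qf {R : Mat n} (hR : R.IsSymm) (h : ∀ x, 0 ≤ qf R x) : R.PosSemidef := by
  refine Matrix.PosSemidef.of_dotProduct_mulVec_nonneg ?_ fun x => ?_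
  · rw [Matrix.IsHermitian, conjTranspose_eq_transpose_of_trivial]; exact hR
  · have := h (WithLp.toLp 2 x)
    rw [qf_eq_dotProduct] at this
    simpa using this

theorem trace_bounds {A R : Mat n} (hA : A ∈ PucciMatrices n lam Lam) (hR : R.IsSymm)
    (h : ∀ x, 0 ≤ qf R x) :
    lam * R.trace ≤ (A * R).trace ∧ (A * R).trace ≤ Lam * R.trace := by
  obtain ⟨hH, hev⟩ := hA
  have hpsd := posSemidef_of_qf hR h
  set U : Mat n := (hH.eigenvectorUnitary : Mat n) with hU
  have hUU : U * star U = 1 := by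
    exact Unitary.mul_star_self_of_mem hH.eigenvectorUnitary.2
  have hsp : A = U * diagonal hH.eigenvalues * star U := by
    have := hH.spectral_theorem
    simpa [Unitary.conjStarAlgAut_apply] using this
  set G : Mat n := star U * R * U with hG
  have hGp : G.PosSemidef := by
    have := hpsd.conjTranspose_mul_mul_same U
    simpa [hG, star_eq_conjTranspose] using this
  have ht : (A * R).trace = ∑ i, hH.eigenvalues i * G i i := by
    have e : (A * R).trace = (diagonal hH.eigenvalues * G).trace := by
      conv_lhs => rw [hsp]
      rw [hG, Matrix.mul_assoc, Matrix.mul_assoc, Matrix.trace_mul_comm]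
      simp only [Matrix.mul_assoc]
    rw [e, Matrix.trace]
    simp [Matrix.diagonal_mul]
  have hr : R.trace = ∑ i, G i i := by
    have e : G.trace = R.trace := by
      rw [hG, Matrix.trace_mul_comm, ← Matrix.mul_assoc, hUU, Matrix.one_mul]
    rw [← e]; rfl
  have hd : ∀ i, 0 ≤ G i i := fun i => hGp.diag_nonneg
  rw [ht, hr, Finset.mul_sum, Finset.mul_sum]
  exact ⟨Finset.sum_le_sum fun i _ => mul_le_mul_of_nonneg_right (hev i).1 (hd i),
    Finset.sum_le_sum fun i _ => mul_le_mul_of_nonneg_right (hev i).2 (hd i)⟩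

theorem smul_one_mem (hL : lam ≤ Lam) : lam • (1 : Mat n) ∈ PucciMatrices n lam Lam := by
  have hH : (lam • (1 : Mat n)).IsHermitian := by
    rw [Matrix.IsHermitian, conjTranspose_smul, conjTranspose_one]; simp
  refine ⟨hH, fun i => ?_⟩
  have h1 := hH.mulVec_eigenvectorBasis i
  have h2 : (hH.eigenvectorBasis i) ≠ 0 := hH.eigenvectorBasis.orthonormal.ne_zero i
  rw [Matrix.smul_mulVec, Matrix.one_mulVec, ← sub_eq_zero, ← sub_smul, smul_eq_zero] at h1
  have h3 : lam - hH.eigenvalues i = 0 := by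
    refine h1.resolve_right fun h => h2 ?_
    exact (WithLp.ofLp_eq_zero 2).1 h
  have : hH.eigenvalues i = lam := by linarith
  rw [this]
  exact ⟨le_rfl, hL⟩

theorem ell_of_uniformlyElliptic (hL : lam ≤ Lam) {F : Mat n → ℝ}
    (hF : UniformlyElliptic n lam Lam F) : Ell lam Lam F := by
  intro M N hM hN c hc
  have h1 := (hF M N hM hN).1
  have h2 : c ≤ PucciMinus n lam Lam (M - N) := by
    refine le_csInf ⟨_, _, smul_one_mem hL, rfl⟩ ?_
    rintro _ ⟨A, hA, rfl⟩
    exact hc A hA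
  linarith

/-- The dual operator `M ↦ -F(-M)`. -/
def dualF (F : Mat n → ℝ) (M : Mat n) : ℝ := -F (-M)

@[simp] theorem dualF_dualF (F : Mat n → ℝ) : dualF (dualF F) = F := by
  ext M; simp [dualF]

theorem Ell.dual {F : Mat n → ℝ} (hF : Ell lam Lam F) : Ell lam Lam (dualF F) := by
  intro M N hM hN c hc
  have := hF (-N) (-M) hN.neg hM.neg c (by rwa [neg_sub_neg])
  simp only [dualF]
  linarith

theorem PositivelyHomogeneous.dual {F : Mat n → ℝ} (hF : PositivelyHomogeneous n F) :
    PositivelyHomogeneous n (dualF F) := by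
  intro M η hη
  have := hF (-M) η hη
  simp only [dualF, ← smul_neg, this]
  ring

theorem PositivelyHomogeneous.map_zero {F : Mat n → ℝ} (hF : PositivelyHomogeneous n F) :
    F 0 = 0 := by
  simpa using hF 0 0 le_rfl

theorem PucciLB.add {X Y : Mat n} {c d : ℝ} (hX : PucciLB lam Lam X c)
    (hY : PucciLB lam Lam Y d) : PucciLB lam Lam (X + Y) (c + d) := by
  intro A hA
  have h1 := hX A hA
  have h2 := hY A hA
  rw [Matrix.mul_add, Matrix.trace_add]
  linarith

theorem PucciLB.smul {X : Mat n} {c κ : ℝ} (hκ : 0 ≤ κ) (hX : PucciLB lam Lam X c) :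
    PucciLB lam Lam (κ • X) (κ * c) := by
  intro A hA
  have h1 := mul_le_mul_of_nonneg_left (hX A hA) hκ
  rw [Matrix.mul_smul, Matrix.trace_smul, smul_eq_mul]
  linarith

theorem PucciLB.mono {X : Mat n} {c d : ℝ} (hX : PucciLB lam Lam X c) (h : d ≤ c) :
    PucciLB lam Lam X d := fun A hA => h.trans (hX A hA)

theorem PucciLB.of_le (hl : 0 ≤ lam) {X Y : Mat n} {c : ℝ} (hXs : X.IsSymm) (hYs : Y.IsSymm)
    (h : ∀ x, qf X x ≤ qf Y x) (hY : PucciLB lam Lam Y c) : PucciLB lam Lam X c := by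
  intro A hA
  have h1 := hY A hA
  have hp : ∀ x, 0 ≤ qf (Y - X) x := fun x => by rw [qf_sub]; linarith [h x]
  have h2 := (trace_bounds hA (hYs.sub hXs) hp).1
  have h3 : 0 ≤ (Y - X).trace := by
    exact (posSemidef_of_qf (hYs.sub hXs) hp).trace_nonneg
  have e : (A * (Y - X)).trace = (A * Y).trace - (A * X).trace := by
    rw [Matrix.mul_sub, Matrix.trace_sub]
  rw [e] at h2
  have := mul_nonneg hl h3
  linarith

theorem pucciLB_zero : PucciLB lam Lam (0 : Mat n) 0 := fun A _ => by simp

theorem pucciLB_one : PucciLB lam Lam (1 : Mat n) (-(n * Lam)) := by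
  intro A hA
  have h := (trace_bounds hA Matrix.isSymm_one (fun x => by rw [qf_one]; positivity)).2
  rw [Matrix.trace_one, Fintype.card_fin] at h
  linarith

theorem pucciLB_neg_one : PucciLB lam Lam (-(1 : Mat n)) (n * lam) := by
  intro A hA
  have h := (trace_bounds hA Matrix.isSymm_one (fun x => by rw [qf_one]; positivity)).1
  rw [Matrix.trace_one, Fintype.card_fin] at h
  rw [Matrix.mul_neg, Matrix.trace_neg]
  linarith

/-- The rank one matrix `y yᵀ`. -/
def rk (y : En n) : Mat n := Matrix.vecMulVec y.ofLp y.ofLp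

theorem rk_symm (y : En n) : (rk y).IsSymm := by
  rw [Matrix.IsSymm, rk, Matrix.transpose_vecMulVec]

theorem qf_rk (y h : En n) : qf (rk y) h = (inner ℝ y h) ^ 2 := by
  have : inner ℝ y h = y.ofLp ⬝ᵥ h.ofLp := by
    simp [EuclideanSpace.inner_eq_star_dotProduct, dotProduct_comm]
  rw [qf_eq_dotProduct, rk, Matrix.vecMulVec_mulVec, this]
  simp [dotProduct_comm h.ofLp]
  ring

theorem trace_rk (y : En n) : (rk y).trace = ‖y‖ ^ 2 := by
  rw [rk, Matrix.trace_vecMulVec, EuclideanSpace.real_norm_sq_eq]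
  simp [dotProduct, pow_two]

theorem pucciLB_rk (y : En n) : PucciLB lam Lam (rk y) (-(Lam * ‖y‖ ^ 2)) := by
  intro A hA
  have h := (trace_bounds hA (rk_symm y) (fun x => by rw [qf_rk]; positivity)).2
  rw [trace_rk] at h
  linarith

theorem pucciLB_neg_rk (y : En n) : PucciLB lam Lam (-rk y) (lam * ‖y‖ ^ 2) := by
  intro A hA
  have h := (trace_bounds hA (rk_symm y) (fun x => by rw [qf_rk]; positivity)).1
  rw [trace_rk] at h
  rw [Matrix.mul_neg, Matrix.trace_neg]
  linarith

theorem Ell.anti {F : Mat n → ℝ} (hF : Ell lam Lam F) (hl : 0 ≤ lam) {X Y : Mat n}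
    (hX : X.IsSymm) (hY : Y.IsSymm) (h : ∀ x, qf X x ≤ qf Y x) : F Y ≤ F X := by
  have := hF X Y hX hY 0 (PucciLB.of_le hl (hX.sub hY) Matrix.isSymm_zero
    (fun x => by rw [qf_sub, qf_zero]; linarith [h x]) pucciLB_zero)
  linarith

theorem Ell.add_smul_one {F : Mat n → ℝ} (hF : Ell lam Lam F) {X : Mat n} (hX : X.IsSymm)
    {δ : ℝ} (hδ : 0 ≤ δ) : F X - n * Lam * δ ≤ F (X + δ • (1 : Mat n)) := by
  have := hF (X + δ • (1 : Mat n)) X (hX.add (Matrix.isSymm_one.smul δ)) hX (δ * -(n * Lam))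
    (by rw [add_sub_cancel_left]; exact pucciLB_one.smul hδ)
  linarith

/-- Viscosity subsolutions of the profile equation, in terms of superjets. -/
def Sub (F : Mat n → ℝ) (α : ℝ) (f u : En n → ℝ) : Prop :=
  ∀ y p X, X.IsSymm → SJ u y p X → F X - (1 / 2) * inner ℝ p y - α * u y ≤ f y

/-- Viscosity supersolutions of the profile equation. -/
def Sup (F : Mat n → ℝ) (α : ℝ) (f v : En n → ℝ) : Prop :=
  Sub (dualF F) α (-f) (-v)

/-- Subsolutions of the extremal equation. -/
def PSub (lam Lam : ℝ) (α : ℝ) (g w : En n → ℝ) : Prop :=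
  ∀ y p (X : Mat n), X.IsSymm → SJ w y p X → ∀ c, PucciLB lam Lam X c →
    c - (1 / 2) * inner ℝ p y ≤ α * w y + g y

theorem SJ.add {u v : En n → ℝ} {y p q : En n} {X Y : Mat n} (hu : SJ u y p X) (hv : SJ v y q Y) :
    SJ (fun z => u z + v z) y (p + q) (X + Y) := by
  intro δ hδ
  filter_upwards [hu (δ / 2) (by linarith), hv (δ / 2) (by linarith)] with h h1 h2
  rw [inner_add_left, qf_add]
  linarith

theorem SJ.smul {u : En n → ℝ} {y p : En n} {X : Mat n} {κ : ℝ} (hκ : 0 ≤ κ) (hu : SJ u y p X) :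
    SJ (fun z => κ * u z) y (κ • p) (κ • X) := by
  intro δ hδ
  filter_upwards [hu (δ / (κ + 1)) (by positivity)] with h h1
  have h2 := mul_le_mul_of_nonneg_left h1 hκ
  have h3 : κ * (δ / (κ + 1) * ‖h‖ ^ 2) ≤ δ * ‖h‖ ^ 2 := by
    rw [← mul_assoc]
    refine mul_le_mul_of_nonneg_right ?_ (by positivity)
    rw [mul_div_assoc', div_le_iff₀ (by positivity)]
    nlinarith
  rw [inner_smul_left, qf_smul, conj_trivial]
  linarith

theorem SJ.of_le {u φ : En n → ℝ} {y p : En n} {X : Mat n} (hφ : SJ φ y p X)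
    (h : ∀ᶠ z in 𝓝 y, u z ≤ φ z) (he : u y = φ y) : SJ u y p X := by
  intro δ hδ
  have h' : ∀ᶠ k in 𝓝 (0 : En n), u (y + k) ≤ φ (y + k) := by
    have : Tendsto (fun k : En n => y + k) (𝓝 0) (𝓝 y) := by
      have : Continuous fun k : En n => y + k := by fun_prop
      simpa using this.tendsto 0
    exact this.eventually h
  filter_upwards [hφ δ hδ, h'] with k h1 h2
  rw [he]; linarith

theorem sj_of_quad {u : En n → ℝ} {y p : En n} {X : Mat n}
    (h : ∀ᶠ k in 𝓝 (0 : En n), u (y + k) ≤ u y + inner ℝ p k + (1 / 2) * qf X k) :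
    SJ u y p X := by
  intro δ hδ
  filter_upwards [h] with k hk
  have : 0 ≤ δ * ‖k‖ ^ 2 := by positivity
  linarith

theorem sj_const (c : ℝ) (y : En n) : SJ (fun _ => c) y 0 0 :=
  sj_of_quad (Eventually.of_forall fun k => by simp [qf_zero])

theorem sj_of_max {u : En n → ℝ} {y : En n} (h : ∀ᶠ z in 𝓝 y, u z ≤ u y) : SJ u y 0 0 :=
  (sj_const (u y) y).of_le h rfl

theorem SJ.const_nonneg {c : ℝ} {y p : En n} {X : Mat n} (h : SJ (fun _ => c) y p X) :
    p = 0 ∧ ∀ x, 0 ≤ qf X x := by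
  have hp : ∀ v, 0 ≤ inner ℝ p v := by
    intro v
    refine le_of_forall_pos_mul (K := 1) fun δ hδ => ?_
    have h1 := eventually_smul_mem v (h 1 one_pos)
    have h2 : ∀ᶠ t : ℝ in 𝓝[>] 0, t * ((1 / 2) * qf X v + ‖v‖ ^ 2) < δ := by
      have : Tendsto (fun t : ℝ => t * ((1 / 2) * qf X v + ‖v‖ ^ 2)) (𝓝[>] 0) (𝓝 0) := by
        have : Continuous (fun t : ℝ => t * ((1 / 2) * qf X v + ‖v‖ ^ 2)) := by fun_prop
        simpa using (this.tendsto 0).mono_left nhdsWithin_le_nhds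
      exact this.eventually (gt_mem_nhds hδ)
    obtain ⟨t, ht1, ht2, ht3⟩ := (h1.and (h2.and self_mem_nhdsWithin)).exists
    have ht0 : (0 : ℝ) < t := ht3
    rw [qf_vec_smul, inner_smul_right, norm_smul, Real.norm_eq_abs, mul_pow, sq_abs] at ht1
    have h5 : 0 ≤ t * (inner ℝ p v + t * ((1 / 2) * qf X v + ‖v‖ ^ 2)) := by nlinarith
    have := nonneg_of_mul_nonneg_right h5 ht0
    linarith
  have hp0 : p = 0 := by
    have h1 := hp (-p)
    rw [inner_neg_right, real_inner_self_eq_norm_sq] at h1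
    have : ‖p‖ ^ 2 = 0 := le_antisymm (by linarith) (by positivity)
    simpa using this
  refine ⟨hp0, fun x => ?_⟩
  refine le_of_forall_pos_mul (K := 2 * ‖x‖ ^ 2) fun δ hδ => ?_
  obtain ⟨t, ht1, ht3⟩ := ((eventually_smul_mem x (h δ hδ)).and self_mem_nhdsWithin).exists
  have ht0 : (0 : ℝ) < t := ht3
  rw [hp0, qf_vec_smul, inner_zero_left, norm_smul, Real.norm_eq_abs, mul_pow, sq_abs] at ht1
  have h5 : 0 ≤ t ^ 2 * (qf X x + δ * (2 * ‖x‖ ^ 2)) := by nlinarith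
  exact nonneg_of_mul_nonneg_right h5 (by positivity)

/-- Superjets of a function with a lower second order expansion. -/
theorem SJ.compare {φ : En n → ℝ} {y p p₀ : En n} {X X₀ : Mat n}
    (h : SJ φ y p X) (h₀ : SJ (fun z => -φ z) y (-p₀) (-X₀)) :
    p = p₀ ∧ ∀ x, qf X₀ x ≤ qf X x := by
  have h1 := h.add h₀
  simp only [add_neg_cancel] at h1
  obtain ⟨h2, h3⟩ := h1.const_nonneg
  refine ⟨by rwa [add_neg_eq_zero] at h2, fun x => ?_⟩
  have := h3 x
  rw [qf_add, qf_neg] at this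
  linarith

theorem TS_ineq {F : Mat n → ℝ} (hF : Ell lam Lam F)
    {u₁ u₂ f₁ f₂ : En n → ℝ} {α₁ α₂ : ℝ} (hu₁ : UpperSemicontinuous u₁)
    (hu₂ : UpperSemicontinuous u₂) {M : ℝ} (hM₁ : ∀ x, |u₁ x| ≤ M) (hM₂ : ∀ x, |u₂ x| ≤ M)
    (hf₁ : Continuous f₁) (hf₂ : Continuous f₂)
    (h₁ : Sub F α₁ f₁ u₁) (h₂ : Sub (dualF F) α₂ f₂ u₂)
    {xh yh a b : En n} {S T : Mat n} (hS : S.IsSymm) (hT : T.IsSymm) {r : ℝ} (hr : 0 < r)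
    (hmax : ∀ h k, ‖h‖ ≤ r → ‖k‖ ≤ r →
      u₁ (xh + h) + u₂ (yh + k) ≤ u₁ xh + u₂ yh + dblTest a b S T h k) {c K : ℝ}
    (hc : ∀ δ > 0, ∀ X₁ X₂ : Mat n, X₁.IsSymm → X₂.IsSymm →
      (∀ ξ η, qf X₁ ξ + qf X₂ η ≤ qf S ξ + qf T (ξ - η) + δ * (‖ξ‖ ^ 2 + ‖η‖ ^ 2)) →
      PucciLB lam Lam (X₁ + X₂) (c - K * δ)) :
    c - (1 / 2) * inner ℝ (a + b) xh + (1 / 2) * inner ℝ b yh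
      ≤ α₁ * u₁ xh + f₁ xh + α₂ * u₂ yh + f₂ yh := by
  have hpos : ∀ k : ℕ, (0 : ℝ) < 1 / ((k : ℝ) + 1) := fun k => by positivity
  have hlim : Tendsto (fun k : ℕ => 1 / ((k : ℝ) + 1)) atTop (𝓝 0) :=
    tendsto_one_div_add_atTop_nhds_zero_nat
  choose x₁ x₂ p₁ p₂ X₁ X₂ hX₁ hX₂ J₁ J₂ d1 d2 d3 d4 d5 d6 hm using fun k : ℕ =>
    theorem_on_sums hu₁ hu₂ hM₁ hM₂ hS hT hr hmax (hpos k)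
  have hneed : ∀ k : ℕ, c - K * (1 / ((k : ℝ) + 1)) - (1 / 2) * inner ℝ (p₁ k) (x₁ k)
      - (1 / 2) * inner ℝ (p₂ k) (x₂ k)
      ≤ α₁ * u₁ (x₁ k) + f₁ (x₁ k) + α₂ * u₂ (x₂ k) + f₂ (x₂ k) := by
    intro k
    have e1 := h₁ _ _ _ (hX₁ k) (J₁ k)
    have e2 := h₂ _ _ _ (hX₂ k) (J₂ k)
    have e3 := hF (X₁ k) (-X₂ k) (hX₁ k) (hX₂ k).neg _
      (by rw [sub_neg_eq_add]; exact hc _ (hpos k) _ _ (hX₁ k) (hX₂ k) (hm k))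
    simp only [dualF] at e2
    linarith
  have t1 : Tendsto x₁ atTop (𝓝 xh) :=
    tendsto_iff_norm_sub_tendsto_zero.2 (squeeze_zero (fun _ => norm_nonneg _)
      (fun k => (d1 k).le) hlim)
  have t2 : Tendsto x₂ atTop (𝓝 yh) :=
    tendsto_iff_norm_sub_tendsto_zero.2 (squeeze_zero (fun _ => norm_nonneg _)
      (fun k => (d2 k).le) hlim)
  have t3 : Tendsto (fun k => u₁ (x₁ k)) atTop (𝓝 (u₁ xh)) :=
    tendsto_iff_norm_sub_tendsto_zero.2 (squeeze_zero (fun _ => norm_nonneg _)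
      (fun k => (d3 k).le) hlim)
  have t4 : Tendsto (fun k => u₂ (x₂ k)) atTop (𝓝 (u₂ yh)) :=
    tendsto_iff_norm_sub_tendsto_zero.2 (squeeze_zero (fun _ => norm_nonneg _)
      (fun k => (d4 k).le) hlim)
  have t5 : Tendsto p₁ atTop (𝓝 (a + b)) :=
    tendsto_iff_norm_sub_tendsto_zero.2 (squeeze_zero (fun _ => norm_nonneg _)
      (fun k => (d5 k).le) hlim)
  have t6 : Tendsto p₂ atTop (𝓝 (-b)) :=
    tendsto_iff_norm_sub_tendsto_zero.2 (squeeze_zero (fun _ => norm_nonneg _)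
      (fun k => by simpa using (d6 k).le) hlim)
  have L := ((tendsto_const_nhds (x := c)).sub (hlim.const_mul K)).sub ((t5.inner t1).const_mul (1 / 2))
    |>.sub ((t6.inner t2).const_mul (1 / 2))
  have R := ((t3.const_mul α₁).add ((hf₁.tendsto xh).comp t1)).add (t4.const_mul α₂)
    |>.add ((hf₂.tendsto yh).comp t2)
  have := le_of_tendsto_of_tendsto' L R hneed
  rw [inner_neg_left] at this
  linarith

theorem quad_add {X : Mat n} (hX : X.IsSymm) (p h k : En n) :
    inner ℝ p (h + k) + (1 / 2) * qf X (h + k)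
      = inner ℝ p h + (1 / 2) * qf X h + inner ℝ (p + mv X h) k + (1 / 2) * qf X k := by
  rw [qf_vec_add hX, inner_add_right, inner_add_left]; ring

theorem continuous_quad (X : Mat n) (p : En n) :
    Continuous fun h => inner ℝ p h + (1 / 2) * qf X h := by
  have := continuous_qf X
  fun_prop

theorem sub_add_ineq (hl : 0 ≤ lam) {F : Mat n → ℝ} (hF : Ell lam Lam F)
    {u₁ u₂ f₁ f₂ : En n → ℝ} {α₁ α₂ : ℝ} (hu₁ : UpperSemicontinuous u₁)
    (hu₂ : UpperSemicontinuous u₂) {M : ℝ} (hM₁ : ∀ x, |u₁ x| ≤ M) (hM₂ : ∀ x, |u₂ x| ≤ M)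
    (hf₁ : Continuous f₁) (hf₂ : Continuous f₂)
    (h₁ : Sub F α₁ f₁ u₁) (h₂ : Sub (dualF F) α₂ f₂ u₂)
    {y p : En n} {X : Mat n} (hX : X.IsSymm) (hJ : SJ (fun z => u₁ z + u₂ z) y p X) {c : ℝ}
    (hc : PucciLB lam Lam X c) :
    c - (1 / 2) * inner ℝ p y ≤ α₁ * u₁ y + f₁ y + α₂ * u₂ y + f₂ y := by
  refine le_of_forall_pos_mul (K := 4 * (n * Lam)) fun δ hδ => ?_
  set S : Mat n := X + (4 * δ) • (1 : Mat n) with hSdef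
  have hS : S.IsSymm := hX.add (Matrix.isSymm_one.smul _)
  have hqS : ∀ h, qf S h = qf X h + 4 * δ * ‖h‖ ^ 2 := fun h => by
    rw [hSdef, qf_add, qf_smul, qf_one]
  obtain ⟨r', hr', hJ'⟩ := Metric.eventually_nhds_iff.1 (hJ δ hδ)
  set r := r' / 2 with hrdef
  have hr : 0 < r := by positivity
  set Q : En n → ℝ := fun h => inner ℝ p h + (1 / 2) * qf S h with hQ
  have hQc : Continuous Q := continuous_quad S p
  have hQ0 : Q 0 = 0 := by simp [hQ]
  have hJr : ∀ h, ‖h‖ ≤ r → u₁ (y + h) + u₂ (y + h) - Q h ≤ u₁ y + u₂ y - δ * ‖h‖ ^ 2 := by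
    intro h hh
    have := hJ' (y := h) (by rw [dist_zero_right]; linarith)
    simp only [hQ, hqS]
    linarith
  set K : Set (En n × En n) := Metric.closedBall 0 r ×ˢ Metric.closedBall 0 r with hK
  have hKc : IsCompact K := (isCompact_closedBall _ _).prod (isCompact_closedBall _ _)
  have h0K : (0 : En n × En n) ∈ K := by
    constructor <;> simp [hr.le]
  set e : ℕ → ℝ := fun j => 1 / ((j : ℝ) + 1) with he
  have hepos : ∀ j, 0 < e j := fun j => by simp only [he]; positivity
  have helim : Tendsto e atTop (𝓝 0) := tendsto_one_div_add_atTop_nhds_zero_nat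
  have hex : ∀ j : ℕ, ∃ z ∈ K, ∀ z' ∈ K,
      u₁ (y + z'.1) + u₂ (y + z'.2) - Q z'.1 - ‖z'.1 - z'.2‖ ^ 2 / (2 * e j)
      ≤ u₁ (y + z.1) + u₂ (y + z.2) - Q z.1 - ‖z.1 - z.2‖ ^ 2 / (2 * e j) := by
    intro j
    have husc : UpperSemicontinuous fun z : En n × En n =>
        (u₁ (y + z.1) + u₂ (y + z.2)) + (- Q z.1 - ‖z.1 - z.2‖ ^ 2 / (2 * e j)) :=
      ((hu₁.comp (by fun_prop : Continuous fun z : En n × En n => y + z.1)).add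
        (hu₂.comp (by fun_prop : Continuous fun z : En n × En n => y + z.2))).add
        (Continuous.upperSemicontinuous (by fun_prop))
    obtain ⟨z, hz, hm⟩ := husc.upperSemicontinuousOn _ |>.exists_isMaxOn ⟨0, h0K⟩ hKc
    refine ⟨z, hz, fun z' hz' => ?_⟩
    have := hm hz'
    simp only [mem_ofPred_eq] at this
    linarith
  choose z hzK hzm using hex
  set w0 := u₁ y + u₂ y with hw0
  set P : ℕ → ℝ := fun j => ‖(z j).1 - (z j).2‖ ^ 2 / (2 * e j) with hP
  have hP0 : ∀ j, 0 ≤ P j := fun j => div_nonneg (by positivity) (by linarith [hepos j])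
  have hlow : ∀ j, w0 + P j + Q (z j).1 ≤ u₁ (y + (z j).1) + u₂ (y + (z j).2) := by
    intro j
    have := hzm j 0 h0K
    simp [hQ0] at this
    simp only [hP, hw0]
    linarith
  obtain ⟨zs, hzs, φ, hφ, hlim⟩ := hKc.tendsto_subseq hzK
  obtain ⟨B, hB⟩ : ∃ B, ∀ z ∈ K, |Q z.1| ≤ B := by
    have := hKc.exists_bound_of_continuousOn (f := fun z : En n × En n => Q z.1)
      (hQc.comp continuous_fst).continuousOn
    simpa using this
  have hPb : ∀ j, P j ≤ 2 * M + B + |w0| := by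
    intro j
    have h1 := hlow j
    have h2 := (abs_le.1 (hB _ (hzK j))).1
    have h3 := (abs_le.1 (hM₁ (y + (z j).1))).2
    have h4 := (abs_le.1 (hM₂ (y + (z j).2))).2
    have h5 := neg_abs_le w0
    linarith
  have hd : Tendsto (fun j => ‖(z j).1 - (z j).2‖ ^ 2) atTop (𝓝 0) := by
    refine squeeze_zero (fun _ => by positivity) (fun j => ?_)
      (by simpa using helim.const_mul (2 * (2 * M + B + |w0|)))
    have := hPb j
    simp only [hP] at this
    rw [div_le_iff₀ (by linarith [hepos j])] at this
    linarith
  have hl1 : Tendsto (fun j => (z (φ j)).1) atTop (𝓝 zs.1) := (continuous_fst.tendsto _).comp hlim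
  have hl2 : Tendsto (fun j => (z (φ j)).2) atTop (𝓝 zs.2) := (continuous_snd.tendsto _).comp hlim
  have h12 : zs.1 = zs.2 := by
    have h1 := ((hl1.sub hl2).norm).pow 2
    have h2 := tendsto_nhds_unique h1 (hd.comp hφ.tendsto_atTop)
    rw [← sub_eq_zero]
    simpa using h2
  have hzs1 : ‖zs.1‖ ≤ r := by simpa using hzs.1
  have us1 : ∀ η > 0, ∀ᶠ j in atTop, u₁ (y + (z (φ j)).1) < u₁ (y + zs.1) + η := fun η hη =>
    ((continuous_const.add continuous_id).tendsto zs.1 |>.comp hl1).eventually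
      (hu₁ (y + zs.1) _ (by simpa using hη))
  have us2 : ∀ η > 0, ∀ᶠ j in atTop, u₂ (y + (z (φ j)).2) < u₂ (y + zs.1) + η := fun η hη => by
    rw [h12]
    exact ((continuous_const.add continuous_id).tendsto zs.2 |>.comp hl2).eventually
      (hu₂ (y + zs.2) _ (by simpa using hη))
  have hQl : Tendsto (fun j => Q (z (φ j)).1) atTop (𝓝 (Q zs.1)) := (hQc.tendsto _).comp hl1
  have hz0 : zs.1 = 0 := by
    have h1 : δ * ‖zs.1‖ ^ 2 ≤ 0 := by
      refine le_of_forall_pos_mul (K := 3) fun η hη => ?_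
      obtain ⟨j, a1, a2, a3⟩ := ((us1 η hη).and ((us2 η hη).and
        (hQl.eventually (lt_mem_nhds (show Q zs.1 - η < Q zs.1 by linarith))))).exists
      have a4 := hJr _ hzs1
      have a5 := hlow (φ j)
      have a6 := hP0 (φ j)
      linarith
    have h2 : ‖zs.1‖ ^ 2 ≤ 0 := by
      by_contra hcon
      push Not at hcon
      have := mul_pos hδ hcon
      linarith
    have h3 : ‖zs.1‖ ^ 2 = 0 := le_antisymm h2 (by positivity)
    simpa using h3
  rw [← h12] at hl2
  rw [hz0, hQ0] at hQl
  simp only [hz0, add_zero] at us1 us2 hl1 hl2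
  have tu1 : Tendsto (fun j => u₁ (y + (z (φ j)).1)) atTop (𝓝 (u₁ y)) := by
    rw [Metric.tendsto_nhds]
    intro η hη
    filter_upwards [us1 (η / 3) (by linarith), us2 (η / 3) (by linarith),
      hQl.eventually (lt_mem_nhds (show -(η / 3) < 0 by linarith))] with j a1 a2 a3
    have a5 := hlow (φ j)
    have a6 := hP0 (φ j)
    rw [Real.dist_eq, abs_lt]
    constructor <;> linarith
  have tu2 : Tendsto (fun j => u₂ (y + (z (φ j)).2)) atTop (𝓝 (u₂ y)) := by
    rw [Metric.tendsto_nhds]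
    intro η hη
    filter_upwards [us1 (η / 3) (by linarith), us2 (η / 3) (by linarith),
      hQl.eventually (lt_mem_nhds (show -(η / 3) < 0 by linarith))] with j a1 a2 a3
    have a5 := hlow (φ j)
    have a6 := hP0 (φ j)
    rw [Real.dist_eq, abs_lt]
    constructor <;> linarith
  have tP : Tendsto (fun j => P (φ j)) atTop (𝓝 0) := by
    have := ((tu1.add tu2).sub hQl).sub (tendsto_const_nhds (x := w0))
    simp only [hw0, sub_zero, sub_self] at this
    refine squeeze_zero (fun _ => hP0 _) (fun j => ?_) this
    have := hlow (φ j)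
    linarith
  have hyt : ∀ {g : ℕ → En n}, Tendsto g atTop (𝓝 0) →
      Tendsto (fun j => y + g j) atTop (𝓝 y) := fun hg => by
    simpa using (tendsto_const_nhds (x := y)).add hg
  have hneed : ∀ᶠ j in atTop, c - 4 * δ * (n * Lam)
      - (1 / 2) * inner ℝ (p + mv S (z (φ j)).1) (y + (z (φ j)).1) - P (φ j)
      ≤ α₁ * u₁ (y + (z (φ j)).1) + f₁ (y + (z (φ j)).1)
        + α₂ * u₂ (y + (z (φ j)).2) + f₂ (y + (z (φ j)).2) := by
    have s1 : ∀ᶠ j in atTop, ‖(z (φ j)).1‖ < r / 2 :=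
      hl1.norm.eventually (gt_mem_nhds (by simpa using (half_pos hr)))
    have s2 : ∀ᶠ j in atTop, ‖(z (φ j)).2‖ < r / 2 :=
      hl2.norm.eventually (gt_mem_nhds (by simpa using (half_pos hr)))
    filter_upwards [s1, s2] with j a1 a2
    have hej := hepos (φ j)
    have key := TS_ineq hF hu₁ hu₂ hM₁ hM₂ hf₁ hf₂ h₁ h₂
      (xh := y + (z (φ j)).1) (yh := y + (z (φ j)).2) (a := p + mv S (z (φ j)).1)
      (b := (1 / e (φ j)) • ((z (φ j)).1 - (z (φ j)).2)) (S := S)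
      (T := (1 / e (φ j)) • (1 : Mat n)) hS (Matrix.isSymm_one.smul _) (r := r / 2)
      (half_pos hr) ?_ (c := c - 4 * δ * (n * Lam)) (K := 2 * (n * Lam)) ?_
    · have e1 : inner ℝ ((1 / e (φ j)) • ((z (φ j)).1 - (z (φ j)).2)) (y + (z (φ j)).1)
          - inner ℝ ((1 / e (φ j)) • ((z (φ j)).1 - (z (φ j)).2)) (y + (z (φ j)).2)
          = 2 * P (φ j) := by
        rw [← inner_sub_right, add_sub_add_left_eq_sub, inner_smul_left, conj_trivial,
          real_inner_self_eq_norm_sq]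
        simp only [hP]
        field_simp
      rw [inner_add_left] at key
      linarith
    · intro ξ η hξ hη
      have hm := hzm (φ j) ((z (φ j)).1 + ξ, (z (φ j)).2 + η) ⟨by
        rw [mem_closedBall_zero_iff]; exact (norm_add_le _ _).trans (by linarith), by
        rw [mem_closedBall_zero_iff]; exact (norm_add_le _ _).trans (by linarith)⟩
      simp only [hQ, quad_add hS] at hm
      simp only [dblTest, qf_smul, qf_one]
      have e1 : ‖(z (φ j)).1 + ξ - ((z (φ j)).2 + η)‖ ^ 2 = ‖(z (φ j)).1 - (z (φ j)).2‖ ^ 2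
          + 2 * inner ℝ ((z (φ j)).1 - (z (φ j)).2) (ξ - η) + ‖ξ - η‖ ^ 2 := by
        rw [add_sub_add_comm, norm_add_sq_real]
      rw [e1] at hm
      rw [inner_smul_left, conj_trivial, add_assoc y, add_assoc y]
      have e2 : (‖(z (φ j)).1 - (z (φ j)).2‖ ^ 2
          + 2 * inner ℝ ((z (φ j)).1 - (z (φ j)).2) (ξ - η) + ‖ξ - η‖ ^ 2) / (2 * e (φ j))
          = ‖(z (φ j)).1 - (z (φ j)).2‖ ^ 2 / (2 * e (φ j))
          + 1 / e (φ j) * inner ℝ ((z (φ j)).1 - (z (φ j)).2) (ξ - η)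
          + 1 / 2 * (1 / e (φ j) * ‖ξ - η‖ ^ 2) := by
        field_simp
      rw [e2] at hm
      linarith
    · intro δ' hδ' X₁ X₂ hX₁ hX₂ hm
      have hle : ∀ x, qf (X₁ + X₂) x ≤ qf (X + (4 * δ + 2 * δ') • (1 : Mat n)) x := by
        intro x
        have := hm x x
        rw [sub_self, qf_vec_zero, hqS] at this
        rw [qf_add, qf_add, qf_smul, qf_one]
        linarith
      refine PucciLB.of_le hl (hX₁.add hX₂) (hX.add (Matrix.isSymm_one.smul _)) hle ?_
      refine (hc.add (pucciLB_one.smul (by positivity))).mono ?_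
      linarith
  have L := ((tendsto_const_nhds (x := c - 4 * δ * (n * Lam))).sub
    (((tendsto_const_nhds (x := p)).add (((mv S).continuous.tendsto 0).comp hl1)).inner
      (hyt hl1) |>.const_mul (1 / 2))).sub tP
  have R := ((tu1.const_mul α₁).add ((hf₁.tendsto y).comp (hyt hl1))).add (tu2.const_mul α₂)
    |>.add ((hf₂.tendsto y).comp (hyt hl2))
  have := le_of_tendsto_of_tendsto L R hneed
  simp only [map_zero, add_zero, sub_zero] at this
  linarith

/-- Stability of subsolutions under relaxed upper limits. -/
theorem sub_stable {F : Mat n → ℝ} (hF : Ell lam Lam F) {α : ℝ} {f w : En n → ℝ}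
    {y p : En n} (hf : ContinuousAt f y) {X : Mat n} (hX : X.IsSymm) (hJ : SJ w y p X)
    (H : ∀ ε > 0, ∃ (v : En n → ℝ) (α' : ℝ) (f' : En n → ℝ), UpperSemicontinuous v ∧
      Sub F α' f' v ∧ |α' - α| < ε ∧ (∀ z, ‖z - y‖ ≤ 1 → f' z ≤ f z + ε) ∧
      (∀ z, ‖z - y‖ ≤ 1 → v z ≤ w z + ε) ∧ ∃ z, ‖z - y‖ < ε ∧ w y - ε < v z) :
    F X - (1 / 2) * inner ℝ p y - α * w y ≤ f y := by
  rw [sub_sub, sub_le_iff_le_add]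
  refine le_of_forall_pos_mul (K := 4 * (n * Lam)) fun δ hδ => ?_
  set S : Mat n := X + (4 * δ) • (1 : Mat n) with hSdef
  have hS : S.IsSymm := hX.add (Matrix.isSymm_one.smul _)
  have hqS : ∀ h, qf S h = qf X h + 4 * δ * ‖h‖ ^ 2 := fun h => by
    rw [hSdef, qf_add, qf_smul, qf_one]
  have hFS : F X - n * Lam * (4 * δ) ≤ F S := hF.add_smul_one hX (by linarith)
  obtain ⟨r', hr', hJ'⟩ := Metric.eventually_nhds_iff.1 (hJ δ hδ)
  set r := min (r' / 2) 1 with hrdef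
  have hr : 0 < r := by positivity
  have hr1 : r ≤ 1 := min_le_right _ _
  have hr2 : r ≤ r' / 2 := min_le_left _ _
  set Q : En n → ℝ := fun h => inner ℝ p h + (1 / 2) * qf S h with hQ
  have hQc : Continuous Q := continuous_quad S p
  have hQ0 : Q 0 = 0 := by simp [hQ]
  have hJr : ∀ h, ‖h‖ ≤ r → w (y + h) - Q h ≤ w y - δ * ‖h‖ ^ 2 := by
    intro h hh
    have := hJ' (y := h) (by rw [dist_zero_right]; linarith)
    simp only [hQ, hqS]
    linarith
  set e : ℕ → ℝ := fun j => 1 / ((j : ℝ) + 1) with he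
  have hepos : ∀ j, 0 < e j := fun j => by simp only [he]; positivity
  have helim : Tendsto e atTop (𝓝 0) := tendsto_one_div_add_atTop_nhds_zero_nat
  choose v α' f' hv hsub hα hf' hvw z hz hzw using fun j => H (e j) (hepos j)
  have hzlim : Tendsto (fun j => z j - y) atTop (𝓝 0) :=
    squeeze_zero_norm (fun j => (hz j).le) helim
  have hex : ∀ j : ℕ, ∃ h, ‖h‖ ≤ r ∧ ∀ h', ‖h'‖ ≤ r → v j (y + h') - Q h' ≤ v j (y + h) - Q h := by
    intro j
    have husc : UpperSemicontinuous fun h => v j (y + h) + -Q h :=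
      ((hv j).comp (by fun_prop : Continuous fun h => y + h)).add hQc.neg.upperSemicontinuous
    obtain ⟨h, hh, hm⟩ := husc.upperSemicontinuousOn _ |>.exists_isMaxOn
      ⟨0, Metric.mem_closedBall_self hr.le⟩ (isCompact_closedBall (0 : En n) r)
    refine ⟨h, by simpa using hh, fun h' hh' => ?_⟩
    have := hm (show h' ∈ Metric.closedBall (0 : En n) r by simpa using hh')
    simp only [mem_ofPred_eq] at this
    linarith
  choose h hhr hmax using hex
  have hup : ∀ j, v j (y + h j) ≤ w y + e j + Q (h j) - δ * ‖h j‖ ^ 2 := by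
    intro j
    have h1 := hvw j (y + h j) (by rw [add_sub_cancel_left]; exact (hhr j).trans hr1)
    have h2 := hJr _ (hhr j)
    linarith
  have hlow : ∀ᶠ j in atTop, w y - e j - Q (z j - y) + Q (h j) ≤ v j (y + h j) := by
    have : ∀ᶠ j in atTop, ‖z j - y‖ < r := hzlim.norm.eventually (gt_mem_nhds (by simpa using hr))
    filter_upwards [this] with j hj
    have h1 := hmax j (z j - y) hj.le
    rw [add_sub_cancel] at h1
    have := hzw j
    linarith
  have hQz : Tendsto (fun j => Q (z j - y)) atTop (𝓝 0) := by
    simpa [hQ0, Function.comp_def] using (hQc.tendsto 0).comp hzlim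
  have hh0 : Tendsto h atTop (𝓝 0) := by
    have h1 : Tendsto (fun j => (2 * e j + Q (z j - y)) / δ) atTop (𝓝 0) := by
      simpa using ((helim.const_mul 2).add hQz).div_const δ
    have h2 : Tendsto (fun j => ‖h j‖ ^ 2) atTop (𝓝 0) := by
      refine squeeze_zero' (Eventually.of_forall fun _ => by positivity) ?_ h1
      filter_upwards [hlow] with j hj
      rw [le_div_iff₀ hδ]
      have := hup j
      linarith
    have h3 := h2.sqrt
    simp only [Real.sqrt_sq (norm_nonneg _), Real.sqrt_zero] at h3
    exact tendsto_zero_iff_norm_tendsto_zero.2 h3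
  have hQh : Tendsto (fun j => Q (h j)) atTop (𝓝 0) := by
    simpa [hQ0, Function.comp_def] using (hQc.tendsto 0).comp hh0
  have hvl : Tendsto (fun j => v j (y + h j)) atTop (𝓝 (w y)) := by
    have l1 : Tendsto (fun j => w y - e j - Q (z j - y) + Q (h j)) atTop (𝓝 (w y)) := by
      simpa using (((tendsto_const_nhds (x := w y)).sub helim).sub hQz).add hQh
    have l2 : Tendsto (fun j => w y + e j + Q (h j)) atTop (𝓝 (w y)) := by
      simpa using ((tendsto_const_nhds (x := w y)).add helim).add hQh
    refine tendsto_of_tendsto_of_tendsto_of_le_of_le' l1 l2 hlow (Eventually.of_forall fun j => ?_)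
    have := hup j
    have : 0 ≤ δ * ‖h j‖ ^ 2 := by positivity
    linarith
  have hneed : ∀ᶠ j in atTop, F S - (1 / 2) * inner ℝ (p + mv S (h j)) (y + h j)
      - α' j * v j (y + h j) ≤ f (y + h j) + e j := by
    have : ∀ᶠ j in atTop, ‖h j‖ < r := hh0.norm.eventually (gt_mem_nhds (by simpa using hr))
    filter_upwards [this] with j hj
    have hJ2 : SJ (v j) (y + h j) (p + mv S (h j)) S := by
      refine sj_of_quad ?_
      have hk : ∀ᶠ k in 𝓝 (0 : En n), ‖k‖ < r - ‖h j‖ :=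
        (continuous_norm.tendsto (0 : En n)).eventually (gt_mem_nhds (by simpa using hj))
      filter_upwards [hk] with k hk
      have := hmax j (h j + k) ((norm_add_le _ _).trans (by linarith))
      simp only [hQ, quad_add hS] at this
      rw [add_assoc]
      linarith
    have h1 := hsub j _ _ _ hS hJ2
    have h2 := hf' j (y + h j) (by rw [add_sub_cancel_left]; exact (hhr j).trans hr1)
    linarith
  have hyt : Tendsto (fun j => y + h j) atTop (𝓝 y) := by
    simpa using (tendsto_const_nhds (x := y)).add hh0
  have hαl : Tendsto α' atTop (𝓝 α) :=
    tendsto_iff_norm_sub_tendsto_zero.2 (squeeze_zero (fun _ => norm_nonneg _)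
      (fun k => (hα k).le) helim)
  have L := ((tendsto_const_nhds (x := F S)).sub
    (((tendsto_const_nhds (x := p)).add (((mv S).continuous.tendsto 0).comp hh0)).inner hyt
      |>.const_mul (1 / 2))).sub (hαl.mul hvl)
  have R := (hf.tendsto.comp hyt).add helim
  have := le_of_tendsto_of_tendsto L R hneed
  simp only [map_zero, add_zero] at this
  linarith

/-- The Gaussian `exp(-b|y|²)`. -/
def gs (b : ℝ) (y : En n) : ℝ := Real.exp (-b * ‖y‖ ^ 2)

theorem gs_pos (b : ℝ) (y : En n) : 0 < gs b y := Real.exp_pos _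

theorem gs_le_one {b : ℝ} (hb : 0 ≤ b) (y : En n) : gs b y ≤ 1 := by
  rw [gs, Real.exp_le_one_iff]
  have : 0 ≤ b * ‖y‖ ^ 2 := by positivity
  linarith

theorem continuous_gs (b : ℝ) : Continuous (gs b : En n → ℝ) := by
  unfold gs; fun_prop

/-- The gradient of a Gaussian. -/
def gsP (b : ℝ) (y : En n) : En n := (-(2 * b) * gs b y) • y

/-- The Hessian of a Gaussian. -/
def gsX (b : ℝ) (y : En n) : Mat n := gs b y • ((4 * b ^ 2) • rk y + (-(2 * b)) • (1 : Mat n))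

theorem gsX_symm (b : ℝ) (y : En n) : (gsX b y).IsSymm :=
  (((rk_symm y).smul _).add (Matrix.isSymm_one.smul _)).smul _

theorem gs_expand (b : ℝ) (y : En n) {δ : ℝ} (hδ : 0 < δ) : ∀ᶠ h in 𝓝 (0 : En n),
    |gs b (y + h) - gs b y - inner ℝ (gsP b y) h - (1 / 2) * qf (gsX b y) h| ≤ δ * ‖h‖ ^ 2 := by
  set G := gs b y with hG
  have hGp : 0 < G := gs_pos b y
  set s : En n → ℝ := fun h => -2 * b * inner ℝ y h - b * ‖h‖ ^ 2 with hs
  have hsc : Continuous s := by fun_prop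
  have hs0 : s 0 = 0 := by simp [hs]
  set A : ℝ := 2 * |b| * ‖y‖ + |b| with hA
  have hA0 : 0 ≤ A := by positivity
  have hsb : ∀ h : En n, ‖h‖ ≤ 1 → |s h| ≤ A * ‖h‖ := by
    intro h hh
    have h1 : |inner ℝ y h| ≤ ‖y‖ * ‖h‖ := abs_real_inner_le_norm _ _
    have h2 : |-2 * b * inner ℝ y h| ≤ 2 * |b| * (‖y‖ * ‖h‖) := by
      rw [abs_mul, abs_mul]; simp only [abs_neg, abs_two]; gcongr
    have h3 : |b * ‖h‖ ^ 2| ≤ |b| * ‖h‖ := by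
      rw [abs_mul, abs_of_nonneg (by positivity : 0 ≤ ‖h‖ ^ 2)]
      refine mul_le_mul_of_nonneg_left ?_ (abs_nonneg _)
      nlinarith [norm_nonneg h]
    have := abs_sub (-2 * b * inner ℝ y h) (b * ‖h‖ ^ 2)
    simp only [hs, hA]
    linarith
  have e1 : ∀ᶠ h in 𝓝 (0 : En n), |s h| ≤ 1 := by
    have : ∀ᶠ h in 𝓝 (0 : En n), |s h| < 1 :=
      (hsc.abs.tendsto 0).eventually (gt_mem_nhds (by simp [hs0]))
    filter_upwards [this] with h hh using hh.le
  set B : ℝ := G * (A ^ 3 + 2 * |b| ^ 2 * ‖y‖ + |b| ^ 2) with hB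
  have e2 : ∀ᶠ h in 𝓝 (0 : En n), B * ‖h‖ < δ := by
    have : Continuous fun h : En n => B * ‖h‖ := by fun_prop
    exact (this.tendsto 0).eventually (gt_mem_nhds (by simpa using hδ))
  have e3 : ∀ᶠ h in 𝓝 (0 : En n), ‖h‖ < 1 :=
    (continuous_norm.tendsto (0 : En n)).eventually (gt_mem_nhds (by simp))
  filter_upwards [e1, e2, e3] with h h1 h2 h3
  have k1 : gs b (y + h) = G * Real.exp (s h) := by
    rw [hG, gs, gs, ← Real.exp_add, norm_add_sq_real]
    congr 1
    simp only [hs]; ring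
  have k2 : |Real.exp (s h) - 1 - s h - s h ^ 2 / 2| ≤ |s h| ^ 3 := by
    have := Real.exp_bound (x := s h) h1 (n := 3) (by norm_num)
    simp only [Finset.sum_range_succ, Finset.sum_range_zero, Nat.factorial] at this
    norm_num at this
    have k3 : Real.exp (s h) - 1 - s h - s h ^ 2 / 2 = Real.exp (s h) - (1 + s h + s h ^ 2 / 2) := by
      ring
    rw [k3]
    refine this.trans ?_
    have : 0 ≤ |s h| ^ 3 := by positivity
    linarith
  have k3 : inner ℝ (gsP b y) h = -(2 * b) * G * inner ℝ y h := by
    rw [gsP, inner_smul_left, conj_trivial]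
  have k4 : qf (gsX b y) h = G * (4 * b ^ 2 * (inner ℝ y h) ^ 2 - 2 * b * ‖h‖ ^ 2) := by
    rw [gsX, qf_smul, qf_add, qf_smul, qf_smul, qf_rk, qf_one]; ring
  set t := inner ℝ y h with ht
  have k5 : gs b (y + h) - G - inner ℝ (gsP b y) h - (1 / 2) * qf (gsX b y) h
      = G * ((Real.exp (s h) - 1 - s h - s h ^ 2 / 2) + (2 * b ^ 2 * t * ‖h‖ ^ 2 +
        b ^ 2 * ‖h‖ ^ 4 / 2)) := by
    rw [k1, k3, k4]; simp only [hs, ← ht]; ring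
  rw [k5, abs_mul, abs_of_pos hGp]
  have k6 : |s h| ^ 3 ≤ A ^ 3 * ‖h‖ ^ 3 := by
    rw [← mul_pow]; exact pow_le_pow_left₀ (abs_nonneg _) (hsb h h3.le) 3
  have k7 : |2 * b ^ 2 * t * ‖h‖ ^ 2| ≤ 2 * |b| ^ 2 * ‖y‖ * ‖h‖ ^ 3 := by
    have h1 : |t| ≤ ‖y‖ * ‖h‖ := abs_real_inner_le_norm _ _
    rw [abs_mul, abs_mul, abs_of_nonneg (by positivity : 0 ≤ ‖h‖ ^ 2),
      abs_of_nonneg (by positivity : 0 ≤ 2 * b ^ 2), sq_abs]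
    calc 2 * b ^ 2 * |t| * ‖h‖ ^ 2 ≤ 2 * b ^ 2 * (‖y‖ * ‖h‖) * ‖h‖ ^ 2 := by gcongr
      _ = _ := by ring
  have k8 : |b ^ 2 * ‖h‖ ^ 4 / 2| ≤ |b| ^ 2 * ‖h‖ ^ 3 := by
    rw [abs_of_nonneg (by positivity), sq_abs]
    have : ‖h‖ ^ 4 ≤ ‖h‖ ^ 3 := pow_le_pow_of_le_one (norm_nonneg _) h3.le (by norm_num)
    have h5 : 0 ≤ b ^ 2 * ‖h‖ ^ 3 := by positivity
    nlinarith [mul_le_mul_of_nonneg_left this (sq_nonneg b)]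
  calc G * |(Real.exp (s h) - 1 - s h - s h ^ 2 / 2) + (2 * b ^ 2 * t * ‖h‖ ^ 2 +
        b ^ 2 * ‖h‖ ^ 4 / 2)|
      ≤ G * (A ^ 3 * ‖h‖ ^ 3 + (2 * |b| ^ 2 * ‖y‖ * ‖h‖ ^ 3 + |b| ^ 2 * ‖h‖ ^ 3)) := by
        refine mul_le_mul_of_nonneg_left ?_ hGp.le
        refine (abs_add_le _ _).trans (add_le_add (k2.trans k6) ((abs_add_le _ _).trans ?_))
        exact add_le_add k7 k8
    _ = (B * ‖h‖) * ‖h‖ ^ 2 := by simp only [hB]; ring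
    _ ≤ δ * ‖h‖ ^ 2 := mul_le_mul_of_nonneg_right h2.le (by positivity)

theorem sj_gs (b : ℝ) (y : En n) : SJ (gs b) y (gsP b y) (gsX b y) := by
  intro δ hδ
  filter_upwards [gs_expand b y hδ] with h hh
  have := (abs_le.1 hh).2
  linarith

theorem sj_neg_gs (b : ℝ) (y : En n) : SJ (fun z => -gs b z) y (-gsP b y) (-gsX b y) := by
  intro δ hδ
  filter_upwards [gs_expand b y hδ] with h hh
  have := (abs_le.1 hh).1
  rw [inner_neg_left, qf_neg]
  linarith

/-- The value `P⁻(D²ψ) - ½ y·Dψ` for a Gaussian is bounded below. -/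
theorem gsX_lb (hl : 0 < lam) (hL : lam ≤ Lam) {b : ℝ} (hb : 0 ≤ b) (hbL : b ≤ 1 / (8 * Lam))
    (y : En n) :
    ∃ c, PucciLB lam Lam (gsX b y) c ∧
      gs b y * (2 * b * n * lam + b * ‖y‖ ^ 2 / 2) ≤ c - (1 / 2) * inner ℝ (gsP b y) y := by
  refine ⟨gs b y * (4 * b ^ 2 * -(Lam * ‖y‖ ^ 2) + 2 * b * (n * lam)), ?_, ?_⟩
  · have e : gsX b y = gs b y • ((4 * b ^ 2) • rk y + (2 * b) • (-(1 : Mat n))) := by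
      rw [gsX, smul_neg, neg_smul]
    rw [e]
    exact (((pucciLB_rk y).smul (by positivity)).add (pucciLB_neg_one.smul (by positivity))).smul
      (gs_pos b y).le
  · rw [gsP, inner_smul_left, conj_trivial, real_inner_self_eq_norm_sq]
    have hLp : 0 < Lam := hl.trans_le hL
    have h1 : b * Lam ≤ 1 / 8 := by
      rw [le_div_iff₀ (by positivity)] at hbL; linarith
    have h2 : 4 * b ^ 2 * (Lam * ‖y‖ ^ 2) ≤ b * ‖y‖ ^ 2 / 2 := by
      have : 0 ≤ b * ‖y‖ ^ 2 := by positivity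
      nlinarith
    have := mul_le_mul_of_nonneg_left h2 (gs_pos b y).le
    nlinarith

theorem Sub.smul {F : Mat n → ℝ} (hF : PositivelyHomogeneous n F) {α : ℝ} {f u : En n → ℝ}
    (h : Sub F α f u) {κ : ℝ} (hκ : 0 < κ) :
    Sub F α (fun z => κ * f z) (fun z => κ * u z) := by
  intro y p X hX hJ
  have h1 := hJ.smul (inv_nonneg.2 hκ.le)
  have e : (fun z => κ⁻¹ * (κ * u z)) = u := by
    ext z; field_simp
  rw [e] at h1
  have h2 := mul_le_mul_of_nonneg_left (h y _ _ (hX.smul _) h1) hκ.le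
  rw [hF _ _ (inv_nonneg.2 hκ.le), inner_smul_left, conj_trivial] at h2
  have e2 : κ * (κ⁻¹ * F X - 1 / 2 * (κ⁻¹ * inner ℝ p y) - α * u y)
      = F X - 1 / 2 * inner ℝ p y - α * (κ * u y) := by
    field_simp
  linarith

theorem Sup.smul {F : Mat n → ℝ} (hF : PositivelyHomogeneous n F) {α : ℝ} {f v : En n → ℝ}
    (h : Sup F α f v) {κ : ℝ} (hκ : 0 < κ) :
    Sup F α (fun z => κ * f z) (fun z => κ * v z) := by
  have h1 := Sub.smul (PositivelyHomogeneous.dual hF) h hκ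
  have e1 : -(fun z => κ * f z) = fun z => κ * (-f) z := by ext z; simp
  have e2 : -(fun z => κ * v z) = fun z => κ * (-v) z := by ext z; simp
  rw [Sup, e1, e2]
  exact h1

theorem Sub.mono {F : Mat n → ℝ} {α α' : ℝ} {f f' u : En n → ℝ} (h : Sub F α f u)
    (hf : ∀ y, α * u y + f y ≤ α' * u y + f' y) : Sub F α' f' u := by
  intro y p X hX hJ
  have := h y p X hX hJ
  have := hf y
  linarith

theorem Sup.mono {F : Mat n → ℝ} {α α' : ℝ} {f f' v : En n → ℝ} (h : Sup F α f v)
    (hf : ∀ y, α' * v y + f' y ≤ α * v y + f y) : Sup F α' f' v := by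
  refine Sub.mono h fun y => ?_
  have := hf y
  simp only [Pi.neg_apply]
  linarith

theorem neg_usc {v : En n → ℝ} (hv : LowerSemicontinuous v) : UpperSemicontinuous (-v) := by
  intro y a ha
  have := hv y (-a) (by simp only [Pi.neg_apply] at ha; linarith)
  filter_upwards [this] with z hz
  simp only [Pi.neg_apply]; linarith

theorem sub_sup_ineq (hl : 0 ≤ lam) {F : Mat n → ℝ} (hF : Ell lam Lam F)
    {u v f₁ f₂ : En n → ℝ} {α₁ α₂ : ℝ} (hu : UpperSemicontinuous u)
    (hv : LowerSemicontinuous v) {M : ℝ} (hM₁ : ∀ x, |u x| ≤ M) (hM₂ : ∀ x, |v x| ≤ M)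
    (hf₁ : Continuous f₁) (hf₂ : Continuous f₂)
    (h₁ : Sub F α₁ f₁ u) (h₂ : Sup F α₂ f₂ v)
    {y p : En n} {X : Mat n} (hX : X.IsSymm) (hJ : SJ (fun z => u z - v z) y p X) {c : ℝ}
    (hc : PucciLB lam Lam X c) :
    c - (1 / 2) * inner ℝ p y ≤ α₁ * u y + f₁ y - α₂ * v y - f₂ y := by
  have := sub_add_ineq hl hF hu (neg_usc hv) hM₁ (fun x => by simpa using hM₂ x) hf₁ hf₂.neg h₁ h₂
    hX (by simpa [sub_eq_add_neg] using hJ) hc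
  simp only [Pi.neg_apply] at this
  linarith

theorem tendsto_gs {b : ℝ} (hb : 0 < b) : Tendsto (gs b : En n → ℝ) (cocompact _) (𝓝 0) := by
  have h1 : Tendsto (fun y : En n => b * ‖y‖ ^ 2) (cocompact _) atTop :=
    ((tendsto_pow_atTop two_ne_zero).comp tendsto_norm_cocompact_atTop).const_mul_atTop hb
  have := Real.tendsto_exp_neg_atTop_nhds_zero.comp h1
  refine this.congr fun y => ?_
  simp [gs]

theorem exists_max_of_decay {w g : En n → ℝ} (hw : UpperSemicontinuous w)
    (hg : Tendsto g (cocompact _) (𝓝 0)) (hwg : ∀ y, w y ≤ g y) {y₀ : En n} (h0 : 0 < w y₀) :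
    ∃ y, ∀ z, w z ≤ w y := by
  have h1 : ∀ᶠ z in cocompact (En n), g z < w y₀ := hg.eventually (gt_mem_nhds h0)
  obtain ⟨K, hK, hKs⟩ := mem_cocompact.1 h1
  obtain ⟨y, hy, hm⟩ := hw.upperSemicontinuousOn _ |>.exists_isMaxOn (s := insert y₀ K)
    ⟨y₀, mem_insert _ _⟩ (hK.insert y₀)
  refine ⟨y, fun z => ?_⟩
  have h3 : w y₀ ≤ w y := hm (mem_insert y₀ K)
  by_cases hz : z ∈ K
  · exact hm (mem_insert_of_mem _ hz)
  · have : g z < w y₀ := hKs hz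
    linarith [hwg z]

theorem usc_mul_pos {u g : En n → ℝ} (hu : UpperSemicontinuous u) (hg : Continuous g)
    (hp : ∀ z, 0 < g z) : UpperSemicontinuous fun z => u z * g z := by
  intro y a ha
  obtain ⟨η, hη, hηa⟩ : ∃ η > 0, (u y + η) * g y < a := by
    refine ⟨(a - u y * g y) / (2 * g y), div_pos (by linarith) (by linarith [hp y]), ?_⟩
    have := hp y
    have : (u y + (a - u y * g y) / (2 * g y)) * g y = (u y * g y + a) / 2 := by
      field_simp; ring
    linarith
  have h1 := hu y (u y + η) (by linarith)
  have h2 : ∀ᶠ z in 𝓝 y, (u y + η) * g z < a :=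
    ((continuous_const.mul hg).tendsto y).eventually (gt_mem_nhds hηa)
  filter_upwards [h1, h2] with z hz1 hz2
  exact (mul_lt_mul_of_pos_right hz1 (hp z)).trans hz2

theorem gs_mul_gs (a b : ℝ) (y : En n) : gs a y * gs b y = gs (a + b) y := by
  rw [gs, gs, gs, ← Real.exp_add]; congr 1; ring

theorem gs_mul_neg (b : ℝ) (y : En n) : gs b y * gs (-b) y = 1 := by
  rw [gs_mul_gs]; simp [gs]

/-- A subsolution which is nonpositive in a large ball and decays is nonpositive. -/
theorem psub_nonpos (hl : 0 < lam) (hL : lam ≤ Lam) {α β b' C R : ℝ} {g w : En n → ℝ}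
    (hw : UpperSemicontinuous w) (hP : PSub lam Lam α g w) (hg : ∀ y, R < ‖y‖ → g y ≤ 0)
    (hwb : ∀ y, w y ≤ C * gs b' y) (hβ : 0 < β) (hβb : β < b') (hβL : β ≤ 1 / (8 * Lam))
    (hR : 0 ≤ R) (hin : ∀ y, ‖y‖ ≤ R → w y ≤ 0) (hα : α ≤ β * R ^ 2 / 2) (y : En n) :
    w y ≤ 0 := by
  by_contra hcon
  push Not at hcon
  have husc := usc_mul_pos hw (continuous_gs (-β)) (gs_pos (-β))
  obtain ⟨z, hz⟩ := exists_max_of_decay (g := fun y => C * gs (b' - β) y) husc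
    (by simpa using (tendsto_gs (sub_pos.2 hβb)).const_mul C)
    (fun y => by
      rw [sub_eq_add_neg, ← gs_mul_gs, ← mul_assoc]
      exact mul_le_mul_of_nonneg_right (hwb y) (gs_pos _ _).le)
    (mul_pos hcon (gs_pos (-β) y))
  set κ := w z * gs (-β) z with hκ
  have hκ0 : 0 < κ := (mul_pos hcon (gs_pos (-β) y)).trans_le (hz y)
  have hwz : w z = κ * gs β z := by
    rw [hκ, mul_assoc, mul_comm (gs (-β) z), gs_mul_neg, mul_one]
  have hle : ∀ x, w x ≤ κ * gs β x := by
    intro x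
    have h1 := mul_le_mul_of_nonneg_right (hz x) (gs_pos β x).le
    rwa [mul_assoc, mul_comm (gs (-β) x), gs_mul_neg, mul_one] at h1
  have hwp : 0 < w z := by rw [hwz]; exact mul_pos hκ0 (gs_pos _ _)
  have hzR : R < ‖z‖ := by
    by_contra h
    push Not at h
    linarith [hin z h]
  have hJ : SJ w z (κ • gsP β z) (κ • gsX β z) :=
    ((sj_gs β z).smul hκ0.le).of_le (Eventually.of_forall hle) hwz
  obtain ⟨c, hc, hcl⟩ := gsX_lb hl hL hβ.le hβL z
  have h1 := hP z _ _ ((gsX_symm β z).smul κ) hJ _ (hc.smul hκ0.le)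
  rw [inner_smul_left, conj_trivial, hwz] at h1
  have h2 := hg z hzR
  have h3 := mul_le_mul_of_nonneg_left hcl hκ0.le
  have h4 : κ * gs β z * (2 * β * n * lam + β * ‖z‖ ^ 2 / 2 - α) ≤ 0 := by nlinarith
  have h5 : 0 < κ * gs β z := mul_pos hκ0 (gs_pos _ _)
  have h6 : 0 < 2 * β * n * lam + β * ‖z‖ ^ 2 / 2 - α := by
    have : R ^ 2 < ‖z‖ ^ 2 := pow_lt_pow_left₀ hzR hR two_ne_zero
    have := mul_lt_mul_of_pos_left this hβ
    have : 0 ≤ 2 * β * n * lam := by positivity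
    linarith
  linarith [mul_pos h5 h6]

theorem SJ.translate {φ : En n → ℝ} {y p : En n} {X : Mat n} (y₁ : En n)
    (h : SJ φ (y - y₁) p X) : SJ (fun z => φ (z - y₁)) y p X := by
  intro δ hδ
  filter_upwards [h δ hδ] with k hk
  rwa [add_sub_right_comm]

/-- Strong maximum principle. -/
theorem strong_max (hl : 0 < lam) (hL : lam ≤ Lam) {α : ℝ} {w : En n → ℝ} (hw : Continuous w)
    (hP : PSub lam Lam α 0 w) (hw0 : ∀ y, w y ≤ 0) {z : En n} (hz : w z = 0) (y : En n) :
    w y = 0 := by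
  by_contra hcon
  set Z : Set (En n) := {x | w x = 0} with hZ
  have hZc : IsClosed Z := isClosed_eq hw continuous_const
  obtain ⟨z₀, hz₀, hd⟩ := hZc.exists_infDist_eq_dist ⟨z, hz⟩ y
  set R := dist y z₀ with hR
  have hR0 : 0 < R := dist_pos.2 fun h => hcon (h ▸ hz₀)
  have hneg : ∀ x, ‖x - y‖ < R → w x < 0 := by
    intro x hx
    refine lt_of_le_of_ne (hw0 x) fun h => ?_
    have h1 : Metric.infDist y Z ≤ dist y x := Metric.infDist_le_dist_of_mem h
    rw [dist_comm, dist_eq_norm] at h1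
    linarith
  have hLp : 0 < Lam := hl.trans_le hL
  set k := (2 * n * Lam + R * (‖y‖ + R) + |α| + 1) / (lam * R ^ 2) + 1 with hk
  have hk1 : 1 ≤ k := by
    have : 0 ≤ (2 * n * Lam + R * (‖y‖ + R) + |α| + 1) / (lam * R ^ 2) := by positivity
    linarith
  have hkR : 2 * n * Lam + R * (‖y‖ + R) + |α| + 1 ≤ k * lam * R ^ 2 := by
    have h1 : (2 * n * Lam + R * (‖y‖ + R) + |α| + 1) / (lam * R ^ 2) * (lam * R ^ 2)
      = 2 * n * Lam + R * (‖y‖ + R) + |α| + 1 := div_mul_cancel₀ _ (by positivity)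
    have h2 : 0 ≤ lam * R ^ 2 := by positivity
    rw [← add_sub_cancel_right ((2 * n * Lam + R * (‖y‖ + R) + |α| + 1) / (lam * R ^ 2)) 1, ← hk]
      at h1
    linarith
  set E := Real.exp (-k * R ^ 2) with hE
  set H : En n → ℝ := fun x => gs k (x - y) - E with hH
  have hHc : Continuous H := ((continuous_gs k).comp (by fun_prop)).sub continuous_const
  have hHneg : ∀ x, R < ‖x - y‖ → H x < 0 := by
    intro x hx
    simp only [hH, gs, hE, sub_neg, Real.exp_lt_exp]
    have : R ^ 2 < ‖x - y‖ ^ 2 := pow_lt_pow_left₀ hx hR0.le two_ne_zero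
    nlinarith
  have hHz : H z₀ = 0 := by
    simp only [hH, gs, hE, hR, dist_eq_norm, norm_sub_rev y z₀, sub_self]
  have hz0w : w z₀ = 0 := hz₀
  have hzR : ‖z₀ - y‖ = R := by rw [hR, dist_eq_norm, norm_sub_rev]
  have hH1 : ∀ x, H x ≤ 1 := fun x => by
    have := gs_le_one (by linarith : 0 ≤ k) (x - y)
    have : 0 < E := Real.exp_pos _
    simp only [hH]; linarith
  -- smallness of `ε`
  obtain ⟨ε, hε, hεs⟩ : ∃ ε > 0, ∀ x, ‖x - y‖ = R / 2 → w x + ε * H x < 0 := by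
    rcases (Metric.sphere y (R / 2)).eq_empty_or_nonempty with hemp | hne
    · refine ⟨1, one_pos, fun x hx => ?_⟩
      have : x ∈ Metric.sphere y (R / 2) := by rwa [mem_sphere_iff_norm]
      rw [hemp] at this
      exact this.elim
    · obtain ⟨x₀, hx₀, hm⟩ := (isCompact_sphere y (R / 2)).exists_isMaxOn hne hw.continuousOn
      have h1 : w x₀ < 0 := hneg x₀ (by rw [mem_sphere_iff_norm.1 hx₀]; linarith)
      refine ⟨-w x₀ / 2, by linarith, fun x hx => ?_⟩
      have h2 : w x ≤ w x₀ := hm (mem_sphere_iff_norm.2 hx)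
      have h3 := mul_le_mul_of_nonneg_left (hH1 x) (by linarith : 0 ≤ -w x₀ / 2)
      linarith
  set K : Set (En n) := Metric.closedBall y (2 * R) ∩ {x | R / 2 ≤ ‖x - y‖} with hK
  have hKc : IsCompact K := (isCompact_closedBall _ _).inter_right
    (isClosed_le continuous_const (by fun_prop))
  have hz0K : z₀ ∈ K := by
    refine ⟨?_, ?_⟩
    · rw [mem_closedBall_iff_norm, hzR]; linarith
    · show R / 2 ≤ ‖z₀ - y‖
      rw [hzR]; linarith
  obtain ⟨x, hxK, hm⟩ := hKc.exists_isMaxOn (f := fun x => w x + ε * H x) ⟨z₀, hz0K⟩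
    (by fun_prop)
  have hx0 : 0 ≤ w x + ε * H x := by
    have := hm hz0K
    simp only [mem_ofPred_eq, hz0w, hHz, mul_zero, add_zero] at this
    exact this
  have hxl : R / 2 < ‖x - y‖ := by
    refine lt_of_le_of_ne hxK.2 fun h => ?_
    linarith [hεs x h.symm]
  have hxu : ‖x - y‖ ≤ R := by
    by_contra h
    push Not at h
    have := mul_neg_of_pos_of_neg hε (hHneg x h)
    linarith [hw0 x]
  set G := gs k (x - y) with hG
  have hGp : 0 < G := gs_pos _ _
  have hJ : SJ w x (-(ε • gsP k (x - y))) (-(ε • gsX k (x - y))) := by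
    have h1 : SJ (fun z => ε * -gs k (z - y)) x (ε • -gsP k (x - y)) (ε • -gsX k (x - y)) :=
      (SJ.translate y (sj_neg_gs k (x - y))).smul hε.le
    have h2 := h1.add (sj_const (w x + ε * gs k (x - y)) x)
    rw [add_zero, add_zero, smul_neg, smul_neg] at h2
    refine h2.of_le ?_ (by ring)
    have o1 : ∀ᶠ z in 𝓝 x, R / 2 < ‖z - y‖ :=
      ((by fun_prop : Continuous fun z : En n => ‖z - y‖).tendsto x).eventually (lt_mem_nhds hxl)
    have o2 : ∀ᶠ z in 𝓝 x, ‖z - y‖ < 2 * R :=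
      ((by fun_prop : Continuous fun z : En n => ‖z - y‖).tendsto x).eventually
        (gt_mem_nhds (by linarith))
    filter_upwards [o1, o2] with z hz1 hz2
    have := hm (show z ∈ K from ⟨by rw [mem_closedBall_iff_norm]; exact hz2.le, hz1.le⟩)
    simp only [mem_ofPred_eq, hH] at this
    linarith
  have hXe : -(ε • gsX k (x - y))
      = (ε * G) • ((4 * k ^ 2) • (-rk (x - y)) + (2 * k) • (1 : Mat n)) := by
    rw [gsX, smul_smul, ← hG, ← smul_neg]
    congr 1
    rw [neg_add, smul_neg, neg_smul, neg_neg]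
  have hLB : PucciLB lam Lam (-(ε • gsX k (x - y)))
      (ε * G * (4 * k ^ 2 * (lam * ‖x - y‖ ^ 2) + 2 * k * -(n * Lam))) := by
    rw [hXe]
    exact (((pucciLB_neg_rk _).smul (by positivity)).add (pucciLB_one.smul (by positivity))).smul
      (by positivity)
  have hfin := hP x _ _ (((gsX_symm k (x - y)).smul ε).neg) hJ _ hLB
  have hin : inner ℝ (-(ε • gsP k (x - y))) x = 2 * k * ε * G * inner ℝ (x - y) x := by
    rw [gsP, inner_neg_left, inner_smul_left, inner_smul_left, conj_trivial, conj_trivial]; ring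
  have hin2 : inner ℝ (x - y) x ≤ R * (‖y‖ + R) := by
    refine (real_inner_le_norm _ _).trans ?_
    have : ‖x‖ ≤ ‖y‖ + R := by
      calc ‖x‖ = ‖y + (x - y)‖ := by rw [add_sub_cancel]
        _ ≤ ‖y‖ + ‖x - y‖ := norm_add_le _ _
        _ ≤ _ := by linarith
    gcongr
  have hαw : α * w x ≤ |α| * (ε * G) := by
    have h1 : |w x| ≤ ε * G := by
      rw [abs_of_nonpos (hw0 x)]
      have : ε * H x ≤ ε * G := mul_le_mul_of_nonneg_left
        (by simp only [hH, ← hG]; linarith [Real.exp_pos (-k * R ^ 2)]) hε.le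
      linarith
    calc α * w x ≤ |α * w x| := le_abs_self _
      _ = |α| * |w x| := abs_mul _ _
      _ ≤ _ := mul_le_mul_of_nonneg_left h1 (abs_nonneg _)
  rw [hin] at hfin
  simp only [Pi.zero_apply, add_zero] at hfin
  have hεG : 0 < ε * G := mul_pos hε hGp
  have h4 : (ε * G) * (4 * k ^ 2 * (lam * ‖x - y‖ ^ 2) - 2 * k * (n * Lam)
      - k * inner ℝ (x - y) x - |α|) ≤ 0 := by linarith
  have h5 : 0 < 4 * k ^ 2 * (lam * ‖x - y‖ ^ 2) - 2 * k * (n * Lam)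
      - k * inner ℝ (x - y) x - |α| := by
    have h6 : R ^ 2 ≤ 4 * ‖x - y‖ ^ 2 := by nlinarith
    have h7 : k ^ 2 * lam * R ^ 2 ≤ 4 * k ^ 2 * (lam * ‖x - y‖ ^ 2) := by
      have := mul_le_mul_of_nonneg_left h6 (by positivity : 0 ≤ k ^ 2 * lam)
      linarith
    have h8 := mul_le_mul_of_nonneg_left hkR (by linarith : 0 ≤ k)
    have h9 := mul_le_mul_of_nonneg_left hin2 (by linarith : 0 ≤ k)
    have h10 : |α| ≤ k * |α| := le_mul_of_one_le_left (abs_nonneg _) hk1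
    nlinarith
  linarith [mul_pos hεG h5]

theorem sup_gs (hl : 0 < lam) (hL : lam ≤ Lam) {F : Mat n → ℝ} (hF : Ell lam Lam F)
    (hFh : PositivelyHomogeneous n F) {b : ℝ} (hb : 0 ≤ b) (hbL : b ≤ 1 / (8 * Lam)) {κ : ℝ}
    (hκ : 0 ≤ κ) (α : ℝ) :
    Sup F α (fun y => κ * gs b y * (2 * b * n * lam + b * ‖y‖ ^ 2 / 2 - α))
      (fun y => κ * gs b y) := by
  intro y p X hX hJ
  have h0 : SJ (fun z => κ * gs b z) y (κ • gsP b y) (κ • gsX b y) := (sj_gs b y).smul hκ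
  obtain ⟨h1, h2⟩ := SJ.compare (p₀ := -(κ • gsP b y)) (X₀ := -(κ • gsX b y)) hJ
    (by simpa only [Pi.neg_apply, neg_neg] using h0)
  have hXs : (κ • gsX b y).IsSymm := (gsX_symm b y).smul κ
  have h3 : F (κ • gsX b y) ≤ F (-X) := by
    refine hF.anti hl.le hX.neg hXs fun x => ?_
    have := h2 x
    rw [qf_neg] at this ⊢
    linarith
  obtain ⟨c, hc, hcl⟩ := gsX_lb hl hL hb hbL y
  have h4 := hF (κ • gsX b y) 0 hXs Matrix.isSymm_zero (κ * c)
    (by rw [sub_zero]; exact hc.smul hκ)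
  rw [PositivelyHomogeneous.map_zero hFh] at h4
  rw [h1, inner_neg_left, inner_smul_left, conj_trivial]
  simp only [dualF, Pi.neg_apply]
  have h5 := mul_le_mul_of_nonneg_left hcl hκ
  linarith

/-- Data common to decaying functions: bounds by a Gaussian give uniform bounds. -/
theorem abs_le_of_gs {u : En n → ℝ} {C b : ℝ} (hb : 0 ≤ b) (h0 : ∀ y, 0 ≤ u y)
    (hC : ∀ y, u y ≤ C * gs b y) (y : En n) : |u y| ≤ |C| := by
  rw [abs_of_nonneg (h0 y)]
  calc u y ≤ C * gs b y := hC y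
    _ ≤ |C| * gs b y := mul_le_mul_of_nonneg_right (le_abs_self _) (gs_pos _ _).le
    _ ≤ |C| * 1 := mul_le_mul_of_nonneg_left (gs_le_one hb y) (abs_nonneg _)
    _ = |C| := mul_one _

theorem exists_radius {β : ℝ} (hβ : 0 < β) (α : ℝ) : ∃ R > 0, α ≤ β * R ^ 2 / 2 := by
  refine ⟨2 * |α| / β + 1, by positivity, ?_⟩
  have h1 : 0 ≤ 2 * |α| / β := by positivity
  have h2 : β * (2 * |α| / β) = 2 * |α| := by field_simp
  have h3 := le_abs_self α
  have h4 : β * (2 * |α| / β + 1) ^ 2 / 2 =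
      β * (2 * |α| / β) ^ 2 / 2 + β * (2 * |α| / β) + β / 2 := by ring
  have h5 : 0 ≤ β * (2 * |α| / β) ^ 2 / 2 := by positivity
  rw [h4, h2]
  linarith [abs_nonneg α]

/-- On a compact ball, a strict inequality `u < v` between semicontinuous functions leaves room. -/
theorem exists_room {u v : En n → ℝ} (hu : UpperSemicontinuous u) (hv : LowerSemicontinuous v)
    {R : ℝ} (h : ∀ y, ‖y‖ ≤ R → u y < v y) {g : En n → ℝ} {M : ℝ} (hg : ∀ y, g y ≤ M) :
    ∃ ε > 0, ∀ y, ‖y‖ ≤ R → u y + ε * g y ≤ v y := by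
  have husc : UpperSemicontinuous fun y => u y + (-v) y := hu.add (neg_usc hv)
  rcases (Metric.closedBall (0 : En n) R).eq_empty_or_nonempty with he | hne
  · refine ⟨1, one_pos, fun y hy => ?_⟩
    have : y ∈ Metric.closedBall (0 : En n) R := mem_closedBall_zero_iff.2 hy
    rw [he] at this
    exact this.elim
  · obtain ⟨z, hz, hm⟩ := husc.upperSemicontinuousOn _ |>.exists_isMaxOn hne
      (isCompact_closedBall _ _)
    have h1 := h z (mem_closedBall_zero_iff.1 hz)
    refine ⟨(v z - u z) / (|M| + 1), div_pos (by linarith) (by positivity), fun y hy => ?_⟩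
    have h2 := hm (mem_closedBall_zero_iff.2 hy)
    simp only [mem_ofPred_eq, Pi.neg_apply] at h2
    have h3 : (v z - u z) / (|M| + 1) * g y ≤ v z - u z := by
      rw [div_mul_eq_mul_div, div_le_iff₀ (by positivity)]
      refine mul_le_mul_of_nonneg_left ?_ (by linarith)
      linarith [hg y, le_abs_self M]
    linarith

theorem lsc_const_mul {v : En n → ℝ} (hv : LowerSemicontinuous v) {c : ℝ} (hc : 0 < c) :
    LowerSemicontinuous fun y => c * v y := by
  intro y a ha
  have h : a / c < v y := (div_lt_iff₀' hc).2 ha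
  filter_upwards [hv y (a / c) h] with z hz
  exact (div_lt_iff₀' hc).1 hz

/-- Comparison principle with a positive right hand side. -/
theorem comparison (hl : 0 < lam) (hL : lam ≤ Lam) {F : Mat n → ℝ} (hF : Ell lam Lam F)
    (hFh : PositivelyHomogeneous n F) {b α C : ℝ} (hb : 0 < b) (hbL : b ≤ 1 / (8 * Lam))
    {f u v : En n → ℝ} (hf : Continuous f) (hfp : ∀ y, 0 < f y)
    (hu : UpperSemicontinuous u) (hu0 : ∀ y, 0 ≤ u y) (huC : ∀ y, u y ≤ C * gs b y)
    (hv : LowerSemicontinuous v) (hv0 : ∀ y, 0 < v y) (hvC : ∀ y, v y ≤ C * gs b y)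
    (hsu : Sub F α f u) (hsv : Sup F α f v) (y : En n) : u y ≤ v y := by
  have hLp : 0 < Lam := hl.trans_le hL
  obtain ⟨R, hR, hRα⟩ := exists_radius (half_pos hb) α
  have husc : ∀ c > 0, UpperSemicontinuous fun y => u y - c * v y := fun c hc => by
    have h := hu.add (neg_usc (lsc_const_mul hv hc))
    simp only [Pi.neg_apply, ← sub_eq_add_neg] at h
    exact h
  -- difference is a subsolution
  have hdiff : ∀ c > 0, PSub lam Lam α (fun y => (1 - c) * f y) (fun y => u y - c * v y) := by
    intro c hc x p X hX hJ d hd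
    have := sub_sup_ineq hl.le hF hu (lsc_const_mul hv hc) (M := |C| + c * |C|)
      (fun x => (abs_le_of_gs hb.le hu0 huC x).trans (by have := abs_nonneg C; nlinarith))
      (fun x => by
        rw [abs_mul, abs_of_pos hc]
        have := mul_le_mul_of_nonneg_left (abs_le_of_gs hb.le (fun y => (hv0 y).le) hvC x) hc.le
        linarith [abs_nonneg C])
      hf (hf.const_mul c) hsu (hsv.smul hFh hc) hX hJ hd
    linarith
  have hext : ∀ c ≥ 1, (∀ y, ‖y‖ ≤ R → u y ≤ c * v y) → ∀ y, u y ≤ c * v y := by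
    intro c hc hin y
    have := psub_nonpos hl hL (husc c (by linarith)) (hdiff c (by linarith)) (R := R) (C := C)
      (b' := b) (β := b / 2)
      (fun y _ => mul_nonpos_of_nonpos_of_nonneg (by linarith) (hfp y).le)
      (fun y => by have := mul_pos (by linarith : 0 < c) (hv0 y); linarith [huC y])
      (by linarith) (by linarith) (by linarith) hR.le
      (fun y hy => by linarith [hin y hy]) hRα y
    linarith
  set 𝒮 : Set ℝ := {c | 1 ≤ c ∧ ∀ y, u y ≤ c * v y} with h𝒮
  have hne : 𝒮.Nonempty := by
    obtain ⟨ε, hε, hεv⟩ := exists_room (u := fun _ : En n => (0 : ℝ))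
      continuous_const.upperSemicontinuous hv (R := R) (fun y _ => hv0 y) (g := u) (M := |C|)
      (fun y => (le_abs_self _).trans (abs_le_of_gs hb.le hu0 huC y))
    refine ⟨max 1 (1 / ε), le_max_left _ _, hext _ (le_max_left _ _) fun y hy => ?_⟩
    have h1 := hεv y hy
    have h2 : u y ≤ 1 / ε * v y := by
      rw [div_mul_eq_mul_div, le_div_iff₀ hε]; linarith
    exact h2.trans (mul_le_mul_of_nonneg_right (le_max_right _ _) (hv0 y).le)
  have hbd : BddBelow 𝒮 := ⟨1, fun c hc => hc.1⟩
  set c := sInf 𝒮 with hc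
  have hc1 : 1 ≤ c := le_csInf hne fun c hc => hc.1
  have hcu : ∀ y, u y ≤ c * v y := by
    intro y
    have : u y / v y ≤ c := le_csInf hne fun d hd => (div_le_iff₀ (hv0 y)).2 (hd.2 y)
    exact (div_le_iff₀ (hv0 y)).1 this
  rcases hc1.eq_or_lt with h1 | h1
  · have := hcu y
    rwa [← h1, one_mul] at this
  exfalso
  by_cases hstrict : ∀ y, ‖y‖ ≤ R → u y < c * v y
  · obtain ⟨ε, hε, hεv⟩ := exists_room hu (lsc_const_mul hv (by linarith : 0 < c)) hstrict
      (g := v) (M := |C|)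
      (fun y => (le_abs_self _).trans (abs_le_of_gs hb.le (fun y => (hv0 y).le) hvC y))
    have hmem : max 1 (c - ε) ∈ 𝒮 := by
      refine ⟨le_max_left _ _, hext _ (le_max_left _ _) fun y hy => ?_⟩
      have h2 := hεv y hy
      have h3 : u y ≤ (c - ε) * v y := by linarith
      exact h3.trans (mul_le_mul_of_nonneg_right (le_max_right _ _) (hv0 y).le)
    have := csInf_le hbd hmem
    have : max 1 (c - ε) < c := max_lt h1 (by linarith)
    linarith
  · push Not at hstrict
    obtain ⟨z, hz, hzc⟩ := hstrict
    have he : u z = c * v z := le_antisymm (hcu z) hzc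
    have hJ : SJ (fun y => u y - c * v y) z 0 0 :=
      sj_of_max (Eventually.of_forall fun x => by linarith [hcu x])
    have := hdiff c (by linarith) z 0 0 Matrix.isSymm_zero hJ 0 pucciLB_zero
    simp only [he, inner_zero_left, sub_self, mul_zero, zero_add] at this
    nlinarith [hfp z]

/-- A positive decaying solution of the homogeneous profile equation. -/
structure IsProfile (F : Mat n → ℝ) (α : ℝ) (φ : En n → ℝ) : Prop where
  cont : Continuous φ
  pos : ∀ y, 0 < φ y
  sub : Sub F α 0 φ
  sup : Sup F α 0 φ
  decay : ∃ C a, 0 < a ∧ ∀ y, φ y ≤ C * gs a y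

theorem IsProfile.unique (hl : 0 < lam) (hL : lam ≤ Lam) {F : Mat n → ℝ} (hF : Ell lam Lam F)
    (hFh : PositivelyHomogeneous n F) {α₁ α₂ : ℝ} {φ₁ φ₂ : En n → ℝ} (h₁ : IsProfile F α₁ φ₁)
    (h₂ : IsProfile F α₂ φ₂) (hα : α₁ ≤ α₂) :
    α₁ = α₂ ∧ ∃ c > 0, ∀ y, φ₂ y = c * φ₁ y := by
  have hLp : 0 < Lam := hl.trans_le hL
  obtain ⟨C₁, a, ha, hC₁⟩ := h₁.decay
  obtain ⟨C₂, a₂, ha₂, hC₂⟩ := h₂.decay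
  have hcφ : ∀ c, Continuous fun y => c * φ₁ y := fun c => continuous_const.mul h₁.cont
  set β := min (a / 2) (1 / (8 * Lam)) with hβ
  have hβ0 : 0 < β := by positivity
  have hβa : β < a := (min_le_left _ _).trans_lt (by linarith)
  obtain ⟨R, hR, hRα⟩ := exists_radius hβ0 α₁
  have hineq : ∀ c > 0, ∀ x p (X : Mat n), X.IsSymm → SJ (fun y => c * φ₁ y - φ₂ y) x p X → ∀ d,
      PucciLB lam Lam X d →
      d - (1 / 2) * inner ℝ p x ≤ α₁ * (c * φ₁ x) - α₂ * φ₂ x := by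
    intro c hc x p X hX hJ d hd
    have h0 : (fun z : En n => c * (0 : En n → ℝ) z) = 0 := by ext; simp
    have := sub_sup_ineq hl.le hF (hcφ c).upperSemicontinuous
      h₂.cont.lowerSemicontinuous (M := c * |C₁| + |C₂|)
      (fun x => by
        rw [abs_mul, abs_of_pos hc]
        have := mul_le_mul_of_nonneg_left (abs_le_of_gs ha.le (fun y => (h₁.pos y).le) hC₁ x) hc.le
        linarith [abs_nonneg C₂])
      (fun x => by
        have := abs_le_of_gs ha₂.le (fun y => (h₂.pos y).le) hC₂ x
        have := mul_nonneg hc.le (abs_nonneg C₁)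
        linarith)
      continuous_zero continuous_zero (h0 ▸ h₁.sub.smul hFh hc) h₂.sup hX hJ hd
    simp only [Pi.zero_apply] at this
    linarith
  have hP : ∀ c > 0, PSub lam Lam α₁ 0 (fun y => c * φ₁ y - φ₂ y) := by
    intro c hc x p X hX hJ d hd
    have := hineq c hc x p X hX hJ d hd
    have := mul_le_mul_of_nonneg_right hα (h₂.pos x).le
    simp only [Pi.zero_apply]
    linarith
  have hcont : ∀ c, Continuous fun y => c * φ₁ y - φ₂ y := fun c =>
    (hcφ c).sub h₂.cont
  have hext : ∀ c > 0, (∀ y, ‖y‖ ≤ R → c * φ₁ y ≤ φ₂ y) → ∀ y, c * φ₁ y ≤ φ₂ y := by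
    intro c hc hin y
    have := psub_nonpos hl hL (hcont c).upperSemicontinuous (hP c hc) (R := R) (C := c * C₁)
      (b' := a) (β := β) (fun _ _ => le_rfl)
      (fun y => by
        have := mul_le_mul_of_nonneg_left (hC₁ y) hc.le
        linarith [h₂.pos y])
      hβ0 hβa (min_le_right _ _) hR.le (fun y hy => by linarith [hin y hy]) hRα y
    linarith
  have hb₁ : ∀ y, φ₁ y ≤ |C₁| := fun y =>
    (le_abs_self _).trans (abs_le_of_gs ha.le (fun y => (h₁.pos y).le) hC₁ y)
  set 𝒮 : Set ℝ := {c | 0 < c ∧ ∀ y, c * φ₁ y ≤ φ₂ y} with h𝒮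
  have hne : 𝒮.Nonempty := by
    obtain ⟨ε, hε, hεv⟩ := exists_room (u := fun _ : En n => (0 : ℝ))
      continuous_const.upperSemicontinuous h₂.cont.lowerSemicontinuous (R := R)
      (fun y _ => h₂.pos y) (g := φ₁) (M := |C₁|) hb₁
    exact ⟨ε, hε, hext ε hε fun y hy => by linarith [hεv y hy]⟩
  have hbd : BddAbove 𝒮 := ⟨φ₂ 0 / φ₁ 0, fun c hc => (le_div_iff₀ (h₁.pos 0)).2 (hc.2 0)⟩
  set c := sSup 𝒮 with hc
  have hc0 : 0 < c := by
    obtain ⟨d, hd⟩ := hne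
    exact hd.1.trans_le (le_csSup hbd hd)
  have hcu : ∀ y, c * φ₁ y ≤ φ₂ y := by
    intro y
    have : c ≤ φ₂ y / φ₁ y := csSup_le hne fun d hd => (le_div_iff₀ (h₁.pos y)).2 (hd.2 y)
    exact (le_div_iff₀ (h₁.pos y)).1 this
  obtain ⟨z, hz⟩ : ∃ z, φ₂ z = c * φ₁ z := by
    by_contra hcon
    push Not at hcon
    have hst : ∀ y, ‖y‖ ≤ R → c * φ₁ y < φ₂ y := fun y _ =>
      lt_of_le_of_ne (hcu y) (hcon y).symm
    obtain ⟨ε, hε, hεv⟩ := exists_room (hcφ c).upperSemicontinuous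
      h₂.cont.lowerSemicontinuous hst (g := φ₁) (M := |C₁|) hb₁
    have hmem : c + ε ∈ 𝒮 := ⟨by linarith, hext _ (by linarith) fun y hy => by
      linarith [hεv y hy]⟩
    linarith [le_csSup hbd hmem]
  have hall : ∀ y, c * φ₁ y - φ₂ y = 0 :=
    strong_max hl hL (hcont c) (hP c hc0) (fun y => by linarith [hcu y]) (z := z)
      (by linarith)
  refine ⟨le_antisymm hα ?_, c, hc0, fun y => by linarith [hall y]⟩
  have h0 := hineq c hc0 z 0 0 Matrix.isSymm_zero
    (sj_of_max (Eventually.of_forall fun x => by linarith [hcu x])) 0 pucciLB_zero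
  rw [← hz, inner_zero_left] at h0
  have : 0 ≤ (α₁ - α₂) * φ₂ z := by linarith
  have := nonneg_of_mul_nonneg_left this (h₂.pos z)
  linarith

/-- Upper semicontinuous envelope of a locally bounded function. -/
def uscEnv (u : En n → ℝ) (y : En n) : ℝ := sInf {c | ∀ᶠ z in 𝓝 y, u z ≤ c}

section Env

variable {u V : En n → ℝ} {m : ℝ}

theorem uscEnv_bddBelow (hm : ∀ y, m ≤ u y) (y : En n) :
    BddBelow {c | ∀ᶠ z in 𝓝 y, u z ≤ c} :=
  ⟨m, fun _ hc => (hm y).trans hc.self_of_nhds⟩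

theorem uscEnv_le (hm : ∀ y, m ≤ u y) {y : En n} {c : ℝ} (h : ∀ᶠ z in 𝓝 y, u z ≤ c) :
    uscEnv u y ≤ c :=
  csInf_le (uscEnv_bddBelow hm y) h

theorem uscEnv_nonempty (hV : Continuous V) (hu : ∀ y, u y ≤ V y) (y : En n) :
    {c | ∀ᶠ z in 𝓝 y, u z ≤ c}.Nonempty := by
  refine ⟨V y + 1, ?_⟩
  have : ∀ᶠ z in 𝓝 y, V z < V y + 1 := hV.continuousAt.eventually_lt_const (by linarith)
  filter_upwards [this] with z hz using (hu z).trans hz.le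

theorem eventually_le_of_uscEnv_lt (hV : Continuous V) (hu : ∀ y, u y ≤ V y) {y : En n} {c : ℝ}
    (h : uscEnv u y < c) : ∀ᶠ z in 𝓝 y, u z ≤ c := by
  obtain ⟨d, hd, hdc⟩ := exists_lt_of_csInf_lt (uscEnv_nonempty hV hu y) h
  exact Eventually.mono hd fun z hz => hz.trans hdc.le

theorem le_uscEnv (hV : Continuous V) (hu : ∀ y, u y ≤ V y) (y : En n) : u y ≤ uscEnv u y :=
  le_csInf (uscEnv_nonempty hV hu y) fun _ hc => Filter.Eventually.self_of_nhds (p := fun z => u z ≤ _) hc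

theorem uscEnv_usc (hm : ∀ y, m ≤ u y) (hV : Continuous V) (hu : ∀ y, u y ≤ V y) :
    UpperSemicontinuous (uscEnv u) := by
  intro y c hc
  obtain ⟨d, hd, hdc⟩ := exists_between hc
  filter_upwards [(eventually_le_of_uscEnv_lt hV hu hd).eventually_nhds] with z hz
  exact (uscEnv_le hm hz).trans_lt hdc

theorem uscEnv_le_cont (hm : ∀ y, m ≤ u y) (hV : Continuous V) (hu : ∀ y, u y ≤ V y) (y : En n) :
    uscEnv u y ≤ V y := by
  refine le_of_forall_gt_imp_ge_of_dense fun c hc => ?_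
  refine uscEnv_le hm ?_
  have : ∀ᶠ z in 𝓝 y, V z < c := hV.continuousAt.eventually_lt_const hc
  filter_upwards [this] with z hz using (hu z).trans hz.le

theorem exists_near_uscEnv (hm : ∀ y, m ≤ u y) (y : En n) {ε : ℝ} (hε : 0 < ε) :
    ∃ z, ‖z - y‖ < ε ∧ uscEnv u y - ε < u z := by
  by_contra hcon
  push Not at hcon
  have : ∀ᶠ z in 𝓝 y, u z ≤ uscEnv u y - ε := by
    filter_upwards [Metric.ball_mem_nhds y hε] with z hz
    exact hcon z (by rwa [← dist_eq_norm])
  linarith [uscEnv_le hm this]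

end Env

/-- The quadratic polynomial with second order expansion `(c, p, X)` at `y`. -/
def quadP (c : ℝ) (y p : En n) (X : Mat n) (z : En n) : ℝ :=
  c + (inner ℝ p (z - y) + (1 / 2) * qf X (z - y))

theorem continuous_quadP (c : ℝ) (y p : En n) (X : Mat n) : Continuous (quadP c y p X) :=
  continuous_const.add ((continuous_quad X p).comp (continuous_id.sub continuous_const))

theorem quadP_add {X : Mat n} (hX : X.IsSymm) (c : ℝ) (y p z k : En n) :
    quadP c y p X (z + k) =
      quadP c y p X z + inner ℝ (p + mv X (z - y)) k + (1 / 2) * qf X k := by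
  rw [quadP, quadP, show z + k - y = (z - y) + k by abel, quad_add hX]; ring

theorem sj_quadP {X : Mat n} (hX : X.IsSymm) (c : ℝ) (y p z : En n) :
    SJ (quadP c y p X) z (p + mv X (z - y)) X :=
  sj_of_quad (Eventually.of_forall fun k => (quadP_add hX c y p z k).le)

theorem sj_neg_quadP {X : Mat n} (hX : X.IsSymm) (c : ℝ) (y p z : En n) :
    SJ (fun x => -quadP c y p X x) z (-(p + mv X (z - y))) (-X) :=
  sj_of_quad (Eventually.of_forall fun k => by
    rw [quadP_add hX c y p z k, inner_neg_left, qf_neg]; linarith)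

theorem Sub.of_sj_le {F : Mat n → ℝ} (hl : 0 ≤ lam) (hF : Ell lam Lam F) {q : En n → ℝ}
    {z p p' : En n} {X X' : Mat n} (hX : X.IsSymm) (hX' : X'.IsSymm)
    (h : SJ q z p' X') (h₀ : SJ (fun x => -q x) z (-p) (-X)) {α c : ℝ}
    (hq : F X - (1 / 2) * inner ℝ p z - α * q z ≤ c) :
    F X' - (1 / 2) * inner ℝ p' z - α * q z ≤ c := by
  obtain ⟨h1, h2⟩ := SJ.compare h h₀
  rw [h1]
  linarith [hF.anti hl hX hX' h2]

/-- Bump construction in Perron's method. -/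
theorem exists_bump (hl : 0 ≤ lam) {F : Mat n → ℝ} (hF : Ell lam Lam F) (hL : 0 ≤ Lam) {α : ℝ}
    {f u ul V : En n → ℝ} (hf : Continuous f) (hV : Continuous V)
    (hu : UpperSemicontinuous u) (hsu : Sub F α f u) (huV : ∀ y, u y ≤ V y)
    (hul : ∀ y, ul y ≤ u y) {y P : En n} {Y : Mat n} (hY : Y.IsSymm)
    (hJ : SJ (-ul) y (-P) (-Y)) (hyV : ul y < V y)
    (hbad : F Y - (1 / 2) * inner ℝ P y - α * ul y < f y) :
    ∃ w : En n → ℝ, UpperSemicontinuous w ∧ Sub F α f w ∧ (∀ z, w z ≤ V z) ∧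
      ∃ η > 0, ∀ᶠ z in 𝓝 y, ul y + η ≤ w z := by
  set γ := f y - (F Y - (1 / 2) * inner ℝ P y - α * ul y) with hγ
  have hγ0 : 0 < γ := by linarith
  obtain ⟨δ, hδ, hδγ⟩ : ∃ δ > 0, n * Lam * (4 * δ) < γ := by
    refine ⟨γ / (4 * (n * Lam + 1)), by positivity, ?_⟩
    have : n * Lam * (4 * (γ / (4 * (n * Lam + 1)))) = γ * ((n * Lam) / (n * Lam + 1)) := by
      field_simp
    rw [this]
    have : (n * Lam) / (n * Lam + 1) < 1 := by rw [div_lt_one (by positivity)]; linarith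
    nlinarith
  set Z : Mat n := Y - (4 * δ) • (1 : Mat n) with hZ
  have hZs : Z.IsSymm := hY.sub (Matrix.isSymm_one.smul _)
  have hFZ : F Z ≤ F Y + n * Lam * (4 * δ) := by
    have := hF.add_smul_one hZs (show 0 ≤ 4 * δ by linarith)
    rw [hZ, sub_add_cancel] at this
    linarith
  have hqZ : ∀ h, qf Z h = qf Y h - 4 * δ * ‖h‖ ^ 2 := fun h => by
    rw [hZ, qf_sub, qf_smul, qf_one]
  set Q : ℝ × En n → ℝ := fun s => quadP (ul y + s.1) y P Z s.2 with hQ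
  have hQc : Continuous Q := by
    have := continuous_quad Z P
    simp only [hQ, quadP]
    exact (continuous_const.add continuous_fst).add (this.comp (continuous_snd.sub continuous_const))
  have hmv : Continuous fun s : ℝ × En n => inner ℝ (P + mv Z (s.2 - y)) s.2 := by
    have h1 : Continuous fun x : En n => mv Z x := (mv Z).continuous
    have h2 : Continuous fun s : ℝ × En n => P + mv Z (s.2 - y) :=
      continuous_const.add (h1.comp (continuous_snd.sub continuous_const))
    exact h2.inner continuous_snd
  have hQ0 : Q (0, y) = ul y := by simp [hQ, quadP, qf_vec_zero]
  have e1 : ∀ᶠ s in 𝓝 ((0 : ℝ), y), Q s < V s.2 :=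
    hQc.continuousAt.eventually_lt (hV.comp continuous_snd).continuousAt (by simpa [hQ0] using hyV)
  have e2 : ∀ᶠ s in 𝓝 ((0 : ℝ), y),
      F Z - (1 / 2) * inner ℝ (P + mv Z (s.2 - y)) s.2 - α * Q s < f s.2 := by
    refine ContinuousAt.eventually_lt ?_ (hf.comp continuous_snd).continuousAt ?_
    · exact ((continuous_const.sub (continuous_const.mul hmv)).sub
        (continuous_const.mul hQc)).continuousAt
    · have h0 : mv Z (0 : En n) = 0 := map_zero _
      simp only [hQ0, sub_self, h0, add_zero]
      linarith
  obtain ⟨ρ, hρ, he⟩ := Metric.eventually_nhds_iff.1 (e1.and e2)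
  obtain ⟨ρ', hρ', hJ'⟩ := Metric.eventually_nhds_iff.1 (hJ δ hδ)
  obtain ⟨r, hr, hrρ, hrρ', hr1⟩ : ∃ r > 0, r < ρ ∧ r < ρ' ∧ δ * r ^ 2 / 2 < ρ := by
    have h1 : Tendsto (fun r : ℝ => δ * r ^ 2 / 2) (𝓝[>] 0) (𝓝 0) := by
      have : Continuous fun r : ℝ => δ * r ^ 2 / 2 := by fun_prop
      have := this.tendsto 0
      simp only [ne_eq, OfNat.ofNat_ne_zero, not_false_eq_true, zero_pow, mul_zero, zero_div] at this
      exact this.mono_left nhdsWithin_le_nhds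
    have h2 := (h1.eventually_lt_const hρ).and
      ((Ioo_mem_nhdsGT (lt_min hρ hρ')))
    obtain ⟨r, hr1, hr2⟩ := h2.exists
    exact ⟨r, hr2.1, hr2.2.trans_le (min_le_left _ _), hr2.2.trans_le (min_le_right _ _), hr1⟩
  set η := δ * r ^ 2 / 2 with hη
  have hη0 : 0 < η := by positivity
  set q : En n → ℝ := quadP (ul y + η) y P Z with hq
  have hqc : Continuous q := continuous_quadP _ _ _ _
  have hball : ∀ z, ‖z - y‖ < r → q z < V z ∧
      F Z - (1 / 2) * inner ℝ (P + mv Z (z - y)) z - α * q z < f z := by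
    intro z hz
    have := he (y := (η, z)) (by
      rw [Prod.dist_eq, max_lt_iff]
      refine ⟨?_, by rw [dist_eq_norm]; exact hz.trans hrρ⟩
      simpa [abs_of_pos hη0] using hr1)
    exact this
  have hann : ∀ z, ‖z - y‖ < r → r ^ 2 / 2 ≤ ‖z - y‖ ^ 2 → q z ≤ u z := by
    intro z hz hz2
    have h1 := hJ' (y := z - y) (by rw [dist_zero_right]; exact hz.trans hrρ')
    simp only [add_sub_cancel, Pi.neg_apply, inner_neg_left, qf_neg] at h1
    have h2 : q z = ul y + η + (inner ℝ P (z - y) + 1 / 2 * (qf Y (z - y) - 4 * δ * ‖z - y‖ ^ 2)) := by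
      rw [hq, quadP, hqZ]
    have h3 : η ≤ δ * ‖z - y‖ ^ 2 := by rw [hη]; nlinarith
    linarith [hul z]
  classical
  set w : En n → ℝ := fun z => if ‖z - y‖ < r then max (u z) (q z) else u z with hw
  have hwu : ∀ z, u z ≤ w z := fun z => by
    simp only [hw]; split_ifs
    exacts [le_max_left _ _, le_rfl]
  have hwq : ∀ z, ‖z - y‖ < r → q z ≤ w z := fun z hz => by
    simp only [hw, if_pos hz]; exact le_max_right _ _
  have hopen : ∀ z, ‖z - y‖ < r → ∀ᶠ x in 𝓝 z, ‖x - y‖ < r := fun z hz =>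
    (by fun_prop : Continuous fun x : En n => ‖x - y‖).continuousAt.eventually_lt_const hz
  refine ⟨w, ?_, ?_, ?_, η / 2, by positivity, ?_⟩
  · intro z c hc
    have huc : u z < c := (hwu z).trans_lt hc
    by_cases hz : ‖z - y‖ < r
    · have hqz : q z < c := (hwq z hz).trans_lt hc
      filter_upwards [hu z c huc, hqc.continuousAt.eventually_lt_const hqz] with x h1 h2
      simp only [hw]; split_ifs
      exacts [max_lt h1 h2, h1]
    · have : r ^ 2 / 2 < ‖z - y‖ ^ 2 := by push Not at hz; nlinarith
      have h3 : ∀ᶠ x in 𝓝 z, r ^ 2 / 2 < ‖x - y‖ ^ 2 :=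
        (by fun_prop : Continuous fun x : En n => ‖x - y‖ ^ 2).continuousAt.eventually_const_lt this
      filter_upwards [hu z c huc, h3] with x h1 h2
      simp only [hw]; split_ifs with hx
      · exact max_lt h1 ((hann x hx h2.le).trans_lt h1)
      · exact h1
  · intro z p' X' hX' hJw
    by_cases hwz : w z = u z
    · rw [hwz]
      exact hsu z p' X' hX' (hJw.of_le (Eventually.of_forall hwu) hwz.symm)
    · have hz : ‖z - y‖ < r := by
        by_contra hz
        exact hwz (by simp only [hw, if_neg hz])
      have hwz' : w z = q z := by
        simp only [hw, if_pos hz] at hwz ⊢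
        exact max_eq_right (by by_contra h; exact hwz (max_eq_left (not_le.1 h).le))
      rw [hwz']
      exact Sub.of_sj_le hl hF hZs hX'
        (hJw.of_le ((hopen z hz).mono fun x hx => hwq x hx) hwz'.symm)
        (sj_neg_quadP hZs _ y P z) (hball z hz).2.le
  · intro z
    simp only [hw]; split_ifs with hz
    exacts [max_le (huV z) (hball z hz).1.le, huV z]
  · have hqy : q y = ul y + η := by simp [hq, quadP, qf_vec_zero]
    filter_upwards [hopen y (by simpa using hr), hqc.continuousAt.eventually_const_lt
      (show ul y + η / 2 < q y by rw [hqy]; linarith)] with z h1 h2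
    exact h2.le.trans (hwq z h1)

/-- Perron's method. -/
theorem perron (hl : 0 < lam) (hL : lam ≤ Lam) {F : Mat n → ℝ} (hF : Ell lam Lam F)
    (hFh : PositivelyHomogeneous n F) {b α C : ℝ} (hb : 0 < b) (hbL : b ≤ 1 / (8 * Lam))
    {f V : En n → ℝ} (hf : Continuous f) (hfp : ∀ y, 0 < f y) (hV : Continuous V)
    (hV0 : ∀ y, 0 ≤ V y) (hVC : ∀ y, V y ≤ C * gs b y) (hVs : Sup F α f V) :
    ∃ u, Continuous u ∧ (∀ y, 0 < u y) ∧ (∀ y, u y ≤ V y) ∧ Sub F α f u ∧ Sup F α f u := by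
  set Per : Set (En n → ℝ) := {w | UpperSemicontinuous w ∧ Sub F α f w ∧ ∀ y, w y ≤ V y} with hPer
  have hzero : (fun _ => 0) ∈ Per := by
    refine ⟨continuous_const.upperSemicontinuous, fun y p X hX hJ => ?_, hV0⟩
    refine Sub.of_sj_le hl.le hF (q := fun _ => (0 : ℝ)) (p := 0) (X := 0) Matrix.isSymm_zero hX hJ
      (by simpa using sj_const (0 : ℝ) y) ?_
    rw [PositivelyHomogeneous.map_zero hFh, inner_zero_left]
    linarith [hfp y]
  set u₀ : En n → ℝ := fun y => sSup ((fun w : En n → ℝ => w y) '' Per) with hu₀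
  have hbdd : ∀ y, BddAbove ((fun w : En n → ℝ => w y) '' Per) := by
    rintro y
    refine ⟨V y, ?_⟩
    rintro _ ⟨w, hw, rfl⟩
    exact hw.2.2 y
  have hne : ∀ y, ((fun w : En n → ℝ => w y) '' Per).Nonempty := fun y => ⟨_, ⟨_, hzero, rfl⟩⟩
  have hle : ∀ w ∈ Per, ∀ y, w y ≤ u₀ y := fun w hw y => le_csSup (hbdd y) ⟨w, hw, rfl⟩
  have hu0 : ∀ y, 0 ≤ u₀ y := fun y => hle _ hzero y
  have hu₀V : ∀ y, u₀ y ≤ V y := fun y => by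
    refine csSup_le (hne y) ?_
    rintro _ ⟨w, hw, rfl⟩
    exact hw.2.2 y
  have hstarS : Sub F α f (uscEnv u₀) := by
    intro y p X hX hJ
    refine sub_stable hF hf.continuousAt hX hJ fun ε hε => ?_
    obtain ⟨z, hz, hzu⟩ := exists_near_uscEnv hu0 y hε
    obtain ⟨_, ⟨w, hw, rfl⟩, hwz⟩ := exists_lt_of_lt_csSup (hne z) hzu
    exact ⟨w, α, f, hw.1, hw.2.1, by simpa using hε, fun z _ => by linarith,
      fun z _ => by linarith [hle w hw z, le_uscEnv hV hu₀V z], z, hz, hwz⟩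
  have hstar : uscEnv u₀ ∈ Per := ⟨uscEnv_usc hu0 hV hu₀V, hstarS, uscEnv_le_cont hu0 hV hu₀V⟩
  have hueq : uscEnv u₀ = u₀ :=
    funext fun y => le_antisymm (hle _ hstar y) (le_uscEnv hV hu₀V y)
  rw [hueq] at hstar
  have hu0' : ∀ y, (-u₀) y ≤ 0 := fun y => by simpa using hu0 y
  have hVb : ∀ y, V y ≤ |C| := fun y => (le_abs_self _).trans (abs_le_of_gs hb.le hV0 hVC y)
  have hum : ∀ y, -|C| ≤ (-u₀) y := fun y => by
    have := (hu₀V y).trans (hVb y)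
    simp only [Pi.neg_apply]; linarith
  set ul : En n → ℝ := fun y => -uscEnv (-u₀) y with hul
  have hulu : ∀ y, ul y ≤ u₀ y := fun y => by
    have := le_uscEnv continuous_const hu0' y
    simp only [hul, Pi.neg_apply] at this ⊢; linarith
  have hul0 : ∀ y, 0 ≤ ul y := fun y => by
    have := uscEnv_le_cont hum continuous_const hu0' y
    simp only [hul]; linarith
  have hulsc : LowerSemicontinuous ul := by
    have h := uscEnv_usc hum continuous_const hu0'
    intro y c hc
    have hc' : uscEnv (-u₀) y < -c := by
      have : c < -uscEnv (-u₀) y := hc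
      linarith
    filter_upwards [h y (-c) hc'] with z hz
    have : uscEnv (-u₀) z < -c := hz
    show c < -uscEnv (-u₀) z
    linarith
  have hulS : Sup F α f ul := by
    intro y p X hX hJ
    by_contra hbad
    rw [not_le] at hbad
    simp only [dualF, Pi.neg_apply] at hbad
    rcases ((hulu y).trans (hu₀V y)).eq_or_lt with he | hlt
    · have := hVs y p X hX (hJ.of_le (Eventually.of_forall fun z => by
        have := (hulu z).trans (hu₀V z)
        simp only [Pi.neg_apply]; linarith) (by simp [he]))
      simp only [dualF, Pi.neg_apply, he] at this hbad
      linarith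
    · obtain ⟨w, hw1, hw2, hw3, η, hη, hev⟩ := exists_bump hl.le hF (hl.le.trans hL) hf hV
        hstar.1 hstar.2.1 hu₀V hulu (y := y) (P := -p) (Y := -X) hX.neg
        (by simpa only [neg_neg] using hJ) hlt (by rw [inner_neg_left]; linarith)
      have : uscEnv (-u₀) y ≤ -(ul y + η) := uscEnv_le hum (hev.mono fun z hz => by
        have := hle w ⟨hw1, hw2, hw3⟩ z
        simp only [Pi.neg_apply]; linarith)
      simp only [hul] at this
      linarith
  have hulp : ∀ y, 0 < ul y := by
    intro y
    refine (hul0 y).lt_of_ne fun h0 => ?_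
    have := hulS y 0 0 Matrix.isSymm_zero
      (sj_of_max (Eventually.of_forall fun z => by
        have := hul0 z
        simp only [Pi.neg_apply, ← h0]; linarith))
    simp only [dualF, neg_zero, PositivelyHomogeneous.map_zero hFh, Pi.neg_apply, ← h0,
      inner_zero_left] at this
    linarith [hfp y]
  have hcmp := comparison hl hL hF hFh hb hbL hf hfp hstar.1 hu0
    (fun y => (hu₀V y).trans (hVC y)) hulsc hulp
    (fun y => ((hulu y).trans (hu₀V y)).trans (hVC y)) hstar.2.1 hulS
  have heq : ul = u₀ := funext fun y => le_antisymm (hulu y) (hcmp y)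
  rw [heq] at hulsc hulp hulS
  exact ⟨u₀, continuous_iff_lower_upperSemicontinuous.2 ⟨hulsc, hstar.1⟩, hulp, hu₀V,
    hstar.2.1, hulS⟩

theorem qf_one_sub_rk_nonneg {e : En n} (he : ‖e‖ = 1) (x : En n) :
    0 ≤ qf (1 - rk e) x := by
  rw [qf_sub, qf_one, qf_rk]
  have := abs_real_inner_le_norm e x
  rw [he, one_mul] at this
  have := sq_le_sq' (abs_le.1 this).1 (abs_le.1 this).2
  linarith

theorem qf_le_trace {R : Mat n} (hR : R.IsSymm) (h : ∀ x, 0 ≤ qf R x) {e : En n} (he : ‖e‖ = 1) :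
    qf R e ≤ R.trace := by
  have hpsd := posSemidef_of_qf hR h
  have hmem : R ∈ PucciMatrices n 0 (∑ i, hpsd.1.eigenvalues i) :=
    ⟨hpsd.1, fun i => ⟨hpsd.eigenvalues_nonneg i,
      Finset.single_le_sum (f := hpsd.1.eigenvalues) (fun j _ => hpsd.eigenvalues_nonneg j)
        (Finset.mem_univ i)⟩⟩
  have h1 := (trace_bounds hmem (Matrix.isSymm_one.sub (rk_symm e)) (qf_one_sub_rk_nonneg he)).1
  have h2 : (R * rk e).trace = qf R e := by
    rw [rk, Matrix.mul_vecMulVec, Matrix.trace_vecMulVec, qf_eq_dotProduct, dotProduct_comm]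
  rw [Matrix.mul_sub, Matrix.mul_one, Matrix.trace_sub R, h2] at h1
  linarith

/-- Lower Pucci bound for a matrix that is almost nonpositive and very negative along `e`. -/
theorem pucciLB_of_direction (hl : 0 ≤ lam) {N : Mat n} (hN : N.IsSymm) {κ δ : ℝ} (hδ : 0 ≤ δ)
    (h : ∀ x, qf N x ≤ δ * ‖x‖ ^ 2) {e : En n} (he : ‖e‖ = 1) (hNe : qf N e ≤ δ - κ) :
    PucciLB lam Lam N (lam * κ - n * Lam * δ) := by
  intro A hA
  have hRs : (δ • (1 : Mat n) - N).IsSymm := (Matrix.isSymm_one.smul δ).sub hN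
  have hR : ∀ x, 0 ≤ qf (δ • (1 : Mat n) - N) x := fun x => by
    rw [qf_sub, qf_smul, qf_one]; linarith [h x]
  have h1 := (trace_bounds hA hRs hR).1
  have h2 := qf_le_trace hRs hR he
  rw [qf_sub, qf_smul, qf_one, he] at h2
  have h3 := pucciLB_one A hA
  rw [Matrix.mul_one] at h3
  rw [Matrix.mul_sub, Matrix.mul_smul, Matrix.mul_one, Matrix.trace_sub (δ • A),
    Matrix.trace_smul δ A, smul_eq_mul] at h1
  have h4 := mul_le_mul_of_nonneg_left
    (show κ ≤ (δ • (1 : Mat n) - N).trace by linarith) hl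
  have h5 := mul_le_mul_of_nonneg_left (show A.trace ≤ n * Lam by linarith) hδ
  linarith

/-- Second order upper bound for the norm away from the origin. -/
theorem norm_add_le_quad {z w e : En n} {r : ℝ} (hr : 0 < r) (he : ‖e‖ = 1) (hz : z = r • e)
    (hw : ‖w‖ ≤ r / 2) :
    ‖z + w‖ ≤ r + inner ℝ e w + (‖w‖ ^ 2 - inner ℝ e w ^ 2) / r := by
  set s := inner ℝ e w with hs
  have hsw : |s| ≤ ‖w‖ := by simpa [he] using abs_real_inner_le_norm e w
  have h1 : r / 2 ≤ r + s := by linarith [(abs_le.1 hsw).1]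
  have h2 : ‖z + w‖ ^ 2 = (r + s) ^ 2 + (‖w‖ ^ 2 - s ^ 2) := by
    rw [norm_add_sq_real, hz, norm_smul, inner_smul_left, conj_trivial, he, ← hs]
    simp [abs_of_pos hr]; ring
  have h3 : 0 ≤ ‖w‖ ^ 2 - s ^ 2 := by
    have := sq_le_sq' (abs_le.1 hsw).1 (abs_le.1 hsw).2
    linarith
  have hpos : 0 ≤ (‖w‖ ^ 2 - s ^ 2) / r := div_nonneg h3 hr.le
  refine abs_le_of_sq_le_sq' ?_ (by linarith) |>.2
  rw [h2]
  set q := ‖w‖ ^ 2 - s ^ 2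
  have h4 : r + s + q / r = r + s + q / r := rfl
  have h5 : q ≤ 2 * (r + s) * (q / r) := by
    rw [← mul_div_assoc, le_div_iff₀ hr]
    nlinarith
  nlinarith [sq_nonneg (q / r)]

/-- Doubling variables: for the modulus `K r - L r² / 2` there is no positive maximum. -/
theorem doubling_contra (hl : 0 < lam) {F : Mat n → ℝ} (hF : Ell lam Lam F)
    {α A M K L r₀ : ℝ} (hα : 0 ≤ α) (hαA : α ≤ A) {f u : En n → ℝ} (hf : Continuous f)
    (hu : Continuous u) (huM : ∀ y, |u y| ≤ M) (hf1 : ∀ y, |f y| ≤ 1) (hu0 : ∀ y, 0 ≤ u y)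
    (hu1 : ∀ y, u y ≤ 1) (h₁ : Sub F α f u) (h₂ : Sup F α f u) (hK : 0 ≤ K) (hL : 0 ≤ L)
    (hKL : A + 2 + K * r₀ / 2 < 4 * (lam * L)) {x y : En n} (hxy : 0 < ‖x - y‖)
    (hxy' : ‖x - y‖ < r₀)
    (hmax : ∀ x' y', ‖x' - y'‖ ≤ r₀ → u x' - u y' - (K * ‖x' - y'‖ - L * ‖x' - y'‖ ^ 2 / 2) ≤
      u x - u y - (K * ‖x - y‖ - L * ‖x - y‖ ^ 2 / 2)) : False := by
  set r := ‖x - y‖ with hr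
  set e : En n := r⁻¹ • (x - y) with he
  have he1 : ‖e‖ = 1 := by
    rw [he, norm_smul, norm_inv, norm_norm, ← hr]; exact inv_mul_cancel₀ hxy.ne'
  have hz : x - y = r • e := by rw [he, smul_smul, mul_inv_cancel₀ hxy.ne', one_smul]
  set T : Mat n := (2 * K / r) • (1 - rk e) - L • 1 with hT
  have hTs : T.IsSymm := ((Matrix.isSymm_one.sub (rk_symm e)).smul _).sub (Matrix.isSymm_one.smul _)
  have hqT : ∀ w, qf T w = 2 * K / r * (‖w‖ ^ 2 - inner ℝ e w ^ 2) - L * ‖w‖ ^ 2 := fun w => by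
    rw [hT, qf_sub, qf_smul, qf_smul, qf_sub, qf_one, qf_rk]
  set ρ := min (r / 4) ((r₀ - r) / 2) with hρ
  have hρ0 : 0 < ρ := lt_min (by linarith) (by linarith)
  have key := TS_ineq hF hu.upperSemicontinuous (u₂ := -u) hu.neg.upperSemicontinuous huM
    (fun z => by simpa using huM z) hf hf.neg h₁ h₂ (xh := x) (yh := y) (a := 0)
    (b := (K - L * r) • e) (S := 0) (T := T) Matrix.isSymm_zero hTs hρ0 (c := 4 * (lam * L))
    (K := n * Lam * 2) ?_ ?_
  · rw [zero_add] at key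
    have h3 : inner ℝ ((K - L * r) • e) x - inner ℝ ((K - L * r) • e) y = (K - L * r) * r := by
      rw [← inner_sub_right, hz, inner_smul_left, inner_smul_right, real_inner_self_eq_norm_sq,
        he1]
      simp
    simp only [Pi.neg_apply] at key
    have h4 := abs_le.1 (hf1 x)
    have h5 := abs_le.1 (hf1 y)
    have h6 : α * u x ≤ A := by nlinarith [hu0 x, hu1 x]
    have h7 : 0 ≤ α * u y := mul_nonneg hα (hu0 y)
    have h8 : (K - L * r) * r ≤ K * r₀ := by
      have := mul_le_mul_of_nonneg_left hxy'.le hK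
      have : 0 ≤ L * r ^ 2 := by positivity
      linarith
    linarith
  · intro h k hh hk
    have hw : ‖h - k‖ ≤ 2 * ρ := (norm_sub_le _ _).trans (by linarith)
    have h1 : (x + h) - (y + k) = (x - y) + (h - k) := by abel
    have h2 : ‖(x + h) - (y + k)‖ ≤ r₀ := by
      rw [h1]
      refine (norm_add_le _ _).trans ?_
      have := min_le_right (r / 4) ((r₀ - r) / 2)
      linarith
    have h3 := hmax _ _ h2
    rw [h1] at h3
    have h4 := norm_add_le_quad hxy he1 hz (hw.trans (by
      have := min_le_left (r / 4) ((r₀ - r) / 2); linarith))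
    have h5 : ‖x - y + (h - k)‖ ^ 2 = r ^ 2 + 2 * (r * inner ℝ e (h - k)) + ‖h - k‖ ^ 2 := by
      rw [norm_add_sq_real, hz, inner_smul_left, conj_trivial, ← hz]
    rw [h5] at h3
    have h6 := mul_le_mul_of_nonneg_left h4 hK
    simp only [dblTest, Pi.neg_apply, inner_zero_left, qf_zero, hqT, inner_smul_left, conj_trivial]
    have h7 : 1 / 2 * (2 * K / r * (‖h - k‖ ^ 2 - inner ℝ e (h - k) ^ 2) - L * ‖h - k‖ ^ 2)
        = K * ((‖h - k‖ ^ 2 - inner ℝ e (h - k) ^ 2) / r) - L * ‖h - k‖ ^ 2 / 2 := by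
      field_simp
    rw [h7]
    linarith
  · intro δ hδ X₁ X₂ hX₁ hX₂ hX
    have h1 := pucciLB_of_direction (Lam := Lam) hl.le (hX₁.add hX₂) (κ := 4 * L) (δ := 2 * δ)
      (by linarith) (fun ξ => by
        have := hX ξ ξ
        rw [sub_self, qf_vec_zero, qf_zero] at this
        rw [qf_add]; linarith) he1 (by
        have := hX e (-e)
        rw [sub_neg_eq_add, ← two_smul ℝ e, qf_vec_neg, qf_zero, hqT, norm_smul, norm_neg,
          inner_smul_right, real_inner_self_eq_norm_sq, he1] at this
        rw [qf_add]
        norm_num at this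
        linarith)
    exact h1.mono (by linarith)

/-- The Lipschitz constant. -/
def lipK (lam A : ℝ) : ℝ := 4 / 3 * (1 + (A + 3) / 2) / min 1 lam

/-- Interior Lipschitz regularity. -/
theorem lipschitz_est (hl : 0 < lam) {F : Mat n → ℝ} (hF : Ell lam Lam F)
    {α A : ℝ} (hα : 0 ≤ α) (hαA : α ≤ A) {f u : En n → ℝ} (hf : Continuous f)
    (hu : Continuous u) (hf1 : ∀ y, |f y| ≤ 1) (hu0 : ∀ y, 0 ≤ u y)
    (hu1 : ∀ y, u y ≤ 1) (hui : Tendsto u (cocompact _) (𝓝 0))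
    (h₁ : Sub F α f u) (h₂ : Sup F α f u) (x y : En n) :
    u x - u y ≤ lipK lam A * ‖x - y‖ := by
  set r₀ := min 1 lam with hr₀
  have hr0 : 0 < r₀ := lt_min one_pos hl
  have hr1 : r₀ ≤ 1 := min_le_left _ _
  have hrl : r₀ ≤ lam := min_le_right _ _
  set B := A + 3 with hB
  have hB0 : 0 < B := by linarith
  set K := lipK lam A with hK
  have hKr : K * r₀ = 4 / 3 * (1 + B / 2) := by
    rw [hK, lipK, ← hr₀, ← hB]; field_simp
  have hK0 : 0 < K := by
    rw [hK, lipK, ← hr₀, ← hB]; positivity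
  set L := (K * r₀ / 2 + B) / (4 * lam) with hL
  have hL0 : 0 < L := by positivity
  have hlL : 4 * (lam * L) = K * r₀ / 2 + B := by rw [hL]; field_simp
  have hLr : L * r₀ ^ 2 ≤ (K * r₀ / 2 + B) / 4 * 1 := by
    rw [← hlL]
    have : r₀ ^ 2 ≤ lam := by nlinarith
    nlinarith
  have hg1 : 1 ≤ K * r₀ - L * r₀ ^ 2 / 2 := by linarith
  have hg0 : ∀ r, 0 ≤ r → r ≤ r₀ → 0 ≤ K * r - L * r ^ 2 / 2 := by
    intro r h0 h1
    have h2 : 0 ≤ r₀ * (K - L * r₀ / 2) := by linarith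
    have h3 : 0 ≤ K - L * r₀ / 2 := by
      by_contra hcon
      push Not at hcon
      nlinarith
    have h4 : 0 ≤ K - L * r / 2 := by nlinarith
    nlinarith [mul_nonneg h0 h4]
  by_contra hcon
  push Not at hcon
  have hxy : ‖x - y‖ < r₀ := by
    by_contra h
    push Not at h
    have := mul_le_mul_of_nonneg_left h hK0.le
    linarith [hu0 y, hu1 x]
  set Ψ : En n × En n → ℝ := fun s =>
    u s.1 - u s.2 - (K * ‖s.1 - s.2‖ - L * ‖s.1 - s.2‖ ^ 2 / 2) with hΨ
  have hΨc : Continuous Ψ := by simp only [hΨ]; fun_prop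
  have hΨ0 : 0 < Ψ (x, y) := by
    have : 0 ≤ L * ‖x - y‖ ^ 2 / 2 := by positivity
    simp only [hΨ]; linarith
  obtain ⟨Kc, hKc, hKs⟩ := mem_cocompact.1 (hui.eventually_lt_const hΨ0)
  set D : Set (En n × En n) := {s | ‖s.1 - s.2‖ ≤ r₀} with hD
  have hDc : IsClosed D := isClosed_le (by fun_prop) continuous_const
  set E : Set (En n × En n) := D ∩ (Kc ×ˢ Metric.cthickening r₀ Kc) with hE
  have hEc : IsCompact E := (hKc.prod hKc.cthickening).inter_left hDc
  have hmemE : ∀ s ∈ D, Ψ (x, y) ≤ Ψ s → s ∈ E := by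
    intro s hs hle
    have h1 : s.1 ∈ Kc := by
      by_contra h
      have h2 : u s.1 < Ψ (x, y) := hKs h
      have h3 := hg0 ‖s.1 - s.2‖ (norm_nonneg _) hs
      have h4 : Ψ s ≤ u s.1 := by simp only [hΨ]; linarith [hu0 s.2]
      linarith
    refine ⟨hs, h1, Metric.mem_cthickening_of_dist_le s.2 s.1 _ _ h1 ?_⟩
    rw [dist_comm, dist_eq_norm]; exact hs
  have hxyE : (x, y) ∈ E := hmemE _ hxy.le le_rfl
  obtain ⟨s, hs, hmax⟩ := hEc.exists_isMaxOn ⟨_, hxyE⟩ hΨc.continuousOn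
  have hΨs : Ψ (x, y) ≤ Ψ s := hmax hxyE
  have hmaxD : ∀ t ∈ D, Ψ t ≤ Ψ s := by
    intro t ht
    by_contra h
    push Not at h
    have : Ψ t ≤ Ψ s := hmax (hmemE t ht (by linarith))
    linarith
  have hs0 : 0 < ‖s.1 - s.2‖ := by
    refine norm_pos_iff.2 fun h => ?_
    have : s.1 = s.2 := sub_eq_zero.1 h
    have : Ψ s = 0 := by simp [hΨ, this]
    linarith
  have hsr : ‖s.1 - s.2‖ < r₀ := by
    refine lt_of_le_of_ne hs.1 fun h => ?_
    have : Ψ s ≤ 0 := by simp only [hΨ, h]; linarith [hu0 s.2, hu1 s.1]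
    linarith
  exact doubling_contra hl hF (M := 1) (K := K) (L := L) hα hαA hf hu
    (fun y => abs_le.2 ⟨by linarith [hu0 y], hu1 y⟩) hf1 hu0 hu1 h₁ h₂ hK0.le hL0.le
    (by linarith) hs0 hsr (fun x' y' h => hmaxD (x', y') h)

/-- A positive supersolution cannot have a large exponent. -/
theorem sup_exponent_le (hl : 0 < lam) (hL : lam ≤ Lam) {F : Mat n → ℝ} (hF : Ell lam Lam F)
    (hFh : PositivelyHomogeneous n F) {α : ℝ} (hα : 0 < α) {f u : En n → ℝ} (hu : Continuous u)
    (hup : ∀ y, 0 < u y) (hf : ∀ y, 0 ≤ f y) (hs : Sup F α f u) : α ≤ 4 * (n * Lam) / lam := by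
  have hLp : 0 < Lam := hl.trans_le hL
  set k := 1 / lam with hk
  have hk0 : 0 < k := by positivity
  set R := Real.sqrt (n * Lam + lam) with hR
  have hR2 : R ^ 2 = n * Lam + lam := Real.sq_sqrt (by positivity)
  have hR0 : 0 < R := Real.sqrt_pos.2 (by positivity)
  set θ := Real.exp (-k * R ^ 2) with hθ
  have hθ0 : 0 < θ := Real.exp_pos _
  have hquo : Continuous fun y => (gs k y - θ) / u y :=
    ((continuous_gs k).sub continuous_const).div hu fun y => (hup y).ne'
  obtain ⟨z, hz, hmax⟩ := (isCompact_closedBall (0 : En n) R).exists_isMaxOn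
    ⟨0, Metric.mem_closedBall_self hR0.le⟩ hquo.continuousOn
  have h0 : θ < gs k (0 : En n) := by
    rw [gs, hθ, Real.exp_lt_exp]
    have : 0 < k * R ^ 2 := by positivity
    simp only [norm_zero]; linarith
  set m := (gs k z - θ) / u z with hm
  have hm0 : 0 < m := by
    have h1 : (gs k 0 - θ) / u 0 ≤ m := hmax (Metric.mem_closedBall_self hR0.le)
    exact (div_pos (by linarith) (hup 0)).trans_le h1
  have hmz : m * u z = gs k z - θ := div_mul_cancel₀ _ (hup z).ne'
  have hgz : 0 < gs k z - θ := by rw [← hmz]; exact mul_pos hm0 (hup z)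
  have hzR : ‖z‖ ^ 2 < R ^ 2 := by
    have h1 : θ < gs k z := by linarith
    rw [gs, hθ, Real.exp_lt_exp] at h1
    by_contra h
    push Not at h
    nlinarith
  have hzR' : ‖z‖ < R := lt_of_pow_lt_pow_left₀ 2 hR0.le hzR
  have hloc : ∀ᶠ x in 𝓝 z, -(m * u x) ≤ -gs k x + θ := by
    have : ∀ᶠ x in 𝓝 z, ‖x‖ < R := continuous_norm.continuousAt.eventually_lt_const hzR'
    filter_upwards [this] with x hx
    have h1 : (gs k x - θ) / u x ≤ m := hmax (mem_closedBall_zero_iff.2 hx.le)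
    rw [div_le_iff₀ (hup x)] at h1
    linarith
  have hJ : SJ (-fun x => m * u x) z (-gsP k z + 0) (-gsX k z + 0) :=
    ((sj_neg_gs k z).add (sj_const θ z)).of_le hloc (by simp only [Pi.neg_apply]; linarith)
  rw [add_zero, add_zero] at hJ
  have h1 := hs.smul hFh hm0 z _ _ (gsX_symm k z).neg hJ
  simp only [dualF, neg_neg, Pi.neg_apply, inner_neg_left] at h1
  rw [hmz] at h1
  have h2 : PucciLB lam Lam (0 - gsX k z)
      (gs k z * (4 * k ^ 2 * (lam * ‖z‖ ^ 2) + 2 * k * (-(n * Lam)))) := by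
    have e : (0 : Mat n) - gsX k z
        = gs k z • ((4 * k ^ 2) • (-rk z) + (2 * k) • (1 : Mat n)) := by
      rw [gsX, zero_sub, ← smul_neg]
      congr 1
      module
    rw [e]
    exact (((pucciLB_neg_rk z).smul (by positivity)).add (pucciLB_one.smul (by positivity))).smul
      (gs_pos _ _).le
  have h3 := hF 0 (gsX k z) Matrix.isSymm_zero (gsX_symm k z) _ h2
  rw [PositivelyHomogeneous.map_zero hFh] at h3
  have h4 : inner ℝ (gsP k z) z = -(2 * k) * gs k z * ‖z‖ ^ 2 := by
    rw [gsP, inner_smul_left, conj_trivial, real_inner_self_eq_norm_sq]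
  rw [h4] at h1
  have h5 : 0 ≤ m * f z := mul_nonneg hm0.le (hf z)
  have hklam : k * lam = 1 := by rw [hk]; field_simp
  have h6 : α * (gs k z - θ) ≤ gs k z * (k * (2 * (n * Lam) - 3 * ‖z‖ ^ 2)) := by
    have : 4 * k ^ 2 * (lam * ‖z‖ ^ 2) = 4 * k * ‖z‖ ^ 2 := by
      linear_combination 4 * k * ‖z‖ ^ 2 * hklam
    rw [this] at h3
    linarith
  have h7 : 0 < α * (gs k z - θ) := mul_pos hα hgz
  have hgp := gs_pos k z
  have h8 : ‖z‖ ^ 2 < n * Lam := by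
    by_contra h
    push Not at h
    have : gs k z * (k * (2 * (n * Lam) - 3 * ‖z‖ ^ 2)) ≤ 0 := by
      refine mul_nonpos_of_nonneg_of_nonpos hgp.le (mul_nonpos_of_nonneg_of_nonpos hk0.le ?_)
      nlinarith [sq_nonneg ‖z‖]
    linarith
  have h9 : 2 * θ ≤ gs k z := by
    have e1 : (2 : ℝ) ≤ Real.exp 1 := by have := Real.add_one_le_exp (1 : ℝ); linarith
    have e2 : Real.exp 1 * θ ≤ gs k z := by
      rw [hθ, gs, ← Real.exp_add, Real.exp_le_exp, hR2]
      nlinarith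
    nlinarith
  have h10 : α * (gs k z / 2) ≤ gs k z * (k * (2 * (n * Lam))) := by
    have e1 := mul_le_mul_of_nonneg_left (show gs k z / 2 ≤ gs k z - θ by linarith) hα.le
    have e2 : gs k z * (k * (2 * (n * Lam) - 3 * ‖z‖ ^ 2)) ≤ gs k z * (k * (2 * (n * Lam))) := by
      gcongr
      nlinarith [sq_nonneg ‖z‖]
    linarith
  have h11 : gs k z * α ≤ gs k z * (4 * (n * Lam) / lam) := by
    have : 4 * (n * Lam) / lam = 4 * (k * (n * Lam)) := by rw [hk]; field_simp
    rw [this]; linarith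
  exact le_of_mul_le_mul_left h11 hgp

/-- A Gaussian bound on a ball propagates to the whole space. -/
theorem gs_bound_of_ball (hl : 0 < lam) (hL : lam ≤ Lam) {F : Mat n → ℝ} (hF : Ell lam Lam F)
    (hFh : PositivelyHomogeneous n F) {b α C R s : ℝ} (hb : 0 < b) (hbL : b ≤ 1 / (8 * Lam))
    (hR : 0 < R) (hRα : α + 1 ≤ b / 2 * R ^ 2 / 2) {u : En n → ℝ} (hu : Continuous u)
    (hu0 : ∀ y, 0 ≤ u y) (huC : ∀ y, u y ≤ C * gs b y) (hs : 1 ≤ s) (hsub : Sub F α (gs b) u)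
    (hin : ∀ y, ‖y‖ ≤ R → u y ≤ s * gs b y) (y : En n) : u y ≤ s * gs b y := by
  have hs0 : 0 < s := by linarith
  have hc : Continuous fun y : En n => s * gs b y := continuous_const.mul (continuous_gs b)
  have hP : PSub lam Lam α
      (fun y => gs b y - s * gs b y * (2 * b * n * lam + b * ‖y‖ ^ 2 / 2 - α))
      (fun y => u y - s * gs b y) := by
    intro x p X hX hJ d hd
    have := sub_sup_ineq hl.le hF hu.upperSemicontinuous hc.lowerSemicontinuous
      (M := |C| + s) (fun x => (abs_le_of_gs hb.le hu0 huC x).trans (by linarith))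
      (fun x => by
        rw [abs_of_pos (mul_pos hs0 (gs_pos _ _))]
        have := mul_le_mul_of_nonneg_left (gs_le_one hb.le x) hs0.le
        linarith [abs_nonneg C])
      (continuous_gs b) (by have := continuous_gs (n := n) b; fun_prop) hsub
      (sup_gs hl hL hF hFh hb.le hbL hs0.le α) hX hJ hd
    linarith
  have hd : Continuous fun y => u y - s * gs b y := hu.sub hc
  have := psub_nonpos hl hL hd.upperSemicontinuous hP (R := R) (C := C) (b' := b)
    (β := b / 2)
    (fun y hy => by
      have hg := gs_pos b y
      have h1 : R ^ 2 ≤ ‖y‖ ^ 2 := by gcongr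
      have h2 : 1 ≤ 2 * b * n * lam + b * ‖y‖ ^ 2 / 2 - α := by
        have : 0 ≤ 2 * b * n * lam := by positivity
        nlinarith
      have h3 : 1 * 1 ≤ s * (2 * b * n * lam + b * ‖y‖ ^ 2 / 2 - α) :=
        mul_le_mul hs h2 zero_le_one hs0.le
      nlinarith)
    (fun y => by have := mul_pos hs0 (gs_pos b y); linarith [huC y])
    (by linarith) (by linarith) (by linarith) hR.le (fun y hy => by linarith [hin y hy])
    (by linarith) y
  linarith

/-- Stability of subsolutions under equi-Lipschitz pointwise limits. -/
theorem sub_limit {F : Mat n → ℝ} (hF : Ell lam Lam F) {l : Filter ℕ} [NeBot l] {K : ℝ}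
    (hK : 0 ≤ K) {w : ℕ → En n → ℝ} {w₀ g : En n → ℝ} {a t : ℕ → ℝ} {a₀ t₀ : ℝ}
    (hg : Continuous g) (hg1 : ∀ y, |g y| ≤ 1) (hw : ∀ k, Continuous (w k))
    (hlip : ∀ k x y, |w k x - w k y| ≤ K * ‖x - y‖) (hlip₀ : ∀ x y, |w₀ x - w₀ y| ≤ K * ‖x - y‖)
    (hlim : ∀ y, Tendsto (fun k => w k y) l (𝓝 (w₀ y))) (ha : Tendsto a l (𝓝 a₀))
    (ht : Tendsto t l (𝓝 t₀)) (hsub : ∀ k, Sub F (a k) (fun y => t k * g y) (w k)) :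
    Sub F a₀ (fun y => t₀ * g y) w₀ := by
  intro y p X hX hJ
  have htg : Continuous fun y => t₀ * g y := continuous_const.mul hg
  refine sub_stable hF htg.continuousAt hX hJ fun ε hε => ?_
  have hr : 0 < ε / (4 * (K + 1)) := by positivity
  obtain ⟨s, -, hsf, hs⟩ := finite_cover_balls_of_compact (isCompact_closedBall y 1) hr
  have e1 : ∀ᶠ k in l, ∀ c ∈ s, |w k c - w₀ c| < ε / 4 :=
    (eventually_all_finite hsf).2 fun c _ => by
      have := (Metric.tendsto_nhds.1 (hlim c)) (ε / 4) (by linarith)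
      simpa [Real.dist_eq] using this
  have e2 : ∀ᶠ k in l, |a k - a₀| < ε := by
    simpa [Real.dist_eq] using (Metric.tendsto_nhds.1 ha) ε hε
  have e3 : ∀ᶠ k in l, |t k - t₀| < ε := by
    simpa [Real.dist_eq] using (Metric.tendsto_nhds.1 ht) ε hε
  obtain ⟨k, h1, h2, h3⟩ := (e1.and (e2.and e3)).exists
  have hclose : ∀ z, ‖z - y‖ ≤ 1 → |w k z - w₀ z| < ε := by
    intro z hz
    have hz' := hs (show z ∈ Metric.closedBall y 1 by rwa [mem_closedBall_iff_norm])
    simp only [mem_iUnion, exists_prop] at hz'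
    obtain ⟨c, hc, hzc⟩ := hz'
    rw [mem_ball_iff_norm] at hzc
    have hKr : K * ‖z - c‖ ≤ ε / 4 := by
      calc K * ‖z - c‖ ≤ (K + 1) * (ε / (4 * (K + 1))) :=
            mul_le_mul (by linarith) hzc.le (norm_nonneg _) (by linarith)
        _ = ε / 4 := by field_simp
    have i1 := abs_le.1 ((hlip k z c).trans hKr)
    have i2 := abs_le.1 ((hlip₀ z c).trans hKr)
    have i3 := abs_lt.1 (h1 c hc)
    rw [abs_lt]
    constructor <;> linarith
  refine ⟨w k, a k, fun y => t k * g y, (hw k).upperSemicontinuous, hsub k, h2, fun z _ => ?_,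
    fun z hz => ?_, y, by simpa using hε, ?_⟩
  · have i1 : (t k - t₀) * g z ≤ ε * 1 :=
      (le_abs_self _).trans (by
        rw [abs_mul]; exact mul_le_mul h3.le (hg1 z) (abs_nonneg _) hε.le)
    linarith
  · have := (abs_lt.1 (hclose z hz)).2
    linarith
  · have := (abs_lt.1 (hclose y (by simp))).1
    linarith

theorem exists_ultralim {X : Type*} [TopologicalSpace X] {s : Set X} (hs : IsCompact s)
    (l : Ultrafilter ℕ) {f : ℕ → X} (hf : ∀ k, f k ∈ s) : ∃ x ∈ s, Tendsto f l (𝓝 x) := by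
  have := hs.ultrafilter_le_nhds (l.map f) (by
    rw [le_principal_iff]
    exact Filter.mem_map.2 (Filter.univ_mem' hf))
  exact this

/-- Exponents admitting a supersolution with Gaussian right hand side. -/
def admissible (F : Mat n → ℝ) (b : ℝ) : Set ℝ :=
  {α | 0 < α ∧ ∃ (V : En n → ℝ) (C : ℝ), Continuous V ∧ (∀ y, 0 ≤ V y) ∧
    (∀ y, V y ≤ C * gs b y) ∧ Sup F α (gs b) V}

theorem exists_admissible (hn : 1 ≤ n) (hl : 0 < lam) (hL : lam ≤ Lam) {F : Mat n → ℝ}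
    (hF : Ell lam Lam F) (hFh : PositivelyHomogeneous n F) {b : ℝ} (hb : 0 < b)
    (hbL : b ≤ 1 / (8 * Lam)) : ∃ α, α ∈ admissible F b := by
  have hn' : (0 : ℝ) < n := by exact_mod_cast hn
  have h0 : 0 < b * n * lam := by positivity
  refine ⟨b * n * lam, h0, fun y => (1 / (b * n * lam)) * gs b y, 1 / (b * n * lam),
    continuous_const.mul (continuous_gs b), fun y => mul_nonneg (by positivity) (gs_pos _ _).le,
    fun y => le_rfl, ?_⟩
  refine (sup_gs hl hL hF hFh hb.le hbL (show 0 ≤ 1 / (b * n * lam) by positivity)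
    (b * n * lam)).mono fun y => ?_
  have h1 : gs b y = 1 / (b * n * lam) * gs b y * (b * n * lam) := by field_simp
  have h2 : 0 ≤ 1 / (b * n * lam) * gs b y := mul_nonneg (by positivity) (gs_pos _ _).le
  have h3 : 0 ≤ b * ‖y‖ ^ 2 := by positivity
  nlinarith [mul_nonneg h2 h3]

/-- Existence of the principal half-eigenfunction. -/
theorem exists_isProfile (hn : 1 ≤ n) (hl : 0 < lam) (hL : lam ≤ Lam) {F : Mat n → ℝ}
    (hF : Ell lam Lam F) (hFh : PositivelyHomogeneous n F) :
    ∃ α > 0, ∃ φ, IsProfile F α φ := by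
  have hLp : 0 < Lam := hl.trans_le hL
  set b := 1 / (8 * Lam) with hbdef
  have hb : 0 < b := by positivity
  have hgc := continuous_gs (n := n) b
  have hgp := gs_pos (n := n) b
  have hper : ∀ α ∈ admissible F b, ∃ (u : En n → ℝ) (C : ℝ), Continuous u ∧ (∀ y, 0 < u y) ∧
      (∀ y, u y ≤ C * gs b y) ∧ Sub F α (gs b) u ∧ Sup F α (gs b) u := by
    rintro α ⟨-, V, C, hV, hV0, hVC, hVs⟩
    obtain ⟨u, h1, h2, h3, h4, h5⟩ := perron hl hL hF hFh hb le_rfl hgc hgp hV hV0 hVC hVs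
    exact ⟨u, C, h1, h2, fun y => (h3 y).trans (hVC y), h4, h5⟩
  have hne : (admissible F b).Nonempty := exists_admissible hn hl hL hF hFh hb le_rfl
  have hbdd : BddAbove (admissible F b) := by
    refine ⟨4 * (n * Lam) / lam, fun α hα => ?_⟩
    obtain ⟨u, C, h1, h2, -, -, h5⟩ := hper α hα
    exact sup_exponent_le hl hL hF hFh hα.1 h1 h2 (fun y => (hgp y).le) h5
  set A := sSup (admissible F b) with hA
  have hApos : 0 < A := by
    obtain ⟨α, hα⟩ := hne
    exact hα.1.trans_le (le_csSup hbdd hα)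
  have hseq : ∀ k : ℕ, ∃ α ∈ admissible F b, A - 1 / ((k : ℝ) + 1) < α := fun k =>
    exists_lt_of_lt_csSup hne (sub_lt_self _ (by positivity))
  choose a ha haA using hseq
  have haA' : ∀ k, a k ≤ A := fun k => le_csSup hbdd (ha k)
  have halim : Tendsto a atTop (𝓝 A) := by
    have h1 : Tendsto (fun k : ℕ => A - 1 / ((k : ℝ) + 1)) atTop (𝓝 A) := by
      simpa using (tendsto_const_nhds (x := A)).sub
        (tendsto_one_div_add_atTop_nhds_zero_nat (𝕜 := ℝ))
    exact tendsto_of_tendsto_of_tendsto_of_le_of_le h1 tendsto_const_nhds (fun k => (haA k).le) haA'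
  choose u C huc hup huC husub husup using fun k => hper (a k) (ha k)
  obtain ⟨R, hR, hRA⟩ := exists_radius (half_pos hb) (A + 1)
  have hmaxex : ∀ k, ∃ z : En n, ‖z‖ ≤ R ∧ ∀ y, ‖y‖ ≤ R → u k y / gs b y ≤ u k z / gs b z := by
    intro k
    obtain ⟨z, hz, hm⟩ := (isCompact_closedBall (0 : En n) R).exists_isMaxOn
      ⟨0, Metric.mem_closedBall_self hR.le⟩
      ((huc k).div hgc fun y => (hgp y).ne').continuousOn
    exact ⟨z, mem_closedBall_zero_iff.1 hz, fun y hy => hm (mem_closedBall_zero_iff.2 hy)⟩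
  choose z hzR hzmax using hmaxex
  set s : ℕ → ℝ := fun k => max 1 (u k (z k) / gs b (z k)) with hs
  have hs1 : ∀ k, 1 ≤ s k := fun k => le_max_left _ _
  have hs0 : ∀ k, 0 < s k := fun k => by linarith [hs1 k]
  have hus : ∀ k y, u k y ≤ s k * gs b y := fun k =>
    gs_bound_of_ball hl hL hF hFh hb le_rfl hR (by linarith [haA' k]) (huc k)
      (fun y => (hup k y).le) (huC k) (hs1 k) (husub k) fun y hy => by
        rw [← div_le_iff₀ (hgp y)]
        exact (hzmax k y hy).trans (le_max_right _ _)
  set t : ℕ → ℝ := fun k => (s k)⁻¹ with ht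
  have ht0 : ∀ k, 0 < t k := fun k => inv_pos.2 (hs0 k)
  have ht1 : ∀ k, t k ≤ 1 := fun k => inv_le_one_of_one_le₀ (hs1 k)
  set φ : ℕ → En n → ℝ := fun k y => t k * u k y with hφ
  have hφc : ∀ k, Continuous (φ k) := fun k => continuous_const.mul (huc k)
  have hφ0 : ∀ k y, 0 ≤ φ k y := fun k y => mul_nonneg (ht0 k).le (hup k y).le
  have hφg : ∀ k y, φ k y ≤ gs b y := fun k y => by
    have := mul_le_mul_of_nonneg_left (hus k y) (ht0 k).le
    rwa [← mul_assoc, inv_mul_cancel₀ (hs0 k).ne', one_mul] at this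
  have hg1 : ∀ y : En n, gs b y ≤ 1 := gs_le_one hb.le
  have hgabs : ∀ y : En n, |gs b y| ≤ 1 := fun y => by rw [abs_of_pos (hgp y)]; exact hg1 y
  have hφsub : ∀ k, Sub F (a k) (fun y => t k * gs b y) (φ k) := fun k =>
    (husub k).smul hFh (ht0 k)
  have hφsup : ∀ k, Sup F (a k) (fun y => t k * gs b y) (φ k) := fun k =>
    (husup k).smul hFh (ht0 k)
  set K := lipK lam A with hK
  have hK0 : 0 ≤ K := by
    have : 0 < min 1 lam := lt_min one_pos hl
    rw [hK, lipK]; positivity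
  have htg : ∀ k, Continuous fun y : En n => t k * gs b y := fun k => continuous_const.mul hgc
  have hlip1 : ∀ k x y, φ k x - φ k y ≤ K * ‖x - y‖ := fun k =>
    lipschitz_est hl hF (ha k).1.le (haA' k) (htg k) (hφc k)
      (fun y => by
        rw [abs_mul, abs_of_pos (ht0 k)]
        exact mul_le_one₀ (ht1 k) (abs_nonneg _) (hgabs y))
      (hφ0 k) (fun y => (hφg k y).trans (hg1 y))
      (squeeze_zero (hφ0 k) (hφg k) (tendsto_gs hb)) (hφsub k) (hφsup k)
  have hlip : ∀ k x y, |φ k x - φ k y| ≤ K * ‖x - y‖ := fun k x y =>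
    abs_sub_le_iff.2 ⟨hlip1 k x y, by rw [norm_sub_rev]; exact hlip1 k y x⟩
  let 𝒰 : Ultrafilter ℕ := hyperfilter ℕ
  have haU : Tendsto a 𝒰 (𝓝 A) := halim.mono_left Nat.hyperfilter_le_atTop
  have hpt : ∀ y, ∃ x ∈ Icc (0 : ℝ) 1, Tendsto (fun k => φ k y) 𝒰 (𝓝 x) := fun y =>
    exists_ultralim isCompact_Icc 𝒰 fun k => ⟨hφ0 k y, (hφg k y).trans (hg1 y)⟩
  choose φ₀ hφ₀I hφ₀ using hpt
  obtain ⟨t₀, ht₀, htU⟩ := exists_ultralim (isCompact_Icc (a := (0 : ℝ)) (b := 1)) 𝒰 (f := t)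
    fun k => ⟨(ht0 k).le, ht1 k⟩
  obtain ⟨z₀, -, hzU⟩ := exists_ultralim (isCompact_closedBall (0 : En n) R) 𝒰 (f := z)
    fun k => mem_closedBall_zero_iff.2 (hzR k)
  have hlip₀ : ∀ x y, |φ₀ x - φ₀ y| ≤ K * ‖x - y‖ := fun x y =>
    le_of_tendsto ((hφ₀ x).sub (hφ₀ y)).abs (Eventually.of_forall fun k => hlip k x y)
  have hφ₀c : Continuous φ₀ := by
    have : LipschitzWith K.toNNReal φ₀ := LipschitzWith.of_dist_le_mul fun x y => by
      rw [Real.dist_eq, dist_eq_norm, Real.coe_toNNReal _ hK0]; exact hlip₀ x y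
    exact this.continuous
  have hφ₀g : ∀ y, φ₀ y ≤ gs b y := fun y =>
    le_of_tendsto (hφ₀ y) (Eventually.of_forall fun k => hφg k y)
  have hsub : Sub F A (fun y => t₀ * gs b y) φ₀ :=
    sub_limit hF hK0 hgc hgabs hφc hlip hlip₀ hφ₀ haU htU hφsub
  have hneg : ∀ c : ℝ, (fun y : En n => c * -gs b y) = -fun y => c * gs b y := fun c => by
    ext y; simp
  have hsup : Sup F A (fun y => t₀ * gs b y) φ₀ := by
    have := sub_limit hF.dual hK0 (w := fun k => -φ k) (w₀ := -φ₀) (g := fun y => -gs b y)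
      hgc.neg (fun y => by rw [abs_neg]; exact hgabs y) (fun k => (hφc k).neg)
      (fun k x y => by
        simp only [Pi.neg_apply]
        rw [← abs_neg, show -(-φ k x - -φ k y) = φ k x - φ k y by ring]; exact hlip k x y)
      (fun x y => by
        simp only [Pi.neg_apply]
        rw [← abs_neg, show -(-φ₀ x - -φ₀ y) = φ₀ x - φ₀ y by ring]; exact hlip₀ x y)
      (fun y => (hφ₀ y).neg) haU htU (fun k => by rw [hneg]; exact hφsup k)
    rw [hneg] at this
    exact this
  rcases ht₀.1.eq_or_lt with h0 | h0
  · have hzero : (fun y : En n => t₀ * gs b y) = 0 := by ext y; simp [← h0]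
    rw [hzero] at hsub hsup
    -- the maximum points survive in the limit
    have hev : ∀ᶠ k in (𝒰 : Filter ℕ), gs b (z k) - K * ‖z k - z₀‖ ≤ φ k z₀ := by
      have : ∀ᶠ k in (𝒰 : Filter ℕ), t k < 1 := htU.eventually_lt_const (by linarith)
      filter_upwards [this] with k hk
      have h1 : s k = u k (z k) / gs b (z k) := by
        rcases max_choice 1 (u k (z k) / gs b (z k)) with h | h
        · exfalso
          have : t k = 1 := by simp only [ht, hs, h, inv_one]
          linarith
        · exact h
      have h2 : φ k (z k) = gs b (z k) := by
        have : u k (z k) = s k * gs b (z k) := by rw [h1]; field_simp [(hgp (z k)).ne']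
        simp only [hφ, ht]
        rw [this, ← mul_assoc, inv_mul_cancel₀ (hs0 k).ne', one_mul]
      have h3 := hlip1 k (z k) z₀
      linarith
    have hz₀ : gs b z₀ ≤ φ₀ z₀ := by
      have h1 : Tendsto (fun k => gs b (z k) - K * ‖z k - z₀‖) 𝒰
          (𝓝 (gs b z₀ - K * ‖z₀ - z₀‖)) :=
        ((hgc.tendsto z₀).comp hzU).sub ((hzU.sub_const z₀).norm.const_mul K)
      have := le_of_tendsto_of_tendsto h1 (hφ₀ z₀) hev
      simpa using this
    have hpos : ∀ y, 0 < φ₀ y := by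
      intro y
      refine (hφ₀I y).1.lt_of_ne fun hy => ?_
      have hP : PSub lam Lam A 0 (-φ₀) := by
        intro x p X hX hJ c hc
        have h1 := hsup x p X hX hJ
        have h2 := hF.dual X 0 hX Matrix.isSymm_zero c (by rwa [sub_zero])
        have h3 : dualF F 0 = 0 := by
          simp [dualF, PositivelyHomogeneous.map_zero hFh]
        rw [h3] at h2
        simp only [Pi.neg_apply, Pi.zero_apply] at h1 ⊢
        linarith
      have := strong_max hl hL hφ₀c.neg hP (fun x => by simpa using (hφ₀I x).1) (z := y)
        (by simp [← hy]) z₀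
      simp only [Pi.neg_apply] at this
      linarith [hgp z₀]
    exact ⟨A, hApos, φ₀, hφ₀c, hpos, hsub, hsup, 1, b, hb, fun y => by
      rw [one_mul]; exact hφ₀g y⟩
  · exfalso
    have hmem : A + t₀ / 2 ∈ admissible F b := by
      refine ⟨by linarith, fun y => 2 / t₀ * φ₀ y, 2 / t₀, continuous_const.mul hφ₀c,
        fun y => mul_nonneg (by positivity) (hφ₀I y).1,
        fun y => mul_le_mul_of_nonneg_left (hφ₀g y) (by positivity), ?_⟩
      refine (hsup.smul hFh (show 0 < 2 / t₀ by positivity)).mono fun y => ?_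
      have h1 : 2 / t₀ * (t₀ * gs b y) = 2 * gs b y := by field_simp
      have h2 : (A + t₀ / 2) * (2 / t₀ * φ₀ y) = A * (2 / t₀ * φ₀ y) + φ₀ y := by field_simp
      rw [h1, h2]
      linarith [hφ₀g y]
    linarith [le_csSup hbdd hmem]

theorem apply_eq_sum (L : En n →L[ℝ] ℝ) (h : En n) :
    L h = ∑ i, h i * L (EuclideanSpace.single i 1) := by
  conv_lhs => rw [← (EuclideanSpace.basisFun (Fin n) ℝ).sum_repr h]
  simp [map_sum]

theorem hess_apply {f : En n → ℝ} (hf : ContDiff ℝ 2 f) (y : En n) (i j : Fin n) :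
    hess n f y i j = fderiv ℝ (fderiv ℝ f) y (EuclideanSpace.single i 1)
      (EuclideanSpace.single j 1) := by
  have hd : DifferentiableAt ℝ (fderiv ℝ f) y :=
    (hf.fderiv_right (m := 1) (by norm_num)).differentiable one_ne_zero y
  have := (hd.hasFDerivAt.clm_apply
    (hasFDerivAt_const (EuclideanSpace.single j (1 : ℝ) : En n) y)).fderiv
  simp only [hess, Matrix.of_apply, this]
  simp

theorem symm_sndFDeriv {f : En n → ℝ} (hf : ContDiff ℝ 2 f) (y : En n) :
    IsSymmSndFDerivAt ℝ f y :=
  hf.contDiffAt.isSymmSndFDerivAt (by simp)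

theorem hess_isSymm {f : En n → ℝ} (hf : ContDiff ℝ 2 f) (y : En n) : (hess n f y).IsSymm := by
  ext i j
  rw [Matrix.transpose_apply, hess_apply hf, hess_apply hf]
  exact symm_sndFDeriv hf y _ _

theorem hess_neg (f : En n → ℝ) (y : En n) : hess n (fun z => -f z) y = -hess n f y := by
  ext i j
  have h : (fun z => fderiv ℝ (fun z => -f z) z (EuclideanSpace.single j 1)) =
      fun z => -(fderiv ℝ f z (EuclideanSpace.single j 1)) := by
    ext z; rw [fderiv_fun_neg]; rfl
  simp only [hess, Matrix.of_apply, Matrix.neg_apply]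
  rw [h, fderiv_fun_neg]
  rfl

theorem qf_hess {f : En n → ℝ} (hf : ContDiff ℝ 2 f) (y h : En n) :
    qf (hess n f y) h = fderiv ℝ (fderiv ℝ f) y h h := by
  set B := fderiv ℝ (fderiv ℝ f) y with hB
  have h1 : ∀ k, B h k = ∑ i, h i * B (EuclideanSpace.single i 1) k := fun k =>
    apply_eq_sum (B.flip k) h
  rw [qf_eq_dotProduct, h1, dotProduct]
  refine Finset.sum_congr rfl fun i _ => ?_
  rw [apply_eq_sum (B _) h, Matrix.mulVec, dotProduct]
  congr 1
  exact Finset.sum_congr rfl fun j _ => by rw [hess_apply hf, mul_comm]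

/-- The gradient as a vector. -/
def grad (f : En n → ℝ) (y : En n) : En n :=
  (InnerProductSpace.toDual ℝ (En n)).symm (fderiv ℝ f y)

theorem inner_grad (f : En n → ℝ) (y h : En n) : inner ℝ (grad f y) h = fderiv ℝ f y h :=
  InnerProductSpace.toDual_symm_apply

theorem grad_neg (f : En n → ℝ) (y : En n) : grad (fun z => -f z) y = -grad f y := by
  simp only [grad, fderiv_fun_neg, map_neg]

/-- Second order Taylor expansion. -/
theorem taylor_two {E : Type*} [NormedAddCommGroup E] [NormedSpace ℝ E] {f : E → ℝ}
    (hf : ContDiff ℝ 2 f) (y : E) {δ : ℝ} (hδ : 0 < δ) :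
    ∀ᶠ h in 𝓝 (0 : E), f (y + h) ≤
      f y + fderiv ℝ f y h + 1 / 2 * fderiv ℝ (fderiv ℝ f) y h h + δ * ‖h‖ ^ 2 := by
  set B := fderiv ℝ (fderiv ℝ f) y with hB
  have hd : HasFDerivAt (fderiv ℝ f) B y :=
    ((hf.fderiv_right (m := 1) (by norm_num)).differentiable one_ne_zero y).hasFDerivAt
  have hlo := (hasFDerivAt_iff_isLittleO_nhds_zero.1 hd).def hδ
  obtain ⟨r, hr, hball⟩ := Metric.eventually_nhds_iff_ball.1 hlo
  filter_upwards [Metric.ball_mem_nhds (0 : E) hr] with h hh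
  have hsym : IsSymmSndFDerivAt ℝ f y := hf.contDiffAt.isSymmSndFDerivAt (by simp)
  set G : E → ℝ := fun k => f (y + k) - fderiv ℝ f y k - 1 / 2 * B k k with hG
  have hGd : ∀ k, HasFDerivAt G (fderiv ℝ f (y + k) - fderiv ℝ f y - B k) k := by
    intro k
    have e1 : HasFDerivAt (fun k => f (y + k)) (fderiv ℝ f (y + k)) k :=
      (hasFDerivAt_comp_add_left y).2 (hf.differentiable two_ne_zero (y + k)).hasFDerivAt
    have e2 : HasFDerivAt (fun k => B k k) (B k + B.flip k) k :=
      (B.hasFDerivAt (x := k)).clm_apply (hasFDerivAt_id k)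
    refine ((e1.sub (fderiv ℝ f y).hasFDerivAt).sub (e2.const_mul (1 / 2))).congr_fderiv ?_
    ext v
    have := hsym k v
    simp only [_root_.sub_apply, _root_.add_apply, _root_.smul_apply,
      ContinuousLinearMap.flip_apply, smul_eq_mul]
    rw [← hB] at this
    linarith
  have hhn : ‖h‖ < r := mem_ball_zero_iff.1 hh
  have hmv := (convex_closedBall (0 : E) ‖h‖).norm_image_sub_le_of_norm_hasFDerivWithin_le
    (f := G) (C := δ * ‖h‖) (fun k _ => (hGd k).hasFDerivWithinAt)
    (fun k hk => by
      have hk' := mem_closedBall_zero_iff.1 hk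
      have := hball k (mem_ball_zero_iff.2 (hk'.trans_lt hhn))
      exact this.trans (by gcongr))
    (Metric.mem_closedBall_self (norm_nonneg _)) (mem_closedBall_zero_iff.2 le_rfl)
  have hm := (le_abs_self _).trans hmv
  simp only [hG, sub_zero, add_zero, map_zero, mul_zero] at hm
  rw [pow_two]
  linarith

theorem sj_of_contDiff {f : En n → ℝ} (hf : ContDiff ℝ 2 f) (y : En n) :
    SJ f y (grad f y) (hess n f y) := by
  intro δ hδ
  filter_upwards [taylor_two hf y hδ] with h hh
  rwa [inner_grad, qf_hess hf]

theorem SJ.comp_smul {u : En n → ℝ} {x y p : En n} {X : Mat n} {r : ℝ} (hr : r ≠ 0)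
    (hxy : r • y = x) (h : SJ u x p X) : SJ (fun z => u (r • z)) y (r • p) (r ^ 2 • X) := by
  intro δ hδ
  have hr2 : 0 < r ^ 2 := by positivity
  have ht : Tendsto (fun k : En n => r • k) (𝓝 0) (𝓝 0) := by
    simpa using (continuous_const_smul r).tendsto (0 : En n)
  filter_upwards [ht.eventually (h (δ / r ^ 2) (by positivity))] with k hk
  rw [smul_add, hxy, qf_smul, inner_smul_left, conj_trivial]
  rw [inner_smul_right, qf_vec_smul, norm_smul, mul_pow, Real.norm_eq_abs, sq_abs,
    ← mul_assoc (δ / r ^ 2), div_mul_cancel₀ _ hr2.ne'] at hk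
  exact hk

section

variable {E : Type*} [NormedAddCommGroup E] [NormedSpace ℝ E] {ψ : E × ℝ → ℝ}

theorem fderiv_slice (hψ : ContDiff ℝ 2 ψ) (x v : E) (t : ℝ) :
    fderiv ℝ (fun z => ψ (z, t)) x v = fderiv ℝ ψ (x, t) (v, 0) := by
  have h : HasFDerivAt ψ (fderiv ℝ ψ (x, t)) (x, t) :=
    (hψ.differentiable two_ne_zero (x, t)).hasFDerivAt
  have h2 : HasFDerivAt (fun z : E => (z, t)) (ContinuousLinearMap.inl ℝ E ℝ) x :=
    hasFDerivAt_prodMk_left x t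
  have h3 : HasFDerivAt (fun z => ψ (z, t))
    ((fderiv ℝ ψ (x, t)).comp (ContinuousLinearMap.inl ℝ E ℝ)) x := h.comp x h2
  rw [h3.fderiv]
  simp

theorem hasDerivAt_curve (hψ : ContDiff ℝ 2 ψ) {γ : ℝ → E} {γ' : E} {t : ℝ}
    (hγ : HasDerivAt γ γ' t) :
    HasDerivAt (fun s => ψ (γ s, s)) (fderiv ℝ ψ (γ t, t) (γ', 0) +
      deriv (fun s => ψ (γ t, s)) t) t := by
  have h : HasFDerivAt ψ (fderiv ℝ ψ (γ t, t)) (γ t, t) :=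
    (hψ.differentiable two_ne_zero _).hasFDerivAt
  have h1 : HasDerivAt (fun s => ψ (γ t, s)) (fderiv ℝ ψ (γ t, t) (0, 1)) t :=
    h.comp_hasDerivAt t ((hasDerivAt_const t (γ t)).prodMk (hasDerivAt_id t))
  have h2 : HasDerivAt (fun s => ψ (γ s, s)) (fderiv ℝ ψ (γ t, t) (γ', 1)) t :=
    HasFDerivAt.comp_hasDerivAt (f := fun s => (γ s, s)) t h (hγ.prodMk (hasDerivAt_id t))
  rw [h1.deriv, ← map_add]
  simpa using h2

end

theorem isOpen_Qset : IsOpen (Qset n) := isOpen_lt continuous_const continuous_snd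

/-- The self-similar function with profile `φ` at time one. -/
def paraExt (α : ℝ) (φ : En n → ℝ) (p : En n × ℝ) : ℝ :=
  p.2 ^ (-α) * φ ((√p.2)⁻¹ • p.1)

theorem viscSubP_paraExt {F : Mat n → ℝ} (hFh : PositivelyHomogeneous n F) {α : ℝ}
    {φ : En n → ℝ} (h : Sub F α 0 φ) :
    ViscSubP n (Qset n) (fun M _ _ _ => F M) (paraExt α φ) := by
  rintro ⟨x, t⟩ ht ψ hψ hmax
  have ht : 0 < t := ht
  have hmax : ∀ᶠ q in 𝓝 (x, t), paraExt α φ q - ψ q ≤ paraExt α φ (x, t) - ψ (x, t) := by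
    have := hmax
    rwa [IsLocalMaxOn, IsMaxFilter, isOpen_Qset.nhdsWithin_eq ht] at this
  set r := √t with hrdef
  have hr : 0 < r := Real.sqrt_pos.2 ht
  have hrt : r ^ 2 = t := Real.sq_sqrt ht.le
  set y := r⁻¹ • x with hy
  have hxy : r • y = x := by rw [hy, smul_smul, mul_inv_cancel₀ hr.ne', one_smul]
  set T := t ^ α with hT
  have hTp : 0 < T := Real.rpow_pos_of_pos ht α
  have hTi : t ^ (-α) = T⁻¹ := Real.rpow_neg ht.le α
  set f : En n → ℝ := fun z => ψ (z, t) with hf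
  have hfc : ContDiff ℝ 2 f := hψ.comp (contDiff_id.prodMk contDiff_const)
  have hJ := (((sj_of_contDiff hfc x).comp_smul hr.ne' hxy).smul hTp.le).add
    (sj_const (φ y - T * f x) y)
  rw [add_zero, add_zero] at hJ
  have hJ' : SJ φ y (T • r • grad f x) (T • r ^ 2 • hess n f x) := by
    refine hJ.of_le ?_ (by rw [hxy]; ring)
    have hc : Tendsto (fun z : En n => (r • z, t)) (𝓝 y) (𝓝 (x, t)) := by
      have : Continuous fun z : En n => (r • z, t) := by fun_prop
      simpa [hxy] using this.tendsto y
    filter_upwards [hc.eventually hmax] with z hz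
    simp only [paraExt, ← hrdef, smul_smul, inv_mul_cancel₀ hr.ne', one_smul, hTi, ← hy] at hz
    have h1 := mul_le_mul_of_nonneg_left hz hTp.le
    rw [mul_sub, mul_sub, mul_inv_cancel_left₀ hTp.ne', mul_inv_cancel_left₀ hTp.ne'] at h1
    simp only [hf]
    linarith
  have h1 := h y _ _ (((hess_isSymm hfc x).smul _).smul _) hJ'
  rw [smul_smul, hFh _ _ (by positivity), inner_smul_left, inner_smul_left, conj_trivial,
    conj_trivial, inner_grad, fderiv_slice hψ, hrt] at h1
  -- the time derivative along the self-similar curve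
  have hγ : HasDerivAt (fun s => √s • y) ((1 / (2 * r)) • y) t :=
    (Real.hasDerivAt_sqrt ht.ne').smul_const y
  have hψd := hasDerivAt_curve hψ hγ
  have hpow : HasDerivAt (fun s : ℝ => s ^ (-α) * φ y) (-α * t ^ (-α - 1) * φ y) t :=
    (Real.hasDerivAt_rpow_const (Or.inl ht.ne')).mul_const _
  have hloc : IsLocalMax (fun s => s ^ (-α) * φ y - ψ (√s • y, s)) t := by
    have hc : Tendsto (fun s : ℝ => (√s • y, s)) (𝓝 t) (𝓝 (x, t)) := by
      have : Continuous fun s : ℝ => (√s • y, s) := by fun_prop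
      simpa [hxy, ← hrdef] using this.tendsto t
    filter_upwards [hc.eventually hmax, lt_mem_nhds ht] with s hs hs0
    simp only [paraExt, smul_smul, inv_mul_cancel₀ (Real.sqrt_pos.2 hs0).ne', one_smul, ← hrdef,
      ← hy, hxy] at hs ⊢
    exact hs
  have h2 := hloc.hasDerivAt_eq_zero (hpow.sub hψd)
  rw [show -α - 1 = -α + -1 by ring, Real.rpow_add ht, hTi, Real.rpow_neg_one, ← hrdef, hxy] at h2
  set L := fderiv ℝ ψ (x, t) with hL
  have e1 : L (((1 / (2 * r)) • y, (0 : ℝ))) = (1 / (2 * r)) * L (y, 0) := by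
    rw [← smul_eq_mul (1 / (2 * r)), ← map_smul, Prod.smul_mk, smul_zero]
  rw [e1] at h2
  change deriv (fun s => ψ (x, s)) t + F (hess n f x) ≤ 0
  set D := L (y, 0)
  set P := deriv (fun s => ψ (x, s)) t
  set Q := F (hess n f x)
  have h3 : -α * φ y = T * (r / 2 * D) + T * t * P := by
    have : T * t * (-α * (T⁻¹ * t⁻¹) * φ y - (1 / (2 * r) * D + P)) = 0 := by rw [h2, mul_zero]
    have h4 : T * t * (-α * (T⁻¹ * t⁻¹) * φ y) = -α * φ y := by field_simp
    have h5 : T * t * (1 / (2 * r) * D) = T * (r / 2 * D) := by rw [← hrt]; field_simp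
    linarith
  have h4 : T * t * (P + Q) ≤ 0 := by
    simp only [Pi.zero_apply] at h1
    linarith
  by_contra hcon
  push Not at hcon
  have : 0 < T * t * (P + Q) := by positivity
  linarith

/-- A positive smooth function equal to the identity near one. -/
theorem exists_pos_contDiff_eq_id :
    ∃ τ : ℝ → ℝ, ContDiff ℝ 2 τ ∧ (∀ t, 0 < τ t) ∧ ∀ᶠ t in 𝓝 1, τ t = t := by
  let b : ContDiffBump (1 : ℝ) := ⟨1 / 4, 1 / 2, by norm_num, by norm_num⟩
  have hbc : ContDiff ℝ 2 b := b.contDiff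
  refine ⟨fun t => 1 + (t - 1) * b t, by fun_prop, fun t => ?_, ?_⟩
  · rcases lt_or_ge (dist t 1) (1 / 2) with h | h
    · rw [Real.dist_eq] at h
      have h1 := abs_lt.1 h
      nlinarith [b.nonneg (x := t), b.le_one (x := t)]
    · have : b t = 0 := b.zero_of_le_dist h
      simp [this]
  · filter_upwards [b.eventuallyEq_one] with t ht
    rw [ht]; simp

theorem contDiff_quadP (c : ℝ) (y p : En n) (X : Mat n) : ContDiff ℝ 2 (quadP c y p X) := by
  unfold quadP qf
  have h1 : ContDiff ℝ 2 fun z : En n => z - y := by fun_prop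
  have h2 : ContDiff ℝ 2 fun z : En n => mv X (z - y) := (mv X).contDiff.comp h1
  exact contDiff_const.add ((contDiff_const.inner ℝ h1).add (contDiff_const.mul (h2.inner ℝ h1)))

theorem sub_of_viscSubP (hl : 0 ≤ lam) {F : Mat n → ℝ} (hF : Ell lam Lam F)
    {α : ℝ} {Φ : En n × ℝ → ℝ} (hΦ : ViscSubP n (Qset n) (fun M _ _ _ => F M) Φ)
    (hself : ∀ p ∈ Qset n, Φ p = paraExt α (fun x => Φ (x, 1)) p) :
    Sub F α 0 fun x => Φ (x, 1) := by
  intro y p X hX hJ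
  set φ : En n → ℝ := fun x => Φ (x, 1) with hφ
  refine le_of_forall_pos_mul (K := n * Lam * 2) fun δ hδ => ?_
  set Y := X + (2 * δ) • (1 : Mat n) with hY
  have hYs : Y.IsSymm := hX.add (Matrix.isSymm_one.smul _)
  set q := quadP (φ y) y p Y with hq
  have hqc : ContDiff ℝ 2 q := contDiff_quadP _ _ _ _
  have hqy : q y = φ y := by simp [hq, quadP, qf_vec_zero]
  have hle : ∀ᶠ z in 𝓝 y, φ z ≤ q z := by
    have ht : Tendsto (fun z : En n => z - y) (𝓝 y) (𝓝 0) := by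
      have : Continuous fun z : En n => z - y := by fun_prop
      simpa using this.tendsto y
    filter_upwards [ht.eventually (hJ δ hδ)] with z hz
    rw [add_sub_cancel] at hz
    simp only [hq, quadP, hY, qf_add, qf_smul, qf_one]
    linarith
  obtain ⟨τ, hτc, hτ0, hτ1⟩ := exists_pos_contDiff_eq_id
  have hτ1' : τ 1 = 1 := hτ1.self_of_nhds
  set ψ : En n × ℝ → ℝ := fun z => τ z.2 ^ (-α) * q ((√(τ z.2))⁻¹ • z.1) with hψ
  have hψc : ContDiff ℝ 2 ψ := by
    have h1 : ContDiff ℝ 2 fun z : En n × ℝ => τ z.2 := hτc.comp contDiff_snd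
    have h2 : ContDiff ℝ 2 fun z : En n × ℝ => (√(τ z.2))⁻¹ :=
      (h1.sqrt fun z => (hτ0 _).ne').inv fun z => (Real.sqrt_pos.2 (hτ0 _)).ne'
    exact (h1.rpow_const_of_ne fun z => (hτ0 _).ne').mul (hqc.comp (h2.smul contDiff_fst))
  have hmax : IsLocalMaxOn (fun z => Φ z - ψ z) (Qset n) (y, 1) := by
    have hψy : ψ (y, 1) = φ y := by simp [hψ, hτ1', hqy]
    have ht : Tendsto (fun z : En n × ℝ => (√z.2)⁻¹ • z.1) (𝓝 (y, 1)) (𝓝 y) := by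
      have : ContinuousAt (fun z : En n × ℝ => (√z.2)⁻¹ • z.1) (y, 1) := by
        have h1 : ContinuousAt (fun z : En n × ℝ => √z.2) (y, 1) := by fun_prop
        exact (h1.inv₀ (by simp)).smul continuousAt_fst
      simpa [ContinuousAt] using this
    have hτ2 : ∀ᶠ z : En n × ℝ in 𝓝 (y, 1), τ z.2 = z.2 :=
      (continuous_snd.tendsto (y, (1 : ℝ))).eventually hτ1
    rw [IsLocalMaxOn, IsMaxFilter]
    filter_upwards [mem_nhdsWithin_of_mem_nhds (ht.eventually hle),
      mem_nhdsWithin_of_mem_nhds hτ2, self_mem_nhdsWithin] with z hz hz2 hzQ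
    have hz0 : 0 < z.2 := hzQ
    have h1 : Φ z ≤ ψ z := by
      rw [hself z hzQ]
      simp only [paraExt, hψ, hz2]
      exact mul_le_mul_of_nonneg_left hz (Real.rpow_nonneg hz0.le _)
    change Φ z - ψ z ≤ Φ (y, 1) - ψ (y, 1)
    rw [hψy]
    simp only [hφ]
    linarith
  have hv := hΦ (y, 1) (show (0 : ℝ) < 1 from one_pos) ψ hψc hmax
  have hsh : shess n ψ (y, 1) = hess n q y := by
    have : (fun z => ψ (z, 1)) = q := by ext z; simp [hψ, hτ1']
    simp only [shess, this]
  have hFq : F Y ≤ F (hess n q y) := by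
    have h1 := sj_of_contDiff (f := fun z => -q z) hqc.neg y
    rw [hess_neg, grad_neg] at h1
    exact hF.anti hl (hess_isSymm hqc y) hYs (SJ.compare (sj_quadP hYs (φ y) y p y) h1).2
  have htd : tderiv n ψ (y, 1) = -α * φ y - 1 / 2 * inner ℝ p y := by
    have hs : HasDerivAt (fun s : ℝ => (√s)⁻¹) (-(1 / 2)) 1 := by
      have := (Real.hasDerivAt_sqrt (one_ne_zero (α := ℝ))).fun_inv (by simp)
      simpa using this
    have hp : HasDerivAt (fun s : ℝ => s ^ (-α)) (-α) 1 := by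
      simpa using Real.hasDerivAt_rpow_const (x := 1) (p := -α) (Or.inl one_ne_zero)
    have h1 := hp.mul (((hs.sub_const 1).mul_const (inner ℝ p y)).add
      ((((hs.sub_const 1).pow 2).const_mul (1 / 2 * qf Y y))) |>.const_add (φ y))
    have h2 : HasDerivAt (fun s => ψ (y, s)) (-α * φ y - 1 / 2 * inner ℝ p y) 1 := by
      refine (h1.congr_of_eventuallyEq ?_).congr_deriv ?_
      · filter_upwards [hτ1] with s hs
        simp only [hψ, hs, hq, quadP, Pi.mul_apply, Pi.add_apply, Pi.pow_apply]
        rw [show (√s)⁻¹ • y - y = ((√s)⁻¹ - 1) • y by rw [sub_smul, one_smul],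
          inner_smul_right, qf_vec_smul]
        ring
      · simp; ring
    exact h2.deriv
  rw [hsh, htd] at hv
  have hadd := hF.add_smul_one hX (show 0 ≤ 2 * δ by positivity)
  simp only [Pi.zero_apply]
  linarith

theorem viscSupP_iff {Ω : Set (En n × ℝ)} {F : Mat n → ℝ} {u : En n × ℝ → ℝ} :
    ViscSupP n Ω (fun M _ _ _ => F M) u ↔ ViscSubP n Ω (fun M _ _ _ => dualF F M) (-u) := by
  have key : ∀ (ψ : En n × ℝ → ℝ) p, tderiv n (fun z => -ψ z) p = -tderiv n ψ p ∧
      shess n (fun z => -ψ z) p = -shess n ψ p := fun ψ p =>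
    ⟨deriv.fun_neg, hess_neg (fun z => ψ (z, p.2)) p.1⟩
  constructor
  · intro h p hp ψ hψ hm
    have := h p hp (fun z => -ψ z) hψ.neg (by
      filter_upwards [hm] with z hz; simp only [Pi.neg_apply] at hz ⊢; linarith)
    rw [(key ψ p).1, (key ψ p).2] at this
    simp only [dualF]
    linarith
  · intro h p hp ψ hψ hm
    have := h p hp (fun z => -ψ z) hψ.neg (by
      filter_upwards [hm] with z hz; simp only [Pi.neg_apply] at hz ⊢; linarith)
    rw [(key ψ p).1, (key ψ p).2] at this
    simp only [dualF, neg_neg] at this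
    linarith

theorem sqrt_mul_inv_smul {σ t : ℝ} (hσ : 0 < σ) (x : En n) :
    (√(σ * t))⁻¹ • √σ • x = (√t)⁻¹ • x := by
  have h1 : √σ ≠ 0 := (Real.sqrt_pos.2 hσ).ne'
  rw [smul_smul, Real.sqrt_mul hσ.le, mul_inv, mul_right_comm, inv_mul_cancel₀ h1, one_mul]

theorem isSelfSimilarPlus_paraExt {F : Mat n → ℝ} (hFh : PositivelyHomogeneous n F) {α : ℝ}
    {φ : En n → ℝ} (h : IsProfile F α φ) : IsSelfSimilarPlus n F α (paraExt α φ) := by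
  refine ⟨?_, fun p hp => mul_pos (Real.rpow_pos_of_pos hp _) (h.pos _),
    ⟨viscSubP_paraExt hFh h.sub, viscSupP_iff.2 ?_⟩, fun σ hσ x t ht => ?_, ?_⟩
  · intro p hp
    have hp0 : p.2 ≠ 0 := (show 0 < p.2 from hp).ne'
    have h1 : ContinuousAt (fun z : En n × ℝ => √z.2) p := by fun_prop
    have h2 : ContinuousAt (fun z : En n × ℝ => (√z.2)⁻¹ • z.1) p :=
      (h1.inv₀ (Real.sqrt_pos.2 hp).ne').smul continuousAt_fst
    have h3 : ContinuousAt (fun z : En n × ℝ => z.2 ^ (-α)) p :=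
      continuousAt_snd.rpow_const (Or.inl hp0)
    have h4 : ContinuousAt (fun z : En n × ℝ => φ ((√z.2)⁻¹ • z.1)) p :=
      h.cont.continuousAt.comp h2
    exact (h3.mul h4).continuousWithinAt
  · have h1 := h.sup
    rw [Sup, neg_zero] at h1
    have h2 := viscSubP_paraExt (PositivelyHomogeneous.dual hFh) h1
    have h3 : paraExt α (-φ) = -paraExt α φ := by
      ext p; simp [paraExt]
    rwa [h3] at h2
  · simp only [paraExt]
    rw [sqrt_mul_inv_smul hσ, Real.mul_rpow hσ.le ht.le, ← mul_assoc, ← mul_assoc,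
      ← Real.rpow_add hσ, add_neg_cancel, Real.rpow_zero, one_mul]
  · obtain ⟨C, a, ha, hC⟩ := h.decay
    refine ⟨C, ?_, a, ha, fun x => ?_⟩
    · have := (h.pos 0).trans_le (hC 0)
      exact pos_of_mul_pos_left this (gs_pos a 0).le
    · simpa [paraExt, gs] using hC x

theorem eq_paraExt {α : ℝ} {Φ : En n × ℝ → ℝ}
    (h : ∀ σ : ℝ, 0 < σ → ∀ x : En n, ∀ t : ℝ, 0 < t →
      Φ (x, t) = σ ^ α * Φ (Real.sqrt σ • x, σ * t)) :
    ∀ p ∈ Qset n, Φ p = paraExt α (fun x => Φ (x, 1)) p := by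
  rintro ⟨x, t⟩ ht
  have ht : 0 < t := ht
  rw [h t⁻¹ (inv_pos.2 ht) x t ht, Real.sqrt_inv, inv_mul_cancel₀ ht.ne', Real.inv_rpow ht.le,
    ← Real.rpow_neg ht.le]
  rfl

theorem isProfile_slice (hl : 0 ≤ lam) {F : Mat n → ℝ} (hF : Ell lam Lam F) {α : ℝ}
    {Φ : En n × ℝ → ℝ} (h : IsSelfSimilarPlus n F α Φ) : IsProfile F α fun x => Φ (x, 1) := by
  obtain ⟨hc, hpos, ⟨hsub, hsup⟩, hself, C, -, a, ha, hdec⟩ := h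
  have h1 : ∀ x : En n, (x, (1 : ℝ)) ∈ Qset n := fun x => show (0 : ℝ) < 1 from one_pos
  refine ⟨?_, fun y => hpos _ (h1 y), sub_of_viscSubP hl hF hsub (eq_paraExt hself), ?_,
    C, a, ha, fun y => by simpa [gs] using hdec y⟩
  · exact hc.comp_continuous (by fun_prop) h1
  · rw [Sup, neg_zero]
    refine sub_of_viscSubP hl hF.dual (viscSupP_iff.1 hsup) (Φ := -Φ) fun p hp => ?_
    rw [Pi.neg_apply, eq_paraExt hself p hp]
    simp [paraExt]

theorem isSelfSimilarMinus_iff {F : Mat n → ℝ} {α : ℝ} {Φ : En n × ℝ → ℝ} :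
    IsSelfSimilarMinus n F α Φ ↔ IsSelfSimilarPlus n (dualF F) α (-Φ) := by
  unfold IsSelfSimilarMinus IsSelfSimilarPlus ViscSolP
  rw [viscSupP_iff, viscSupP_iff, dualF_dualF, neg_neg]
  simp only [Pi.neg_apply, neg_pos, mul_neg, neg_inj]
  have : ContinuousOn (-Φ) (Qset n) ↔ ContinuousOn Φ (Qset n) :=
    ⟨fun h => by simpa using h.neg, fun h => h.neg⟩
  rw [this]
  tauto

theorem selfSimilarPlus_unique (hl : 0 < lam) (hL : lam ≤ Lam) {F : Mat n → ℝ}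
    (hF : Ell lam Lam F) (hFh : PositivelyHomogeneous n F) {α₁ α₂ : ℝ} {Φ₁ Φ₂ : En n × ℝ → ℝ}
    (h₁ : IsSelfSimilarPlus n F α₁ Φ₁) (h₂ : IsSelfSimilarPlus n F α₂ Φ₂) (hα : α₁ ≤ α₂) :
    α₁ = α₂ ∧ ∃ c : ℝ, 0 < c ∧ ∀ p ∈ Qset n, Φ₂ p = c * Φ₁ p := by
  obtain ⟨he, c, hc, h⟩ := (isProfile_slice hl.le hF h₁).unique hl hL hF hFh (isProfile_slice hl.le hF h₂) hα
  refine ⟨he, c, hc, fun p hp => ?_⟩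
  rw [eq_paraExt h₁.2.2.2.1 p hp, eq_paraExt h₂.2.2.2.1 p hp, paraExt, paraExt, h, he]
  ring

theorem existsUnique_plus (hn : 1 ≤ n) (hl : 0 < lam) (hL : lam ≤ Lam) {F : Mat n → ℝ}
    (hF : Ell lam Lam F) (hFh : PositivelyHomogeneous n F) :
    ∃! α : ℝ, 0 < α ∧ ∃ Φ : En n × ℝ → ℝ, IsSelfSimilarPlus n F α Φ := by
  obtain ⟨α, hα, φ, hφ⟩ := exists_isProfile hn hl hL hF hFh
  have hΦ := isSelfSimilarPlus_paraExt hFh hφ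
  refine ⟨α, ⟨hα, _, hΦ⟩, ?_⟩
  rintro β ⟨-, Ψ, hΨ⟩
  rcases le_total α β with h | h
  · exact (selfSimilarPlus_unique hl hL hF hFh hΦ hΨ h).1.symm
  · exact (selfSimilarPlus_unique hl hL hF hFh hΨ hΦ h).1

end SelfSim

/-- **Theorem 1.1.** Existence and uniqueness of the anomalous exponents `α⁺, α⁻ > 0` and of the
positive and negative self-similar solutions `Φ⁺ > 0`, `Φ⁻ < 0` of `u_t + F(D²u) = 0`,
the latter unique up to multiplication by a positive constant. -/
theorem existence_self_similar_solutions
    (n : ℕ) (hn : 1 ≤ n) (lam Lam : ℝ) (hlam : 0 < lam) (hLam : lam ≤ Lam)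
    (F : Mat n → ℝ) (hF : UniformlyElliptic n lam Lam F)
    (hFh : PositivelyHomogeneous n F) :
    (∃! α : ℝ, 0 < α ∧ ∃ Φ : En n × ℝ → ℝ, IsSelfSimilarPlus n F α Φ) ∧
    (∃! α : ℝ, 0 < α ∧ ∃ Φ : En n × ℝ → ℝ, IsSelfSimilarMinus n F α Φ) ∧
    (∀ α : ℝ, ∀ Φ₁ Φ₂ : En n × ℝ → ℝ, IsSelfSimilarPlus n F α Φ₁ →
      IsSelfSimilarPlus n F α Φ₂ → ∃ c : ℝ, 0 < c ∧ ∀ p ∈ Qset n, Φ₂ p = c * Φ₁ p) ∧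
    (∀ α : ℝ, ∀ Φ₁ Φ₂ : En n × ℝ → ℝ, IsSelfSimilarMinus n F α Φ₁ →
      IsSelfSimilarMinus n F α Φ₂ → ∃ c : ℝ, 0 < c ∧ ∀ p ∈ Qset n, Φ₂ p = c * Φ₁ p) := by
  have hE := SelfSim.ell_of_uniformlyElliptic hLam hF
  have hFh' := SelfSim.PositivelyHomogeneous.dual hFh
  refine ⟨SelfSim.existsUnique_plus hn hlam hLam hE hFh, ?_,
    fun α Φ₁ Φ₂ h₁ h₂ => (SelfSim.selfSimilarPlus_unique hlam hLam hE hFh h₁ h₂ le_rfl).2,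
    fun α Φ₁ Φ₂ h₁ h₂ => ?_⟩
  · have key : ∀ α, (∃ Φ, IsSelfSimilarMinus n F α Φ) ↔
        ∃ Φ, IsSelfSimilarPlus n (SelfSim.dualF F) α Φ := fun α =>
      ⟨fun ⟨Φ, h⟩ => ⟨-Φ, SelfSim.isSelfSimilarMinus_iff.1 h⟩,
        fun ⟨Φ, h⟩ => ⟨-Φ, SelfSim.isSelfSimilarMinus_iff.2 (by rwa [neg_neg])⟩⟩
    simp only [key]
    exact SelfSim.existsUnique_plus hn hlam hLam hE.dual hFh'
  · obtain ⟨-, c, hc, h⟩ := SelfSim.selfSimilarPlus_unique hlam hLam hE.dual hFh'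
      (SelfSim.isSelfSimilarMinus_iff.1 h₁) (SelfSim.isSelfSimilarMinus_iff.1 h₂) le_rfl
    refine ⟨c, hc, fun p hp => ?_⟩
    have := h p hp
    simp only [Pi.neg_apply] at this
    linarith
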